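/- Let d ≥ 3 be an integer and let u be a classical finite-energy free Coulomb wave on ℝ^d with energy E which is radial in the space variable (u(x,t) depends only on (|x|,t)). Let ℓ : (0,∞) → (0,∞) satisfy ℓ(t)/ln t → +∞ as t → +∞, and let η ∈ ℝ. Then lim_{t→+∞} ∫_{t-ℓ(t)<|x|<t-η} e(x,t) dx = E, where e(x,t) := ½|∇ₓu(x,t)|² + ½|∂ₜu(x,t)|² + |u(x,t)|²/(2|x|) is the energy density. -/

import Mathlib

open MeasureTheory Filter

/-- The Laplacian of `u : ℝ^d → ℝ`, as the sum of second derivatives in the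
coordinate directions. -/
noncomputable def lap {d : ℕ} (u : EuclideanSpace ℝ (Fin d) → ℝ)
    (x : EuclideanSpace ℝ (Fin d)) : ℝ :=
  ∑ i : Fin d, iteratedFDeriv ℝ 2 u x ![EuclideanSpace.single i 1, EuclideanSpace.single i 1]

/-- The energy density `e(x,t) = ½|∇ₓu|² + ½|∂ₜu|² + |u|²/(2|x|)` of the free
Coulomb wave equation. -/
noncomputable def eDenFree {d : ℕ} (u : EuclideanSpace ℝ (Fin d) → ℝ → ℝ)
    (x : EuclideanSpace ℝ (Fin d)) (t : ℝ) : ℝ :=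
  (1 / 2) * ‖gradient (fun y => u y t) x‖ ^ 2
    + (1 / 2) * (deriv (u x) t) ^ 2 + (u x t) ^ 2 / (2 * ‖x‖)

/-- `u` is a classical finite-energy free Coulomb wave with (conserved)
energy `E`: it is continuous on `ℝ^d × ℝ`, `C²` on `(ℝ^d∖{0}) × ℝ`, solves
`∂ₜ²u - Δu + u/|x| = 0` away from `x = 0`, and its total energy equals `E`
at every time. -/
def IsFreeCoulombWave {d : ℕ} (u : EuclideanSpace ℝ (Fin d) → ℝ → ℝ) (E : ℝ) : Prop :=
  Continuous (fun q : EuclideanSpace ℝ (Fin d) × ℝ => u q.1 q.2) ∧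
  ContDiffOn ℝ 2 (fun q : EuclideanSpace ℝ (Fin d) × ℝ => u q.1 q.2)
    ({(0 : EuclideanSpace ℝ (Fin d))}ᶜ ×ˢ Set.univ) ∧
  (∀ x : EuclideanSpace ℝ (Fin d), x ≠ 0 → ∀ t : ℝ,
    deriv (deriv (u x)) t - lap (fun y => u y t) x + u x t / ‖x‖ = 0) ∧
  (∀ t : ℝ, Integrable (fun x => eDenFree u x t)) ∧
  (∀ t : ℝ, ∫ x, eDenFree u x t = E)

section

open Set Topology

/-- Joint continuity of a function of `(r, t)` on `r > 0`. -/
def ContPos (F : ℝ → ℝ → ℝ) : Prop :=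
  ContinuousOn (fun q : ℝ × ℝ => F q.1 q.2) (Ioi 0 ×ˢ univ)

namespace ContPos

variable {F G : ℝ → ℝ → ℝ}

lemma of_continuous (hF : Continuous (fun q : ℝ × ℝ => F q.1 q.2)) : ContPos F :=
  hF.continuousOn

lemma comp_max (hF : ContPos F) {c : ℝ} (hc : 0 < c) :
    Continuous (fun q : ℝ × ℝ => F (max c q.1) q.2) :=
  ContinuousOn.comp_continuous (f := fun q : ℝ × ℝ => (max c q.1, q.2)) hF (by fun_prop)
    (fun _ => ⟨lt_max_of_lt_left hc, trivial⟩)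

lemma of_comp_max (hF : ∀ c : ℝ, 0 < c → Continuous (fun q : ℝ × ℝ => F (max c q.1) q.2)) :
    ContPos F := by
  rintro ⟨r, t⟩ ⟨hr, -⟩
  simp only [mem_Ioi] at hr
  have h := (hF (r / 2) (by positivity)).continuousAt (x := (r, t))
  refine ContinuousAt.continuousWithinAt (h.congr ?_)
  have : ∀ᶠ q : ℝ × ℝ in 𝓝 (r, t), r / 2 < q.1 :=
    continuousAt_fst.eventually (lt_mem_nhds (by simpa using hr))
  filter_upwards [this] with q hq
  rw [max_eq_right hq.le]

lemma of_fst {f : ℝ → ℝ} (hf : ContinuousOn f (Ioi 0)) : ContPos (fun r _ => f r) :=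
  hf.comp continuousOn_fst (fun _ h => h.1)

lemma add (hF : ContPos F) (hG : ContPos G) : ContPos (fun r t => F r t + G r t) :=
  ContinuousOn.add hF hG

lemma sub (hF : ContPos F) (hG : ContPos G) : ContPos (fun r t => F r t - G r t) :=
  ContinuousOn.sub hF hG

lemma mul (hF : ContPos F) (hG : ContPos G) : ContPos (fun r t => F r t * G r t) :=
  ContinuousOn.mul hF hG

lemma neg (hF : ContPos F) : ContPos (fun r t => - F r t) :=
  ContinuousOn.neg hF

lemma pow (hF : ContPos F) (n : ℕ) : ContPos (fun r t => F r t ^ n) :=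
  ContinuousOn.pow hF n

lemma const (k : ℝ) : ContPos (fun _ _ => k) := continuousOn_const

lemma const_mul (hF : ContPos F) (k : ℝ) : ContPos (fun r t => k * F r t) :=
  (const k).mul hF

lemma shift (hF : ContPos F) (s : ℝ) : ContPos (fun r t => F r (t + s)) :=
  ContinuousOn.comp (g := fun q : ℝ × ℝ => F q.1 q.2) (f := fun q : ℝ × ℝ => (q.1, q.2 + s)) hF
    (by fun_prop) (fun _ h => ⟨h.1, trivial⟩)

lemma continuousOn_fst (hF : ContPos F) (t : ℝ) : ContinuousOn (fun r => F r t) (Ioi 0) :=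
  ContinuousOn.comp (g := fun q : ℝ × ℝ => F q.1 q.2) (f := fun r : ℝ => (r, t)) hF
    (by fun_prop) (fun _ h => ⟨h, trivial⟩)

lemma continuous_snd (hF : ContPos F) {r : ℝ} (hr : 0 < r) : Continuous (F r) :=
  ContinuousOn.comp_continuous (g := fun q : ℝ × ℝ => F q.1 q.2) (f := fun t : ℝ => (r, t)) hF
    (by fun_prop) (fun _ => ⟨hr, trivial⟩)

lemma intervalIntegrable (hF : ContPos F) (t : ℝ) {c d : ℝ} (hc : 0 < c) (hcd : c ≤ d) :
    IntervalIntegrable (fun r => F r t) volume c d := by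
  apply ContinuousOn.intervalIntegrable
  rw [uIcc_of_le hcd]
  exact (hF.continuousOn_fst t).mono (fun x hx => hc.trans_le hx.1)

lemma integral_comp_max {c d : ℝ} (hcd : c ≤ d) (t : ℝ) :
    ∫ r in c..d, F (max c r) t = ∫ r in c..d, F r t := by
  apply intervalIntegral.integral_congr
  intro r hr
  rw [uIcc_of_le hcd] at hr
  simp [max_eq_right hr.1]

lemma continuous_integral (hF : ContPos F) {c d : ℝ} (hc : 0 < c) (hcd : c ≤ d) :
    Continuous (fun t => ∫ r in c..d, F r t) := by
  simp_rw [← integral_comp_max (F := F) hcd]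
  apply intervalIntegral.continuous_parametric_intervalIntegral_of_continuous'
  exact (hF.comp_max hc).comp continuous_swap

lemma integral_swap (hF : ContPos F) {c d : ℝ} (hc : 0 < c) (hcd : c ≤ d) {s t : ℝ}
    (hst : s ≤ t) :
    ∫ r in c..d, ∫ τ in s..t, F r τ = ∫ τ in s..t, ∫ r in c..d, F r τ := by
  have h := (hF.comp_max hc)
  have h1 : ∫ r in c..d, ∫ τ in s..t, F r τ = ∫ r in c..d, ∫ τ in s..t, F (max c r) τ := by
    apply intervalIntegral.integral_congr
    intro r hr
    rw [uIcc_of_le hcd] at hr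
    simp [max_eq_right hr.1]
  simp_rw [h1, ← integral_comp_max (F := F) hcd]
  simp_rw [intervalIntegral.integral_of_le hcd, intervalIntegral.integral_of_le hst]
  apply integral_integral_swap
  rw [Measure.prod_restrict]
  have : IntegrableOn (fun q : ℝ × ℝ => F (max c q.1) q.2) (Icc c d ×ˢ Icc s t)
      (volume.prod volume) :=
    h.continuousOn.integrableOn_compact (isCompact_Icc.prod isCompact_Icc)
  exact this.mono_set (prod_mono Ioc_subset_Icc_self Ioc_subset_Icc_self)

lemma intervalIntegrable_integral (hF : ContPos F) {c d : ℝ} (hc : 0 < c) (hcd : c ≤ d)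
    (s t : ℝ) : IntervalIntegrable (fun τ => ∫ r in c..d, F r τ) volume s t :=
  (hF.continuous_integral hc hcd).intervalIntegrable _ _

lemma intervalIntegrable_integral_snd (hF : ContPos F) {c d : ℝ} (hc : 0 < c) (hcd : c ≤ d)
    (s t : ℝ) : IntervalIntegrable (fun r => ∫ τ in s..t, F r τ) volume c d := by
  have : Continuous (fun r => ∫ τ in s..t, F (max c r) τ) :=
    intervalIntegral.continuous_parametric_intervalIntegral_of_continuous' (hF.comp_max hc) _ _
  refine (this.intervalIntegrable c d).congr_ae ?_
  refine (ae_restrict_mem measurableSet_uIoc).mono fun r hr => ?_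
  rw [uIoc_of_le hcd] at hr
  simp [max_eq_right hr.1.le]

end ContPos

lemma rect_identity {G H Gt Hr S : ℝ → ℝ → ℝ} {c d s t : ℝ} (hc : 0 < c) (hcd : c ≤ d)
    (hst : s ≤ t) (hGc : ContPos G) (hGt : ContPos Gt) (hHr : ContPos Hr)
    (hG : ∀ r τ, 0 < r → HasDerivAt (G r) (Gt r τ) τ)
    (hH : ∀ r τ, 0 < r → HasDerivAt (fun x => H x τ) (Hr r τ) r)
    (hS : ∀ r τ, 0 < r → Gt r τ = Hr r τ + S r τ)
    (hHc : ∀ τ, H c τ = 0) (hHd : ∀ τ, H d τ = 0) :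
    ∫ r in c..d, G r t = (∫ r in c..d, G r s) + ∫ τ in s..t, ∫ r in c..d, S r τ := by
  have hd : 0 < d := hc.trans_le hcd
  have e1 : ∫ r in c..d, (G r t - G r s) = ∫ r in c..d, ∫ τ in s..t, Gt r τ := by
    apply intervalIntegral.integral_congr
    intro r hr
    rw [uIcc_of_le hcd] at hr
    have hr0 := hc.trans_le hr.1
    exact (intervalIntegral.integral_eq_sub_of_hasDerivAt (fun τ _ => hG r τ hr0)
      ((hGt.continuous_snd hr0).intervalIntegrable _ _)).symm
  rw [intervalIntegral.integral_sub (hGc.intervalIntegrable t hc hcd)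
    (hGc.intervalIntegrable s hc hcd), hGt.integral_swap hc hcd hst] at e1
  have e2 : ∫ τ in s..t, ∫ r in c..d, Gt r τ = ∫ τ in s..t, ∫ r in c..d, S r τ := by
    apply intervalIntegral.integral_congr
    intro τ _
    have h0 : ∫ r in c..d, Hr r τ = 0 := by
      rw [intervalIntegral.integral_eq_sub_of_hasDerivAt (f := fun x => H x τ) _
        (hHr.intervalIntegrable τ hc hcd)]
      · simp [hHc, hHd]
      · intro r hr
        rw [uIcc_of_le hcd] at hr
        exact hH r τ (hc.trans_le hr.1)
    have : ∫ r in c..d, S r τ = ∫ r in c..d, (Gt r τ - Hr r τ) := by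
      apply intervalIntegral.integral_congr
      intro r hr
      rw [uIcc_of_le hcd] at hr
      have := hS r τ (hc.trans_le hr.1)
      simp only []
      linarith
    simp only []
    rw [this, intervalIntegral.integral_sub (hGt.intervalIntegrable τ hc hcd)
      (hHr.intervalIntegrable τ hc hcd), h0, sub_zero]
  linarith

/-- Bump profile: the derivative of `ramp`. -/
noncomputable def bump (x : ℝ) : ℝ := 6 * max 0 (x * (1 - x))

/-- A `C¹` monotone step from `0` (on `x ≤ 0`) to `1` (on `x ≥ 1`). -/
noncomputable def ramp (x : ℝ) : ℝ := ∫ y in (0 : ℝ)..x, bump y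

@[fun_prop]
lemma continuous_bump : Continuous bump := by unfold bump; fun_prop

lemma hasDerivAt_ramp (x : ℝ) : HasDerivAt ramp (bump x) x :=
  intervalIntegral.integral_hasDerivAt_right (continuous_bump.intervalIntegrable _ _)
    (continuous_bump.stronglyMeasurableAtFilter _ _) continuous_bump.continuousAt

@[fun_prop]
lemma continuous_ramp : Continuous ramp :=
  continuous_iff_continuousAt.2 fun x => (hasDerivAt_ramp x).continuousAt

lemma bump_nonneg (x : ℝ) : 0 ≤ bump x := by unfold bump; positivity

lemma bump_le (x : ℝ) : bump x ≤ 2 := by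
  unfold bump
  have : max 0 (x * (1 - x)) ≤ 1 / 4 := max_le (by norm_num) (by nlinarith [sq_nonneg (x - 1 / 2)])
  linarith

lemma bump_of_nonpos {x : ℝ} (hx : x ≤ 0) : bump x = 0 := by
  unfold bump
  rw [max_eq_left (by nlinarith)]; simp

lemma bump_of_one_le {x : ℝ} (hx : 1 ≤ x) : bump x = 0 := by
  unfold bump
  rw [max_eq_left (by nlinarith)]; simp

lemma le_bump {x : ℝ} (h1 : 1 / 3 ≤ x) (h2 : x ≤ 2 / 3) : 1 ≤ bump x := by
  unfold bump
  have : x * (1 - x) ≤ max 0 (x * (1 - x)) := le_max_right _ _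
  nlinarith

lemma monotone_ramp : Monotone ramp :=
  monotone_of_hasDerivAt_nonneg hasDerivAt_ramp bump_nonneg

lemma ramp_of_nonpos {x : ℝ} (hx : x ≤ 0) : ramp x = 0 := by
  unfold ramp
  rw [intervalIntegral.integral_congr (g := fun _ => (0 : ℝ))]
  · simp
  · intro y hy
    rw [uIcc_of_ge hx] at hy
    exact bump_of_nonpos hy.2

lemma ramp_one : ramp 1 = 1 := by
  unfold ramp
  rw [intervalIntegral.integral_congr (g := fun y => 6 * y - 6 * y ^ 2)]
  · rw [intervalIntegral.integral_sub (by apply Continuous.intervalIntegrable; fun_prop)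
      (by apply Continuous.intervalIntegrable; fun_prop)]
    rw [intervalIntegral.integral_const_mul, intervalIntegral.integral_const_mul, integral_id,
      integral_pow]
    norm_num
  · intro y hy
    rw [uIcc_of_le zero_le_one] at hy
    simp only [bump]
    rw [max_eq_right (by nlinarith [hy.1, hy.2])]; ring

lemma ramp_of_one_le {x : ℝ} (hx : 1 ≤ x) : ramp x = 1 := by
  have h : ramp x = ramp 1 + ∫ y in (1 : ℝ)..x, bump y := by
    unfold ramp
    rw [intervalIntegral.integral_add_adjacent_intervals] <;>
      exact continuous_bump.intervalIntegrable _ _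
  rw [h, ramp_one, intervalIntegral.integral_congr (g := fun _ => (0 : ℝ))]
  · simp
  · intro y hy
    rw [uIcc_of_le hx] at hy
    exact bump_of_one_le hy.1

lemma ramp_nonneg (x : ℝ) : 0 ≤ ramp x := by
  rcases le_total x 0 with h | h
  · exact (ramp_of_nonpos h).ge
  · exact (ramp_of_nonpos le_rfl).ge.trans (monotone_ramp h)

lemma ramp_le_one (x : ℝ) : ramp x ≤ 1 := by
  rcases le_total x 1 with h | h
  · exact (monotone_ramp h).trans ramp_one.le
  · exact (ramp_of_one_le h).le

lemma hasDerivAt_integral_param {F F' : ℝ → ℝ → ℝ} {s : Set ℝ} {x₀ : ℝ} (hs : s ∈ 𝓝 x₀)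
    (hF : ContinuousOn (fun q : ℝ × ℝ => F q.1 q.2) (s ×ˢ univ))
    (hF' : ContinuousOn (fun q : ℝ × ℝ => F' q.1 q.2) (s ×ˢ univ))
    (h : ∀ x ∈ s, ∀ θ, HasDerivAt (fun x => F x θ) (F' x θ) x) :
    HasDerivAt (fun x => ∫ θ in (0 : ℝ)..1, F x θ) (∫ θ in (0 : ℝ)..1, F' x₀ θ) x₀ := by
  obtain ⟨δ, hδ, hball⟩ := Metric.nhds_basis_closedBall.mem_iff.1 hs
  have hc : ∀ {K : ℝ → ℝ → ℝ}, ContinuousOn (fun q : ℝ × ℝ => K q.1 q.2) (s ×ˢ univ) →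
      ∀ x ∈ s, Continuous (K x) := fun {K} hK x hx =>
    ContinuousOn.comp_continuous (g := fun q : ℝ × ℝ => K q.1 q.2) (f := fun t : ℝ => (x, t)) hK
      (by fun_prop) (fun _ => ⟨hx, trivial⟩)
  obtain ⟨C, hC⟩ := ((isCompact_closedBall x₀ δ).prod (isCompact_Icc (a := (0 : ℝ)) (b := 1))).exists_bound_of_continuousOn
    (hF'.mono (prod_mono hball (subset_univ _)))
  refine (intervalIntegral.hasDerivAt_integral_of_dominated_loc_of_deriv_le (F := F) (F' := F')
    (bound := fun _ => C) (Metric.closedBall_mem_nhds x₀ hδ) ?_ ?_ ?_ ?_ ?_ ?_).2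
  · filter_upwards [hs] with x hx
    exact (hc hF x hx).aestronglyMeasurable
  · exact (hc hF x₀ (mem_of_mem_nhds hs)).intervalIntegrable _ _
  · exact (hc hF' x₀ (mem_of_mem_nhds hs)).aestronglyMeasurable
  · refine Eventually.of_forall fun θ hθ x hx => hC (x, θ) ⟨hx, ?_⟩
    rw [uIoc_of_le zero_le_one] at hθ
    exact ⟨hθ.1.le, hθ.2⟩
  · exact continuous_const.intervalIntegrable _ _
  · exact Eventually.of_forall fun θ _ x hx => h x (hball hx) θ

/-- Cauchy–Schwarz for averages over `[0, 1]`. -/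
lemma sq_integral_le {f : ℝ → ℝ} (hf : Continuous f) :
    (∫ θ in (0 : ℝ)..1, f θ) ^ 2 ≤ ∫ θ in (0 : ℝ)..1, f θ ^ 2 := by
  set A := ∫ θ in (0 : ℝ)..1, f θ
  have h : 0 ≤ ∫ θ in (0 : ℝ)..1, (f θ - A) ^ 2 :=
    intervalIntegral.integral_nonneg zero_le_one fun _ _ => sq_nonneg _
  have e : ∫ θ in (0 : ℝ)..1, (f θ - A) ^ 2
      = (∫ θ in (0 : ℝ)..1, f θ ^ 2) - A ^ 2 := by
    have : ∀ θ, (f θ - A) ^ 2 = f θ ^ 2 - (2 * A) * f θ + A ^ 2 := fun θ => by ring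
    simp_rw [this]
    rw [intervalIntegral.integral_add (by apply Continuous.intervalIntegrable; fun_prop)
      (by apply Continuous.intervalIntegrable; fun_prop),
      intervalIntegral.integral_sub (by apply Continuous.intervalIntegrable; fun_prop)
      (by apply Continuous.intervalIntegrable; fun_prop), intervalIntegral.integral_const_mul]
    simp
    ring
  linarith

/-- The effective potential `m(m-1)/r² + 1/r` on the half line. -/
noncomputable def effPot (m r : ℝ) : ℝ := m * (m - 1) / r ^ 2 + 1 / r

/-- Minus the derivative of `effPot`. -/
noncomputable def effForce (m r : ℝ) : ℝ := 2 * (m * (m - 1)) / r ^ 3 + 1 / r ^ 2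

/-- A classical solution `w` of `w_tt - w_rr + (m(m-1)/r² + 1/r) w = 0` on `r > 0`, with
`a = w_r`, `b = w_t`, `ar = w_rr`, `c = w_rt`, and `w = O(r^m)` at the origin. -/
structure RadialWave (m : ℝ) where
  w : ℝ → ℝ → ℝ
  a : ℝ → ℝ → ℝ
  b : ℝ → ℝ → ℝ
  ar : ℝ → ℝ → ℝ
  c : ℝ → ℝ → ℝ
  w_r : ∀ r t, 0 < r → HasDerivAt (fun x => w x t) (a r t) r
  w_t : ∀ r t, 0 < r → HasDerivAt (w r) (b r t) t
  a_r : ∀ r t, 0 < r → HasDerivAt (fun x => a x t) (ar r t) r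
  a_t : ∀ r t, 0 < r → HasDerivAt (a r) (c r t) t
  b_r : ∀ r t, 0 < r → HasDerivAt (fun x => b x t) (c r t) r
  b_t : ∀ r t, 0 < r → HasDerivAt (b r) (ar r t - effPot m r * w r t) t
  cont_w : ContPos w
  cont_a : ContPos a
  cont_b : ContPos b
  cont_ar : ContPos ar
  cont_c : ContPos c
  near : ∀ T : ℝ, ∃ C, ∀ r t, 0 < r → r ≤ 1 → |t| ≤ T → |w r t| ≤ C * r ^ m

/-- All integrals of `F` over compact subintervals of `(0, ∞)` are at most `K`. -/
def IntLe (F : ℝ → ℝ) (K : ℝ) : Prop :=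
  ∀ c d, 0 < c → c ≤ d → ∫ r in c..d, F r ≤ K

lemma effPot_nonneg {m r : ℝ} (hm : 1 ≤ m) (hr : 0 < r) : 0 ≤ effPot m r := by
  unfold effPot
  have : 0 ≤ m * (m - 1) := mul_nonneg (by linarith) (by linarith)
  positivity

lemma inv_le_effPot {m r : ℝ} (hm : 1 ≤ m) (hr : 0 < r) : 1 / r ≤ effPot m r := by
  unfold effPot
  have : 0 ≤ m * (m - 1) := mul_nonneg (by linarith) (by linarith)
  have : 0 ≤ m * (m - 1) / r ^ 2 := by positivity
  linarith

lemma inv_sq_le_effForce {m r : ℝ} (hm : 1 ≤ m) (hr : 0 < r) : 1 / r ^ 2 ≤ effForce m r := by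
  unfold effForce
  have : 0 ≤ m * (m - 1) := mul_nonneg (by linarith) (by linarith)
  have : 0 ≤ 2 * (m * (m - 1)) / r ^ 3 := by positivity
  linarith

lemma effForce_nonneg {m r : ℝ} (hm : 1 ≤ m) (hr : 0 < r) : 0 ≤ effForce m r :=
  le_trans (by positivity) (inv_sq_le_effForce hm hr)

lemma hasDerivAt_effPot (m : ℝ) {r : ℝ} (hr : 0 < r) :
    HasDerivAt (effPot m) (-effForce m r) r := by
  have h1 : HasDerivAt (fun x : ℝ => m * (m - 1) / x ^ 2 + 1 / x) _ r :=
    ((hasDerivAt_const r (m * (m - 1))).div (hasDerivAt_pow 2 r) (by positivity)).add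
      ((hasDerivAt_const r (1 : ℝ)).div (hasDerivAt_id r) hr.ne')
  refine h1.congr_deriv ?_
  unfold effForce
  field_simp
  ring

lemma contPos_effPot (m : ℝ) : ContPos (fun r _ => effPot m r) :=
  ContPos.of_fst fun _ hr => (hasDerivAt_effPot m hr).continuousAt.continuousWithinAt

lemma contPos_effForce (m : ℝ) : ContPos (fun r _ => effForce m r) := by
  refine ContPos.of_fst fun r hr => ContinuousAt.continuousWithinAt ?_
  have : r ≠ 0 := ne_of_gt hr
  unfold effForce
  fun_prop (disch := positivity)

namespace RadialWave

variable {m : ℝ} (z : RadialWave m)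

/-- Energy density. -/
noncomputable def e (r t : ℝ) : ℝ :=
  (z.a r t ^ 2 + z.b r t ^ 2 + effPot m r * z.w r t ^ 2) / 2

/-- Momentum density. -/
def p (r t : ℝ) : ℝ := z.a r t * z.b r t

/-- `w_t = O(r^m)` at the origin, locally uniformly in time. -/
def Reg : Prop := ∀ T : ℝ, ∃ C, ∀ r t, 0 < r → r ≤ 1 → |t| ≤ T → |z.b r t| ≤ C * r ^ m

/-- The energy is bounded by `M` at all times. -/
def Bdd (M : ℝ) : Prop := ∀ t, IntLe (fun r => z.e r t) M

lemma cont_e : ContPos z.e := by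
  have := (((z.cont_a.pow 2).add (z.cont_b.pow 2)).add
    ((contPos_effPot m).mul (z.cont_w.pow 2))).mul (ContPos.const (1 / 2))
  refine this.congr fun q _ => ?_
  simp only [e]; ring

lemma cont_p : ContPos z.p := z.cont_a.mul z.cont_b

lemma e_nonneg (hm : 1 ≤ m) {r : ℝ} (hr : 0 < r) (t : ℝ) : 0 ≤ z.e r t := by
  have := effPot_nonneg hm hr
  unfold e; positivity

lemma e_add_p (r t : ℝ) :
    z.e r t + z.p r t = ((z.a r t + z.b r t) ^ 2 + effPot m r * z.w r t ^ 2) / 2 := by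
  unfold e p; ring

lemma e_sub_p (r t : ℝ) :
    z.e r t - z.p r t = ((z.a r t - z.b r t) ^ 2 + effPot m r * z.w r t ^ 2) / 2 := by
  unfold e p; ring

lemma e_add_p_nonneg (hm : 1 ≤ m) {r : ℝ} (hr : 0 < r) (t : ℝ) : 0 ≤ z.e r t + z.p r t := by
  have := effPot_nonneg hm hr
  rw [e_add_p]; positivity

lemma e_sub_p_nonneg (hm : 1 ≤ m) {r : ℝ} (hr : 0 < r) (t : ℝ) : 0 ≤ z.e r t - z.p r t := by
  have := effPot_nonneg hm hr
  rw [e_sub_p]; positivity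

lemma pot_le_e (r t : ℝ) : effPot m r * z.w r t ^ 2 ≤ 2 * z.e r t := by
  unfold e; nlinarith [sq_nonneg (z.a r t), sq_nonneg (z.b r t)]

lemma pot_le_e_add_p (r t : ℝ) :
    effPot m r * z.w r t ^ 2 ≤ 2 * (z.e r t + z.p r t) := by
  rw [e_add_p]; nlinarith [sq_nonneg (z.a r t + z.b r t)]

lemma hasDerivAt_e_t {r : ℝ} (hr : 0 < r) (t : ℝ) :
    HasDerivAt (z.e r) (z.c r t * z.a r t + z.ar r t * z.b r t) t := by
  have h := (((z.a_t r t hr).pow 2).add ((z.b_t r t hr).pow 2)).add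
    (((z.w_t r t hr).pow 2).const_mul (effPot m r))
  refine (h.div_const 2).congr_deriv ?_
  push_cast
  ring

lemma hasDerivAt_p_t {r : ℝ} (hr : 0 < r) (t : ℝ) :
    HasDerivAt (z.p r) (z.c r t * z.b r t + z.a r t * (z.ar r t - effPot m r * z.w r t)) t :=
  (z.a_t r t hr).mul (z.b_t r t hr)

lemma hasDerivAt_p_r {r : ℝ} (hr : 0 < r) (t : ℝ) :
    HasDerivAt (fun x => z.p x t) (z.ar r t * z.b r t + z.a r t * z.c r t) r :=
  (z.a_r r t hr).mul (z.b_r r t hr)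

/-- The flux of `p`: `(w_r² + w_t² - V w²)/2`. -/
noncomputable def s (r t : ℝ) : ℝ :=
  (z.a r t ^ 2 + z.b r t ^ 2 - effPot m r * z.w r t ^ 2) / 2

lemma cont_s : ContPos z.s := by
  have := (((z.cont_a.pow 2).add (z.cont_b.pow 2)).sub
    ((contPos_effPot m).mul (z.cont_w.pow 2))).mul (ContPos.const (1 / 2))
  refine this.congr fun q _ => ?_
  simp only [s]; ring

lemma hasDerivAt_s_r {r : ℝ} (hr : 0 < r) (t : ℝ) :
    HasDerivAt (fun x => z.s x t) (z.a r t * z.ar r t + z.b r t * z.c r t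
      - effPot m r * z.w r t * z.a r t + effForce m r * z.w r t ^ 2 / 2) r := by
  have h := (((z.a_r r t hr).pow 2).add ((z.b_r r t hr).pow 2)).sub
    ((hasDerivAt_effPot m hr).mul ((z.w_r r t hr).pow 2))
  refine (h.div_const 2).congr_deriv ?_
  push_cast
  simp only [Pi.pow_apply]
  ring

end RadialWave

/-- A `C¹` function with values in `[0, 1]`. -/
structure Profile where
  v : ℝ → ℝ
  d : ℝ → ℝ
  hd : ∀ x, HasDerivAt v (d x) x
  cont : Continuous d
  nonneg : ∀ x, 0 ≤ v x
  le_one : ∀ x, v x ≤ 1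

namespace Profile

lemma continuous (φ : Profile) : Continuous φ.v :=
  continuous_iff_continuousAt.2 fun x => (φ.hd x).continuousAt

/-- The zero profile. -/
def zero : Profile where
  v := fun _ => 0
  d := fun _ => 0
  hd := fun x => hasDerivAt_const x 0
  cont := continuous_const
  nonneg := fun _ => le_rfl
  le_one := fun _ => zero_le_one

/-- The constant profile `1`. -/
def one : Profile where
  v := fun _ => 1
  d := fun _ => 0
  hd := fun x => hasDerivAt_const x 1
  cont := continuous_const
  nonneg := fun _ => zero_le_one
  le_one := fun _ => le_rfl

/-- Step from `0` (at `s`) up to `1` (at `s + l`). -/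
noncomputable def up (s l : ℝ) : Profile where
  v := fun x => ramp ((x - s) / l)
  d := fun x => bump ((x - s) / l) / l
  hd := fun x => by
    have := (hasDerivAt_ramp ((x - s) / l)).comp x (((hasDerivAt_id x).sub_const s).div_const l)
    exact this.congr_deriv (by ring)
  cont := by fun_prop
  nonneg := fun _ => ramp_nonneg _
  le_one := fun _ => ramp_le_one _

/-- Step from `1` (at `s`) down to `0` (at `s + l`). -/
noncomputable def down (s l : ℝ) : Profile where
  v := fun x => 1 - ramp ((x - s) / l)
  d := fun x => -(bump ((x - s) / l) / l)
  hd := fun x => ((up s l).hd x).const_sub 1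
  cont := (up s l).cont.neg
  nonneg := fun _ => sub_nonneg.2 (ramp_le_one _)
  le_one := fun _ => sub_le_self _ (ramp_nonneg _)

lemma contPos_sub {g : ℝ → ℝ} (hg : Continuous g) : ContPos (fun r t => g (t - r)) :=
  ContPos.of_continuous (by fun_prop)

lemma contPos_add {g : ℝ → ℝ} (hg : Continuous g) : ContPos (fun r t => g (t + r)) :=
  ContPos.of_continuous (by fun_prop)

end Profile

namespace RadialWave

variable {m : ℝ} (z : RadialWave m)

/-- Weighted energy density with weights `ψ(t-r)` on the energy, `f(t-r)` on its outgoing part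
and `k(t+r)` on its incoming part. -/
noncomputable def q (ψ f k : Profile) (r t : ℝ) : ℝ :=
  ψ.v (t - r) * z.e r t + f.v (t - r) * (z.e r t - z.p r t) + k.v (t + r) * (z.e r t + z.p r t)

lemma cont_q (ψ f k : Profile) : ContPos (z.q ψ f k) :=
  (((Profile.contPos_sub ψ.continuous).mul z.cont_e).add
    ((Profile.contPos_sub f.continuous).mul (z.cont_e.sub z.cont_p))).add
    ((Profile.contPos_add k.continuous).mul (z.cont_e.add z.cont_p))

lemma q_nonneg (hm : 1 ≤ m) (ψ f k : Profile) {r : ℝ} (hr : 0 < r) (t : ℝ) :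
    0 ≤ z.q ψ f k r t :=
  add_nonneg (add_nonneg (mul_nonneg (ψ.nonneg _) (z.e_nonneg hm hr t))
    (mul_nonneg (f.nonneg _) (z.e_sub_p_nonneg hm hr t)))
    (mul_nonneg (k.nonneg _) (z.e_add_p_nonneg hm hr t))

/-- The flux matching `q`. -/
noncomputable def j (ψ f k : Profile) (r t : ℝ) : ℝ :=
  (ψ.v (t - r) + f.v (t - r) + k.v (t + r)) * z.p r t + (k.v (t + r) - f.v (t - r)) * z.s r t

lemma cont_j (ψ f k : Profile) : ContPos (z.j ψ f k) :=
  ((((Profile.contPos_sub ψ.continuous).add (Profile.contPos_sub f.continuous)).add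
    (Profile.contPos_add k.continuous)).mul z.cont_p).add
    (((Profile.contPos_add k.continuous).sub (Profile.contPos_sub f.continuous)).mul z.cont_s)

/-- Source with a good sign. -/
noncomputable def good (ψ f k : Profile) (r t : ℝ) : ℝ :=
  -ψ.d (t - r) * (z.e r t + z.p r t)
    + (k.v (t + r) - f.v (t - r)) * (effForce m r * z.w r t ^ 2 / 2)

/-- Source with a bad sign. -/
noncomputable def bad (f k : Profile) (r t : ℝ) : ℝ :=
  (f.d (t - r) + k.d (t + r)) * (effPot m r * z.w r t ^ 2)

lemma cont_forceTerm : ContPos (fun r t => effForce m r * z.w r t ^ 2 / 2) := by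
  have := ((contPos_effForce m).mul (z.cont_w.pow 2)).mul (ContPos.const (1 / 2))
  refine this.congr fun q _ => ?_
  simp only []; ring

lemma cont_potTerm : ContPos (fun r t => effPot m r * z.w r t ^ 2) :=
  (contPos_effPot m).mul (z.cont_w.pow 2)

lemma cont_good (ψ f k : Profile) : ContPos (z.good ψ f k) :=
  ((Profile.contPos_sub ψ.cont).neg.mul (z.cont_e.add z.cont_p)).add
    (((Profile.contPos_add k.continuous).sub (Profile.contPos_sub f.continuous)).mul
      z.cont_forceTerm)

lemma cont_bad (f k : Profile) : ContPos (z.bad f k) :=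
  ((Profile.contPos_sub f.cont).add (Profile.contPos_add k.cont)).mul z.cont_potTerm

lemma hasDerivAt_sub_right (φ : Profile) (r t : ℝ) :
    HasDerivAt (fun τ => φ.v (τ - r)) (φ.d (t - r)) t := by
  exact ((φ.hd (t - r)).comp t ((hasDerivAt_id t).sub_const r)).congr_deriv (by ring)

lemma hasDerivAt_sub_left (φ : Profile) (r t : ℝ) :
    HasDerivAt (fun x => φ.v (t - x)) (-φ.d (t - r)) r := by
  exact ((φ.hd (t - r)).comp r ((hasDerivAt_id r).const_sub t)).congr_deriv (by ring)

lemma hasDerivAt_add_right (φ : Profile) (r t : ℝ) :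
    HasDerivAt (fun τ => φ.v (τ + r)) (φ.d (t + r)) t := by
  exact ((φ.hd (t + r)).comp t ((hasDerivAt_id t).add_const r)).congr_deriv (by ring)

lemma hasDerivAt_add_left (φ : Profile) (r t : ℝ) :
    HasDerivAt (fun x => φ.v (t + x)) (φ.d (t + r)) r := by
  exact ((φ.hd (t + r)).comp r ((hasDerivAt_id r).const_add t)).congr_deriv (by ring)

/-- Time derivative of `q`. -/
noncomputable def qt (ψ f k : Profile) (r t : ℝ) : ℝ :=
  let et := z.c r t * z.a r t + z.ar r t * z.b r t
  let pt := z.c r t * z.b r t + z.a r t * (z.ar r t - effPot m r * z.w r t)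
  (ψ.d (t - r) * z.e r t + ψ.v (t - r) * et)
    + (f.d (t - r) * (z.e r t - z.p r t) + f.v (t - r) * (et - pt))
    + (k.d (t + r) * (z.e r t + z.p r t) + k.v (t + r) * (et + pt))

lemma hasDerivAt_q_t (ψ f k : Profile) {r : ℝ} (hr : 0 < r) (t : ℝ) :
    HasDerivAt (z.q ψ f k r) (z.qt ψ f k r t) t := by
  have he := z.hasDerivAt_e_t hr t
  have hp := z.hasDerivAt_p_t hr t
  exact (((hasDerivAt_sub_right ψ r t).mul he).add
    ((hasDerivAt_sub_right f r t).mul (he.sub hp))).add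
    ((hasDerivAt_add_right k r t).mul (he.add hp))

/-- Space derivative of `j`. -/
noncomputable def jr (ψ f k : Profile) (r t : ℝ) : ℝ :=
  let pr := z.ar r t * z.b r t + z.a r t * z.c r t
  let sr := z.a r t * z.ar r t + z.b r t * z.c r t
      - effPot m r * z.w r t * z.a r t + effForce m r * z.w r t ^ 2 / 2
  (-ψ.d (t - r) + -f.d (t - r) + k.d (t + r)) * z.p r t
    + (ψ.v (t - r) + f.v (t - r) + k.v (t + r)) * pr
    + ((k.d (t + r) - -f.d (t - r)) * z.s r t + (k.v (t + r) - f.v (t - r)) * sr)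

lemma hasDerivAt_j_r (ψ f k : Profile) {r : ℝ} (hr : 0 < r) (t : ℝ) :
    HasDerivAt (fun x => z.j ψ f k x t) (z.jr ψ f k r t) r := by
  have hp := z.hasDerivAt_p_r hr t
  have hs := z.hasDerivAt_s_r hr t
  exact ((((hasDerivAt_sub_left ψ r t).add (hasDerivAt_sub_left f r t)).add
    (hasDerivAt_add_left k r t)).mul hp).add
    (((hasDerivAt_add_left k r t).sub (hasDerivAt_sub_left f r t)).mul hs)

lemma qt_eq (ψ f k : Profile) (r t : ℝ) :
    z.qt ψ f k r t = z.jr ψ f k r t + (z.bad f k r t - z.good ψ f k r t) := by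
  simp only [qt, jr, bad, good, e, p, s]
  ring

lemma cont_qt (ψ f k : Profile) : ContPos (z.qt ψ f k) := by
  have h1 := Profile.contPos_sub ψ.continuous
  have h2 := Profile.contPos_sub ψ.cont
  have h3 := Profile.contPos_sub f.continuous
  have h4 := Profile.contPos_sub f.cont
  have h5 := Profile.contPos_add k.continuous
  have h6 := Profile.contPos_add k.cont
  have he := z.cont_e
  have hp := z.cont_p
  have et := (z.cont_c.mul z.cont_a).add (z.cont_ar.mul z.cont_b)
  have pt := (z.cont_c.mul z.cont_b).add
    (z.cont_a.mul (z.cont_ar.sub ((contPos_effPot m).mul z.cont_w)))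
  exact (((h2.mul he).add (h1.mul et)).add ((h4.mul (he.sub hp)).add (h3.mul (et.sub pt)))).add
    ((h6.mul (he.add hp)).add (h5.mul (et.add pt)))

lemma cont_jr (ψ f k : Profile) : ContPos (z.jr ψ f k) := by
  have := (z.cont_qt ψ f k).sub ((z.cont_bad f k).sub (z.cont_good ψ f k))
  refine this.congr fun q _ => ?_
  have := z.qt_eq ψ f k q.1 q.2
  simp only []
  linarith

/-- Spatial cutoff: `0` for `r ≤ δ` and `r ≥ 2 * R`, `1` on `[2δ, R]`. -/
noncomputable def cut (δ R r : ℝ) : ℝ := ramp ((r - δ) / δ) - ramp ((r - R) / R)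

/-- Derivative of `cut`. -/
noncomputable def cut' (δ R r : ℝ) : ℝ := bump ((r - δ) / δ) / δ - bump ((r - R) / R) / R

lemma hasDerivAt_cut (δ R r : ℝ) : HasDerivAt (cut δ R) (cut' δ R r) r :=
  ((Profile.up δ δ).hd r).sub ((Profile.up R R).hd r)

@[fun_prop]
lemma continuous_cut' (δ R : ℝ) : Continuous (cut' δ R) := by unfold cut'; fun_prop

@[fun_prop]
lemma continuous_cut (δ R : ℝ) : Continuous (cut δ R) := by unfold cut; fun_prop

lemma cut_left {δ R : ℝ} (hδ : 0 < δ) (hR : 2 * δ ≤ R) {r : ℝ} (hr : r ≤ δ) : cut δ R r = 0 := by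
  have hR0 : 0 < R := by linarith
  unfold cut
  rw [ramp_of_nonpos (div_nonpos_of_nonpos_of_nonneg (by linarith) hδ.le),
    ramp_of_nonpos (div_nonpos_of_nonpos_of_nonneg (by linarith) hR0.le), sub_zero]

lemma cut_right {δ R : ℝ} (hδ : 0 < δ) (hR : 2 * δ ≤ R) {r : ℝ} (hr : 2 * R ≤ r) :
    cut δ R r = 0 := by
  have hR0 : 0 < R := by linarith
  unfold cut
  rw [ramp_of_one_le ((one_le_div hδ).2 (by linarith)),
    ramp_of_one_le ((one_le_div hR0).2 (by linarith)), sub_self]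

lemma cut_mid {δ R : ℝ} (hδ : 0 < δ) {r : ℝ} (h1 : 2 * δ ≤ r) (h2 : r ≤ R) :
    cut δ R r = 1 := by
  have hR0 : 0 < R := by linarith
  unfold cut
  rw [ramp_of_one_le ((one_le_div hδ).2 (by linarith)),
    ramp_of_nonpos (div_nonpos_of_nonpos_of_nonneg (by linarith) hR0.le), sub_zero]

lemma cut_mem {δ R : ℝ} (hδ : 0 < δ) (hR : 2 * δ ≤ R) (r : ℝ) : 0 ≤ cut δ R r ∧ cut δ R r ≤ 1 := by
  rcases le_total r R with h | h
  · have hR0 : 0 < R := by linarith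
    unfold cut
    rw [ramp_of_nonpos (x := (r - R) / R)
      (div_nonpos_of_nonpos_of_nonneg (by linarith) hR0.le), sub_zero]
    exact ⟨ramp_nonneg _, ramp_le_one _⟩
  · unfold cut
    rw [ramp_of_one_le ((one_le_div hδ).2 (by linarith))]
    exact ⟨sub_nonneg.2 (ramp_le_one _), sub_le_self _ (ramp_nonneg _)⟩

/-- Localized energy identity. -/
lemma cut_identity (ψ f k : Profile) {δ R t₀ t₁ : ℝ} (hδ : 0 < δ) (hR : 2 * δ ≤ R)
    (ht : t₀ ≤ t₁) :
    ∫ r in δ..2 * R, cut δ R r * z.q ψ f k r t₁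
      = (∫ r in δ..2 * R, cut δ R r * z.q ψ f k r t₀)
        + ∫ τ in t₀..t₁, ∫ r in δ..2 * R, (cut δ R r * (z.bad f k r τ - z.good ψ f k r τ)
          - cut' δ R r * z.j ψ f k r τ) := by
  have hc : ContPos (fun r _ => cut δ R r) :=
    ContPos.of_fst (continuous_cut δ R).continuousOn
  have hc' : ContPos (fun r _ => cut' δ R r) :=
    ContPos.of_fst (continuous_cut' δ R).continuousOn
  refine rect_identity (G := fun r t => cut δ R r * z.q ψ f k r t)
    (H := fun r t => cut δ R r * z.j ψ f k r t)
    (Gt := fun r t => cut δ R r * z.qt ψ f k r t)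
    (Hr := fun r t => cut' δ R r * z.j ψ f k r t + cut δ R r * z.jr ψ f k r t)
    hδ (by linarith) ht (hc.mul (z.cont_q ψ f k)) (hc.mul (z.cont_qt ψ f k))
    ((hc'.mul (z.cont_j ψ f k)).add (hc.mul (z.cont_jr ψ f k))) ?_ ?_ ?_ ?_ ?_
  · exact fun r τ hr => (z.hasDerivAt_q_t ψ f k hr τ).const_mul _
  · exact fun r τ hr => (hasDerivAt_cut δ R r).mul (z.hasDerivAt_j_r ψ f k hr τ)
  · intro r τ _
    rw [z.qt_eq]; ring
  · intro τ; rw [cut_left hδ hR le_rfl, zero_mul]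
  · intro τ; rw [cut_right hδ hR le_rfl, zero_mul]

end RadialWave

namespace ContPos

variable {F G : ℝ → ℝ → ℝ}

lemma integral_mono (hF : ContPos F) (hG : ContPos G) (t : ℝ) {c d : ℝ} (hc : 0 < c) (hcd : c ≤ d)
    (h : ∀ r, c ≤ r → r ≤ d → F r t ≤ G r t) : ∫ r in c..d, F r t ≤ ∫ r in c..d, G r t :=
  intervalIntegral.integral_mono_on hcd (hF.intervalIntegrable t hc hcd)
    (hG.intervalIntegrable t hc hcd) fun r hr => h r hr.1 hr.2

lemma integral_mono_interval (hF : ContPos F) (t : ℝ) (h0 : ∀ r, 0 < r → 0 ≤ F r t)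
    {c c' d d' : ℝ} (hc : 0 < c') (hcc : c' ≤ c) (hcd : c ≤ d) (hdd : d ≤ d') :
    ∫ r in c..d, F r t ≤ ∫ r in c'..d', F r t := by
  refine intervalIntegral.integral_mono_interval hcc hcd hdd ?_
    (hF.intervalIntegrable t hc (hcc.trans (hcd.trans hdd)))
  refine (ae_restrict_iff' measurableSet_Ioc).2 (ae_of_all _ fun r hr => h0 r (hc.trans hr.1))

lemma integral_nonneg (t : ℝ) (h0 : ∀ r, 0 < r → 0 ≤ F r t)
    {c d : ℝ} (hc : 0 < c) (hcd : c ≤ d) : 0 ≤ ∫ r in c..d, F r t :=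
  intervalIntegral.integral_nonneg hcd fun r hr => h0 r (hc.trans_le hr.1)

lemma integral_add' (hF : ContPos F) (hG : ContPos G) (t : ℝ) {c d : ℝ} (hc : 0 < c)
    (hcd : c ≤ d) :
    ∫ r in c..d, (F r t + G r t) = (∫ r in c..d, F r t) + ∫ r in c..d, G r t :=
  intervalIntegral.integral_add (hF.intervalIntegrable t hc hcd) (hG.intervalIntegrable t hc hcd)

lemma integral_sub' (hF : ContPos F) (hG : ContPos G) (t : ℝ) {c d : ℝ} (hc : 0 < c)
    (hcd : c ≤ d) :
    ∫ r in c..d, (F r t - G r t) = (∫ r in c..d, F r t) - ∫ r in c..d, G r t :=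
  intervalIntegral.integral_sub (hF.intervalIntegrable t hc hcd) (hG.intervalIntegrable t hc hcd)

/-- Monotonicity of iterated integrals. -/
lemma integral₂_mono (hF : ContPos F) (hG : ContPos G) {s t : ℝ} (hst : s ≤ t) {c d : ℝ}
    (hc : 0 < c) (hcd : c ≤ d)
    (h : ∀ r τ, c ≤ r → r ≤ d → s ≤ τ → τ ≤ t → F r τ ≤ G r τ) :
    ∫ τ in s..t, ∫ r in c..d, F r τ ≤ ∫ τ in s..t, ∫ r in c..d, G r τ :=
  intervalIntegral.integral_mono_on hst (hF.intervalIntegrable_integral hc hcd s t)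
    (hG.intervalIntegrable_integral hc hcd s t) fun τ hτ =>
      hF.integral_mono hG τ hc hcd fun r h1 h2 => h r τ h1 h2 hτ.1 hτ.2

lemma integral₂_mono_interval (hF : ContPos F) {s t : ℝ} (hst : s ≤ t)
    (h0 : ∀ r τ, 0 < r → s ≤ τ → τ ≤ t → 0 ≤ F r τ) {c c' d d' : ℝ}
    (hc : 0 < c') (hcc : c' ≤ c) (hcd : c ≤ d) (hdd : d ≤ d') :
    ∫ τ in s..t, ∫ r in c..d, F r τ ≤ ∫ τ in s..t, ∫ r in c'..d', F r τ :=
  intervalIntegral.integral_mono_on hst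
    (hF.intervalIntegrable_integral (hc.trans_le hcc) hcd s t)
    (hF.intervalIntegrable_integral hc (hcc.trans (hcd.trans hdd)) s t) fun τ hτ =>
      hF.integral_mono_interval τ (fun r hr => h0 r τ hr hτ.1 hτ.2) hc hcc hcd hdd

lemma integral₂_add (hF : ContPos F) (hG : ContPos G) (s t : ℝ) {c d : ℝ}
    (hc : 0 < c) (hcd : c ≤ d) :
    ∫ τ in s..t, ∫ r in c..d, (F r τ + G r τ)
      = (∫ τ in s..t, ∫ r in c..d, F r τ) + ∫ τ in s..t, ∫ r in c..d, G r τ := by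
  rw [← intervalIntegral.integral_add (hF.intervalIntegrable_integral hc hcd s t)
    (hG.intervalIntegrable_integral hc hcd s t)]
  exact intervalIntegral.integral_congr fun τ _ => hF.integral_add' hG τ hc hcd

lemma integral₂_sub (hF : ContPos F) (hG : ContPos G) (s t : ℝ) {c d : ℝ}
    (hc : 0 < c) (hcd : c ≤ d) :
    ∫ τ in s..t, ∫ r in c..d, (F r τ - G r τ)
      = (∫ τ in s..t, ∫ r in c..d, F r τ) - ∫ τ in s..t, ∫ r in c..d, G r τ := by
  rw [← intervalIntegral.integral_sub (hF.intervalIntegrable_integral hc hcd s t)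
    (hG.intervalIntegrable_integral hc hcd s t)]
  exact intervalIntegral.integral_congr fun τ _ => hF.integral_sub' hG τ hc hcd

lemma integral₂_const_mul (F : ℝ → ℝ → ℝ) (s t c d k : ℝ) :
    ∫ τ in s..t, ∫ r in c..d, k * F r τ = k * ∫ τ in s..t, ∫ r in c..d, F r τ := by
  simp_rw [intervalIntegral.integral_const_mul]

lemma integral₂_nonneg {s t : ℝ} (hst : s ≤ t) {c d : ℝ} (hc : 0 < c) (hcd : c ≤ d)
    (h : ∀ r τ, 0 < r → s ≤ τ → τ ≤ t → 0 ≤ F r τ) : 0 ≤ ∫ τ in s..t, ∫ r in c..d, F r τ :=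
  intervalIntegral.integral_nonneg hst fun τ hτ =>
    integral_nonneg τ (fun r hr => h r τ hr hτ.1 hτ.2) hc hcd

/-- Bound an iterated integral by bounding the inner one. -/
lemma integral₂_le (hF : ContPos F) {s t : ℝ} (hst : s ≤ t) {c d K : ℝ}
    (hc : 0 < c) (hcd : c ≤ d) (h : ∀ τ, s ≤ τ → τ ≤ t → ∫ r in c..d, F r τ ≤ K) :
    ∫ τ in s..t, ∫ r in c..d, F r τ ≤ (t - s) * K := by
  calc _ ≤ ∫ τ in s..t, K := intervalIntegral.integral_mono_on hst
        (hF.intervalIntegrable_integral hc hcd s t) (by simp) fun τ hτ => h τ hτ.1 hτ.2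
    _ = _ := by simp

end ContPos

/-- Admissible angular parameters: `m = (d-1)/2` with `d ≥ 3` an integer. -/
def Adm (m : ℝ) : Prop := m = 1 ∨ 3 / 2 ≤ m

lemma Adm.one_le {m : ℝ} (hm : Adm m) : 1 ≤ m := by
  rcases hm with h | h <;> linarith

namespace RadialWave

variable {m : ℝ} (z : RadialWave m)

lemma abs_p_le (hm : 1 ≤ m) {r : ℝ} (hr : 0 < r) (t : ℝ) : |z.p r t| ≤ z.e r t := by
  rw [abs_le]
  constructor <;> linarith [z.e_add_p_nonneg hm hr t, z.e_sub_p_nonneg hm hr t]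

lemma abs_s_le (hm : 1 ≤ m) {r : ℝ} (hr : 0 < r) (t : ℝ) : |z.s r t| ≤ z.e r t := by
  have : 0 ≤ effPot m r * z.w r t ^ 2 := mul_nonneg (effPot_nonneg hm hr) (sq_nonneg _)
  rw [abs_le]
  unfold s e
  constructor <;> nlinarith [sq_nonneg (z.a r t), sq_nonneg (z.b r t)]

lemma pot_le_of_near (hm : Adm m) {C r t : ℝ} (hr : 0 < r) (hr1 : r ≤ 1)
    (h : |z.w r t| ≤ C * r ^ m) :
    effPot m r * z.w r t ^ 2 ≤ C ^ 2 * (m * (m - 1) + 1) * r := by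
  have hm1 := hm.one_le
  have hV := effPot_nonneg hm1 hr
  have h2 : z.w r t ^ 2 ≤ C ^ 2 * r ^ (2 * m) := by
    rw [← sq_abs]
    calc |z.w r t| ^ 2 ≤ (C * r ^ m) ^ 2 := by gcongr
      _ = C ^ 2 * r ^ (2 * m) := by
        rw [mul_pow, ← Real.rpow_natCast (r ^ m), ← Real.rpow_mul hr.le]
        congr 2; push_cast; ring
  have h3 : m * (m - 1) / r ^ 2 * r ^ (2 * m) ≤ m * (m - 1) * r := by
    rcases hm with rfl | hm
    · simp
    · have : r ^ (2 * m) ≤ r ^ (3 : ℝ) :=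
        Real.rpow_le_rpow_of_exponent_ge hr hr1 (by linarith)
      have h4 : r ^ (3 : ℝ) = r ^ 3 := by norm_cast
      rw [h4] at this
      have h5 : 0 ≤ m * (m - 1) := mul_nonneg (by linarith) (by linarith)
      calc m * (m - 1) / r ^ 2 * r ^ (2 * m) ≤ m * (m - 1) / r ^ 2 * r ^ 3 := by gcongr
        _ = m * (m - 1) * r := by field_simp
  have h4 : 1 / r * r ^ (2 * m) ≤ r := by
    have : r ^ (2 * m) ≤ r ^ (2 : ℝ) :=
        Real.rpow_le_rpow_of_exponent_ge hr hr1 (by linarith)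
    have h4 : r ^ (2 : ℝ) = r ^ 2 := by norm_cast
    rw [h4] at this
    calc 1 / r * r ^ (2 * m) ≤ 1 / r * r ^ 2 := by gcongr
      _ = r := by field_simp
  calc effPot m r * z.w r t ^ 2 ≤ effPot m r * (C ^ 2 * r ^ (2 * m)) := by gcongr
    _ = C ^ 2 * (m * (m - 1) / r ^ 2 * r ^ (2 * m) + 1 / r * r ^ (2 * m)) := by
      unfold effPot; ring
    _ ≤ C ^ 2 * (m * (m - 1) * r + r) := by gcongr
    _ = _ := by ring

/-- The flux error of the cutoff. -/
lemma neg_cut'_mul_j_le (hm : Adm m) (ψ f k : Profile) (hfk : ∀ x y, x ≤ y → f.v x ≤ k.v y)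
    {C ν r t : ℝ} (hC : 0 ≤ C) (hν : 0 < ν) (hν1 : 2 * ν ^ 2 ≤ 1) (hr : 0 < r)
    (hw : r ≤ 1 → |z.w r t| ≤ C * r ^ m) (hb : r ≤ 1 → |z.b r t| ≤ C * r ^ m) :
    -(cut' (ν ^ 2) (1 / ν) r * z.j ψ f k r t) ≤ (8 * ν + 12 * C * ν) * z.e r t
      + (bump ((r - ν ^ 2) / ν ^ 2) / ν ^ 2) *
        (3 * C * ν + C ^ 2 * (m * (m - 1) + 1) * ν ^ 2) := by
  have hm1 := hm.one_le
  have he := z.e_nonneg hm1 hr t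
  have hp := abs_p_le z hm1 hr t
  have hs := abs_s_le z hm1 hr t
  have hψ := ψ.nonneg (t - r)
  have hψ' := ψ.le_one (t - r)
  have hf := f.nonneg (t - r)
  have hf' := f.le_one (t - r)
  have hk := k.nonneg (t + r)
  have hk' := k.le_one (t + r)
  have hβ := hfk (t - r) (t + r) (by linarith)
  have hα : |(ψ.v (t - r) + f.v (t - r) + k.v (t + r))| ≤ 3 := by
    rw [abs_le]; constructor <;> linarith
  have hβ' : |k.v (t + r) - f.v (t - r)| ≤ 1 := by
    rw [abs_le]; constructor <;> linarith
  have hj : |z.j ψ f k r t| ≤ 4 * z.e r t := by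
    unfold j
    refine (abs_add_le _ _).trans ?_
    rw [abs_mul, abs_mul]
    have h1 := mul_le_mul hα hp (abs_nonneg _) (by norm_num)
    have h2 := mul_le_mul hβ' hs (abs_nonneg _) (by norm_num)
    linarith
  have h2 : bump ((r - 1 / ν) / (1 / ν)) / (1 / ν) * z.j ψ f k r t ≤ 8 * ν * z.e r t := by
    have hb0 := bump_nonneg ((r - 1 / ν) / (1 / ν))
    have hb2 := bump_le ((r - 1 / ν) / (1 / ν))
    have : bump ((r - 1 / ν) / (1 / ν)) / (1 / ν) = ν * bump ((r - 1 / ν) / (1 / ν)) := by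
      field_simp
    rw [this]
    calc ν * bump ((r - 1 / ν) / (1 / ν)) * z.j ψ f k r t
        ≤ ν * bump ((r - 1 / ν) / (1 / ν)) * (4 * z.e r t) := by
          gcongr; exact (le_abs_self _).trans hj
      _ ≤ ν * 2 * (4 * z.e r t) := by gcongr
      _ = _ := by ring
  have h1 : -(bump ((r - ν ^ 2) / ν ^ 2) / ν ^ 2 * z.j ψ f k r t) ≤ 12 * C * ν * z.e r t
      + (bump ((r - ν ^ 2) / ν ^ 2) / ν ^ 2) *
        (3 * C * ν + C ^ 2 * (m * (m - 1) + 1) * ν ^ 2) := by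
    have hK : 0 ≤ m * (m - 1) + 1 := by nlinarith
    rcases le_total (2 * ν ^ 2) r with hr2 | hr2
    · rw [bump_of_one_le ((one_le_div (by positivity)).2 (by linarith))]
      simp only [zero_div, zero_mul, neg_zero, add_zero]
      positivity
    · have hr1 : r ≤ 1 := hr2.trans hν1
      have hV := pot_le_of_near z hm hr hr1 (hw hr1)
      have hbb : |z.b r t| ≤ 2 * C * ν ^ 2 := by
        have : r ^ m ≤ r ^ (1 : ℝ) := Real.rpow_le_rpow_of_exponent_ge hr hr1 hm1
        rw [Real.rpow_one] at this
        calc |z.b r t| ≤ C * r ^ m := hb hr1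
          _ ≤ C * r := by gcongr
          _ ≤ C * (2 * ν ^ 2) := by gcongr
          _ = _ := by ring
      have hV' : effPot m r * z.w r t ^ 2 ≤ 2 * (C ^ 2 * (m * (m - 1) + 1) * ν ^ 2) := by
        refine hV.trans ?_
        calc C ^ 2 * (m * (m - 1) + 1) * r ≤ C ^ 2 * (m * (m - 1) + 1) * (2 * ν ^ 2) := by gcongr
          _ = _ := by ring
      have hab : |z.p r t| ≤ C * ν ^ 2 * (ν * z.a r t ^ 2 + 1 / ν) := by
        unfold p
        rw [abs_mul]
        have hAM : 2 * |z.a r t| ≤ ν * z.a r t ^ 2 + 1 / ν := by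
          rw [← sq_abs (z.a r t)]
          have := sq_nonneg (ν * |z.a r t| - 1)
          have h3 : ν * |z.a r t| ^ 2 + 1 / ν - 2 * |z.a r t|
            = (ν * |z.a r t| - 1) ^ 2 / ν := by field_simp; ring
          have : 0 ≤ (ν * |z.a r t| - 1) ^ 2 / ν := by positivity
          linarith
        calc |z.a r t| * |z.b r t| ≤ |z.a r t| * (2 * C * ν ^ 2) := by gcongr
          _ = C * ν ^ 2 * (2 * |z.a r t|) := by ring
          _ ≤ _ := by gcongr
      have ha : z.a r t ^ 2 ≤ 2 * z.e r t := by
        have := mul_nonneg (effPot_nonneg hm1 hr) (sq_nonneg (z.w r t))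
        unfold e; nlinarith [sq_nonneg (z.b r t)]
      have hab2 : C * ν ^ 2 * (ν * z.a r t ^ 2 + 1 / ν) ≤ ν ^ 2 * (2 * C * ν * z.e r t)
          + C * ν := by
        have h3 : C * ν ^ 2 * (ν * z.a r t ^ 2 + 1 / ν)
          = C * ν ^ 3 * z.a r t ^ 2 + C * ν := by field_simp
        rw [h3]
        have : C * ν ^ 3 * z.a r t ^ 2 ≤ C * ν ^ 3 * (2 * z.e r t) := by gcongr
        nlinarith
      have hj' : -z.j ψ f k r t ≤ ν ^ 2 * (6 * C * ν * z.e r t) +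
          (3 * C * ν + C ^ 2 * (m * (m - 1) + 1) * ν ^ 2) := by
        have e1 : -((ψ.v (t - r) + f.v (t - r) + k.v (t + r)) * z.p r t) ≤ 3 * |z.p r t| := by
          refine (neg_le_abs _).trans ?_
          rw [abs_mul]; gcongr
        have e2 : -((k.v (t + r) - f.v (t - r)) * z.s r t) ≤ effPot m r * z.w r t ^ 2 / 2 := by
          have h3 := mul_nonneg (effPot_nonneg hm1 hr) (sq_nonneg (z.w r t))
          have h4 : -z.s r t ≤ effPot m r * z.w r t ^ 2 / 2 := by
            unfold s; nlinarith [sq_nonneg (z.b r t), sq_nonneg (z.a r t)]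
          have h5 := mul_le_mul_of_nonneg_left h4 (sub_nonneg.2 hβ)
          have h6 : (k.v (t + r) - f.v (t - r)) * (effPot m r * z.w r t ^ 2 / 2)
            ≤ 1 * (effPot m r * z.w r t ^ 2 / 2) :=
            mul_le_mul_of_nonneg_right (by linarith) (by linarith)
          linarith
        unfold j
        linarith
      have hκ : 0 ≤ bump ((r - ν ^ 2) / ν ^ 2) / ν ^ 2 := by
        have := bump_nonneg ((r - ν ^ 2) / ν ^ 2); positivity
      have h3 := mul_le_mul_of_nonneg_left hj' hκ
      have h4 : bump ((r - ν ^ 2) / ν ^ 2) / ν ^ 2 * (ν ^ 2 * (6 * C * ν * z.e r t))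
        ≤ 12 * C * ν * z.e r t := by
        have : bump ((r - ν ^ 2) / ν ^ 2) / ν ^ 2 * (ν ^ 2 * (6 * C * ν * z.e r t))
          = bump ((r - ν ^ 2) / ν ^ 2) * (6 * C * ν * z.e r t) := by field_simp
        rw [this]
        have := mul_le_mul_of_nonneg_right (bump_le ((r - ν ^ 2) / ν ^ 2))
          (show 0 ≤ 6 * C * ν * z.e r t by positivity)
        linarith
      linarith
  unfold cut'
  linarith

end RadialWave

namespace RadialWave

variable {m : ℝ} {z : RadialWave m}

lemma near_nonneg {F : ℝ → ℝ → ℝ} {m T C : ℝ} (hT : 0 ≤ T)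
    (h : ∀ r t, 0 < r → r ≤ 1 → |t| ≤ T → |F r t| ≤ C * r ^ m) : 0 ≤ C := by
  have := h 1 0 one_pos le_rfl (by simpa using hT)
  simp only [Real.one_rpow, mul_one] at this
  exact (abs_nonneg _).trans this

lemma integral_cutoff_bump_le (δ R : ℝ) :
    ∫ r in δ..R, bump ((r - δ) / δ) / δ ≤ 1 := by
  have h := intervalIntegral.integral_eq_sub_of_hasDerivAt (a := δ) (b := R)
    (fun x _ => (Profile.up δ δ).hd x) ((Profile.up δ δ).cont.intervalIntegrable _ _)
  have h1 : ∫ r in δ..R, bump ((r - δ) / δ) / δ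
    = (Profile.up δ δ).v R - (Profile.up δ δ).v δ := h
  rw [h1]
  linarith [(Profile.up δ δ).nonneg δ, (Profile.up δ δ).le_one R]

/-- Weighted energy inequality. -/
theorem master (hm : Adm m) (hreg : z.Reg) {M : ℝ} (hM : z.Bdd M) {ψ f k : Profile}
    (hψ : ∀ x, ψ.d x ≤ 0) (hf : ∀ x, 0 ≤ f.d x) (hk : ∀ x, 0 ≤ k.d x)
    (hfk : ∀ x y, x ≤ y → f.v x ≤ k.v y) {t₀ t₁ : ℝ} (ht : t₀ ≤ t₁) {K₀ K₁ : ℝ}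
    (hK₀ : IntLe (fun r => z.q ψ f k r t₀) K₀)
    (hK₁ : ∀ c d, 0 < c → c ≤ d → ∫ τ in t₀..t₁, ∫ r in c..d, z.bad f k r τ ≤ K₁)
    {c d : ℝ} (hc : 0 < c) (hcd : c ≤ d) :
    (∫ r in c..d, z.q ψ f k r t₁) + ∫ τ in t₀..t₁, ∫ r in c..d, z.good ψ f k r τ ≤ K₀ + K₁ := by
  have hm1 := hm.one_le
  set T := max |t₀| |t₁|
  obtain ⟨C₁, hC₁⟩ := z.near T
  obtain ⟨C₂, hC₂⟩ := hreg T
  set C := max C₁ C₂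
  have hT : 0 ≤ T := (abs_nonneg _).trans (le_max_left _ _)
  have hC : 0 ≤ C := (near_nonneg hT hC₁).trans (le_max_left _ _)
  have htT : ∀ τ, t₀ ≤ τ → τ ≤ t₁ → |τ| ≤ T := fun τ h1 h2 => abs_le_max_abs_abs h1 h2
  have hw : ∀ r τ, 0 < r → t₀ ≤ τ → τ ≤ t₁ → r ≤ 1 → |z.w r τ| ≤ C * r ^ m :=
    fun r τ hr h1 h2 hr1 => (hC₁ r τ hr hr1 (htT τ h1 h2)).trans
      (mul_le_mul_of_nonneg_right (le_max_left _ _) (by positivity))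
  have hb : ∀ r τ, 0 < r → t₀ ≤ τ → τ ≤ t₁ → r ≤ 1 → |z.b r τ| ≤ C * r ^ m :=
    fun r τ hr h1 h2 hr1 => (hC₂ r τ hr hr1 (htT τ h1 h2)).trans
      (mul_le_mul_of_nonneg_right (le_max_right _ _) (by positivity))
  have hgood : ∀ r τ, 0 < r → 0 ≤ z.good ψ f k r τ := fun r τ hr => by
    unfold good
    have h1 := z.e_add_p_nonneg hm1 hr τ
    have h2 := effForce_nonneg hm1 hr
    have h3 := hfk (τ - r) (τ + r) (by linarith)
    have h4 := hψ (τ - r)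
    have h5 : 0 ≤ -ψ.d (τ - r) * (z.e r τ + z.p r τ) := mul_nonneg (by linarith) h1
    have h6 : 0 ≤ (k.v (τ + r) - f.v (τ - r)) * (effForce m r * z.w r τ ^ 2 / 2) :=
      mul_nonneg (by linarith) (by positivity)
    linarith
  have hbad : ∀ r τ, 0 < r → 0 ≤ z.bad f k r τ := fun r τ hr => by
    unfold bad
    have := hf (τ - r)
    have := hk (τ + r)
    have := effPot_nonneg hm1 hr
    positivity
  -- the estimate with an error term
  have key : ∀ ν : ℝ, 0 < ν → 2 * ν ^ 2 ≤ 1 → 2 * ν ^ 2 ≤ c → d ≤ 1 / ν →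
      (∫ r in c..d, z.q ψ f k r t₁) + ∫ τ in t₀..t₁, ∫ r in c..d, z.good ψ f k r τ ≤ K₀ + K₁
        + (t₁ - t₀) * ((8 * ν + 12 * C * ν) * M
          + (3 * C * ν + C ^ 2 * (m * (m - 1) + 1) * ν ^ 2)) := by
    intro ν hν hν1 hνc hνd
    set δ := ν ^ 2 with hδd
    set R := 1 / ν with hRd
    have hδ : 0 < δ := by positivity
    have hR : 2 * δ ≤ R := by linarith
    have hδR : δ ≤ 2 * R := by linarith
    have hcq : ContPos (fun r _ => cut δ R r) :=
      ContPos.of_fst (continuous_cut δ R).continuousOn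
    have hcq' : ContPos (fun r _ => cut' δ R r) :=
      ContPos.of_fst (continuous_cut' δ R).continuousOn
    have hid := z.cut_identity ψ f k hδ hR ht
    have c1 : ContPos (fun r τ => cut δ R r * z.bad f k r τ) := hcq.mul (z.cont_bad f k)
    have c2 : ContPos (fun r τ => cut δ R r * z.good ψ f k r τ) := hcq.mul (z.cont_good ψ f k)
    have c3 : ContPos (fun r τ => -(cut' δ R r * z.j ψ f k r τ)) :=
      (hcq'.mul (z.cont_j ψ f k)).neg
    have c4 : ContPos (fun r τ => cut δ R r * z.q ψ f k r τ) := hcq.mul (z.cont_q ψ f k)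
    have e1 : ∫ τ in t₀..t₁, ∫ r in δ..2 * R, (cut δ R r * (z.bad f k r τ - z.good ψ f k r τ)
          - cut' δ R r * z.j ψ f k r τ)
        = (∫ τ in t₀..t₁, ∫ r in δ..2 * R, cut δ R r * z.bad f k r τ)
          - (∫ τ in t₀..t₁, ∫ r in δ..2 * R, cut δ R r * z.good ψ f k r τ)
          + ∫ τ in t₀..t₁, ∫ r in δ..2 * R, -(cut' δ R r * z.j ψ f k r τ) := by
      rw [← c1.integral₂_sub c2 _ _ hδ hδR, ← (c1.sub c2).integral₂_add c3 _ _ hδ hδR]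
      congr 1; ext τ; congr 1; ext r; ring
    rw [e1] at hid
    have hcm := fun r => cut_mem (δ := δ) (R := R) hδ hR r
    -- initial energy
    have i1 : ∫ r in δ..2 * R, cut δ R r * z.q ψ f k r t₀ ≤ K₀ := by
      refine (c4.integral_mono (z.cont_q ψ f k) t₀ hδ hδR fun r h1 h2 => ?_).trans
        (hK₀ δ (2 * R) hδ hδR)
      exact mul_le_of_le_one_left (z.q_nonneg hm1 ψ f k (by linarith) t₀) (hcm r).2
    have i2 : ∫ τ in t₀..t₁, ∫ r in δ..2 * R, cut δ R r * z.bad f k r τ ≤ K₁ := by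
      refine (c1.integral₂_mono (z.cont_bad f k) ht hδ hδR fun r τ h1 h2 _ _ => ?_).trans
        (hK₁ δ (2 * R) hδ hδR)
      exact mul_le_of_le_one_left (hbad r τ (by linarith)) (hcm r).2
    have i3 : ∫ r in c..d, z.q ψ f k r t₁ ≤ ∫ r in δ..2 * R, cut δ R r * z.q ψ f k r t₁ := by
      refine le_trans ?_ (c4.integral_mono_interval t₁ (c := c) (d := d) (fun r hr => ?_) hδ
        (by linarith) hcd (by linarith))
      · refine (z.cont_q ψ f k).integral_mono c4 t₁ hc hcd fun r h1 h2 => ?_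
        rw [cut_mid hδ (by linarith) (by linarith), one_mul]
      · exact mul_nonneg (hcm r).1 (z.q_nonneg hm1 ψ f k hr t₁)
    have i4 : ∫ τ in t₀..t₁, ∫ r in c..d, z.good ψ f k r τ
        ≤ ∫ τ in t₀..t₁, ∫ r in δ..2 * R, cut δ R r * z.good ψ f k r τ := by
      refine le_trans ?_ (c2.integral₂_mono_interval ht (c := c) (d := d)
        (fun r τ hr _ _ => ?_) hδ (by linarith) hcd (by linarith))
      · refine (z.cont_good ψ f k).integral₂_mono c2 ht hc hcd fun r τ h1 h2 _ _ => ?_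
        rw [cut_mid hδ (by linarith) (by linarith), one_mul]
      · exact mul_nonneg (hcm r).1 (hgood r τ hr)
    have hK : 0 ≤ m * (m - 1) + 1 := by nlinarith
    have i5 : ∫ τ in t₀..t₁, ∫ r in δ..2 * R, -(cut' δ R r * z.j ψ f k r τ)
        ≤ (t₁ - t₀) * ((8 * ν + 12 * C * ν) * M
          + (3 * C * ν + C ^ 2 * (m * (m - 1) + 1) * ν ^ 2)) := by
      have c5 : ContPos (fun r τ => (8 * ν + 12 * C * ν) * z.e r τ) := z.cont_e.const_mul _
      have c6 : ContPos (fun r (_ : ℝ) => (bump ((r - δ) / δ) / δ) *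
        (3 * C * ν + C ^ 2 * (m * (m - 1) + 1) * ν ^ 2)) :=
        ContPos.of_continuous (by fun_prop)
      refine c3.integral₂_le ht hδ hδR fun τ h1 h2 => ?_
      refine (c3.integral_mono (c5.add c6) τ hδ hδR fun r hr1 hr2 => ?_).trans ?_
      · exact z.neg_cut'_mul_j_le hm ψ f k hfk hC hν hν1 (by linarith)
          (hw r τ (by linarith) h1 h2) (hb r τ (by linarith) h1 h2)
      · rw [c5.integral_add' c6 τ hδ hδR, intervalIntegral.integral_const_mul,
          intervalIntegral.integral_mul_const]
        refine add_le_add (mul_le_mul_of_nonneg_left (hM τ _ _ hδ hδR) (by positivity)) ?_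
        exact mul_le_of_le_one_left (by positivity) (integral_cutoff_bump_le _ _)
    linarith
  have hlim : Tendsto (fun ν : ℝ => K₀ + K₁ + (t₁ - t₀) * ((8 * ν + 12 * C * ν) * M
          + (3 * C * ν + C ^ 2 * (m * (m - 1) + 1) * ν ^ 2))) (𝓝[>] 0) (𝓝 (K₀ + K₁)) := by
    have : Continuous (fun ν : ℝ => K₀ + K₁ + (t₁ - t₀) * ((8 * ν + 12 * C * ν) * M
          + (3 * C * ν + C ^ 2 * (m * (m - 1) + 1) * ν ^ 2))) := by fun_prop
    have h := this.tendsto 0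
    simp only [mul_zero, add_zero, zero_mul, ne_eq, OfNat.ofNat_ne_zero, not_false_eq_true,
      zero_pow] at h
    exact h.mono_left nhdsWithin_le_nhds
  refine ge_of_tendsto hlim ?_
  have hd : 0 < d := hc.trans_le hcd
  filter_upwards [Ioo_mem_nhdsGT (show (0 : ℝ) < min (min (1 / 2) (c / 2)) (1 / d) by positivity)]
    with ν ⟨hν, hν'⟩
  simp only [lt_min_iff] at hν'
  have h2 : ν ^ 2 ≤ ν * (1 / 2) := by nlinarith
  refine key ν hν (by nlinarith) (by nlinarith) ?_
  rw [le_div_iff₀ hν]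
  have := hν'.2
  rw [lt_div_iff₀ hd] at this
  linarith

end RadialWave

section IntLe

variable {F G : ℝ → ℝ} {K : ℝ}

lemma intervalIntegrable_of_pos (hF : ContinuousOn F (Ioi 0)) {c d : ℝ} (hc : 0 < c) (hcd : c ≤ d) :
    IntervalIntegrable F volume c d := by
  apply ContinuousOn.intervalIntegrable
  rw [uIcc_of_le hcd]
  exact hF.mono fun x hx => hc.trans_le hx.1

lemma IntLe.nonneg (h : IntLe F K) : 0 ≤ K := by simpa using h 1 1 one_pos le_rfl

lemma IntLe.mono (h : IntLe F K) {K' : ℝ} (hK : K ≤ K') : IntLe F K' :=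
  fun c d hc hcd => (h c d hc hcd).trans hK

lemma IntLe.mono_fun (h : IntLe G K) (hF : ContinuousOn F (Ioi 0)) (hG : ContinuousOn G (Ioi 0))
    (hFG : ∀ r, 0 < r → F r ≤ G r) : IntLe F K := fun c d hc hcd =>
  (intervalIntegral.integral_mono_on hcd (intervalIntegrable_of_pos hF hc hcd)
    (intervalIntegrable_of_pos hG hc hcd) fun r hr => hFG r (hc.trans_le hr.1)).trans
    (h c d hc hcd)

lemma IntLe.congr (h : IntLe G K) (hFG : ∀ r, 0 < r → F r = G r) : IntLe F K := by
  intro c d hc hcd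
  rw [intervalIntegral.integral_congr (g := G)]
  · exact h c d hc hcd
  · intro r hr
    rw [uIcc_of_le hcd] at hr
    exact hFG r (hc.trans_le hr.1)

lemma IntLe.const_mul (h : IntLe F K) {k : ℝ} (hk : 0 ≤ k) : IntLe (fun r => k * F r) (k * K) := by
  intro c d hc hcd
  rw [intervalIntegral.integral_const_mul]
  exact mul_le_mul_of_nonneg_left (h c d hc hcd) hk

lemma IntLe.add (hF : IntLe F K) {K' : ℝ} (hG : IntLe G K') (cF : ContinuousOn F (Ioi 0))
    (cG : ContinuousOn G (Ioi 0)) : IntLe (fun r => F r + G r) (K + K') := by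
  intro c d hc hcd
  rw [intervalIntegral.integral_add (intervalIntegrable_of_pos cF hc hcd)
    (intervalIntegrable_of_pos cG hc hcd)]
  exact add_le_add (hF c d hc hcd) (hG c d hc hcd)

/-- Enlarging the interval of integration of a nonnegative function. -/
lemma integral_le_of_subinterval (cF : ContinuousOn F (Ioi 0)) (h0 : ∀ r, 0 < r → 0 ≤ F r)
    {c c' d d' : ℝ} (hc : 0 < c') (hcc : c' ≤ c) (hcd : c ≤ d) (hdd : d ≤ d') :
    ∫ r in c..d, F r ≤ ∫ r in c'..d', F r :=
  intervalIntegral.integral_mono_interval hcc hcd hdd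
    ((ae_restrict_iff' measurableSet_Ioc).2 (ae_of_all _ fun r hr => h0 r (hc.trans hr.1)))
    (intervalIntegrable_of_pos cF hc (hcc.trans (hcd.trans hdd)))

/-- Almost all of the mass sits on a compact interval. -/
lemma IntLe.exists_core (h : IntLe F K) (cF : ContinuousOn F (Ioi 0))
    (h0 : ∀ r, 0 < r → 0 ≤ F r) {ε : ℝ} (hε : 0 < ε) :
    ∃ c₀ d₀, 0 < c₀ ∧ c₀ ≤ d₀ ∧ (∀ c d, 0 < c → c ≤ d → d ≤ c₀ → ∫ r in c..d, F r ≤ ε) ∧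
      (∀ c d, d₀ ≤ c → c ≤ d → ∫ r in c..d, F r ≤ ε) := by
  set S : Set ℝ := {x | ∃ c d, 0 < c ∧ c ≤ d ∧ x = ∫ r in c..d, F r}
  have hne : S.Nonempty := ⟨_, 1, 1, one_pos, le_rfl, rfl⟩
  have hbd : BddAbove S := ⟨K, by rintro _ ⟨c, d, hc, hcd, rfl⟩; exact h c d hc hcd⟩
  obtain ⟨_, ⟨c₀, d₀, hc₀, hcd₀, rfl⟩, hlt⟩ := exists_lt_of_lt_csSup hne (sub_lt_self (sSup S) hε)
  refine ⟨c₀, d₀, hc₀, hcd₀, fun c d hc hcd hd => ?_, fun c d hc hcd => ?_⟩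
  · have h1 : ∫ r in c..d₀, F r ≤ sSup S := le_csSup hbd ⟨c, d₀, hc, by linarith, rfl⟩
    have h2 := intervalIntegral.integral_add_adjacent_intervals
      (intervalIntegrable_of_pos cF hc (hcd.trans hd)) (intervalIntegrable_of_pos cF hc₀ hcd₀)
    have h3 := integral_le_of_subinterval cF h0 hc le_rfl hcd hd
    linarith
  · have h1 : ∫ r in c₀..d, F r ≤ sSup S := le_csSup hbd ⟨c₀, d, hc₀, by linarith, rfl⟩
    have h2 := intervalIntegral.integral_add_adjacent_intervals
      (intervalIntegrable_of_pos cF hc₀ hcd₀)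
      (intervalIntegrable_of_pos cF (hc₀.trans_le hcd₀) (hc.trans hcd))
    have h3 := integral_le_of_subinterval cF h0 (hc₀.trans_le hcd₀) hc hcd le_rfl
    linarith

/-- A function dominated by `F` and vanishing below `R` has small integrals. -/
lemma intLe_of_vanish (cF : ContinuousOn F (Ioi 0)) (cG : ContinuousOn G (Ioi 0)) {R ε : ℝ}
    (hR : 0 < R) (hε : 0 ≤ ε) (hF : ∀ c d, R ≤ c → c ≤ d → ∫ r in c..d, F r ≤ ε)
    (hG0 : ∀ r, 0 < r → r ≤ R → G r ≤ 0) (hGF : ∀ r, R ≤ r → G r ≤ F r) : IntLe G ε := by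
  have hlow : ∀ c d, 0 < c → c ≤ d → d ≤ R → ∫ r in c..d, G r ≤ 0 := by
    intro c d hc hcd hd
    have := intervalIntegral.integral_mono_on hcd (intervalIntegrable_of_pos cG hc hcd)
      (intervalIntegrable_const (μ := volume) (c := (0 : ℝ)))
      fun r hr => hG0 r (hc.trans_le hr.1) (hr.2.trans hd)
    simpa using this
  have hhigh : ∀ c d, R ≤ c → c ≤ d → ∫ r in c..d, G r ≤ ε := fun c d hc hcd =>
    (intervalIntegral.integral_mono_on hcd (intervalIntegrable_of_pos cG (hR.trans_le hc) hcd)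
      (intervalIntegrable_of_pos cF (hR.trans_le hc) hcd)
      fun r hr => hGF r (hc.trans hr.1)).trans (hF c d hc hcd)
  intro c d hc hcd
  rcases le_total d R with h | h
  · exact (hlow c d hc hcd h).trans hε
  rcases le_total R c with h' | h'
  · exact hhigh c d h' hcd
  · have h2 := intervalIntegral.integral_add_adjacent_intervals
      (intervalIntegrable_of_pos cG hc h') (intervalIntegrable_of_pos cG hR h)
    have := hlow c R hc h' le_rfl
    have := hhigh R d le_rfl h
    linarith

end IntLe

lemma Profile.up_d_nonneg (s : ℝ) {l : ℝ} (hl : 0 ≤ l) (x : ℝ) : 0 ≤ (Profile.up s l).d x :=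
  div_nonneg (bump_nonneg _) hl

lemma Profile.down_d_nonpos (s : ℝ) {l : ℝ} (hl : 0 ≤ l) (x : ℝ) : (Profile.down s l).d x ≤ 0 :=
  neg_nonpos.2 (div_nonneg (bump_nonneg _) hl)

lemma Profile.up_v_of_le {s l x : ℝ} (hl : 0 < l) (hx : x ≤ s) : (Profile.up s l).v x = 0 :=
  ramp_of_nonpos (div_nonpos_of_nonpos_of_nonneg (by linarith) hl.le)

lemma Profile.up_v_of_ge {s l x : ℝ} (hl : 0 < l) (hx : s + l ≤ x) : (Profile.up s l).v x = 1 :=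
  ramp_of_one_le ((one_le_div hl).2 (by linarith))

lemma Profile.up_d_of_le {s l x : ℝ} (hl : 0 < l) (hx : x ≤ s) : (Profile.up s l).d x = 0 := by
  show bump _ / l = 0
  rw [bump_of_nonpos (div_nonpos_of_nonpos_of_nonneg (by linarith) hl.le), zero_div]

lemma Profile.up_d_of_ge {s l x : ℝ} (hl : 0 < l) (hx : s + l ≤ x) : (Profile.up s l).d x = 0 := by
  show bump _ / l = 0
  rw [bump_of_one_le ((one_le_div hl).2 (by linarith)), zero_div]

lemma Profile.up_d_le (s : ℝ) {l : ℝ} (hl : 0 < l) (x : ℝ) : (Profile.up s l).d x ≤ 2 / l :=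
  div_le_div_of_nonneg_right (bump_le _) hl.le

namespace RadialWave

variable {m : ℝ} {z : RadialWave m}

lemma cont_e_fst (z : RadialWave m) (t : ℝ) : ContinuousOn (fun r => z.e r t) (Ioi 0) :=
  z.cont_e.continuousOn_fst t

lemma cont_w_sq (z : RadialWave m) : ContPos (fun r t => z.w r t ^ 2 / r ^ 2) := by
  have h : ContPos (fun r _ => 1 / r ^ 2) := by
    refine ContPos.of_fst fun r hr => ContinuousAt.continuousWithinAt ?_
    have : r ≠ 0 := ne_of_gt hr
    fun_prop (disch := positivity)
  refine ((z.cont_w.pow 2).mul h).congr fun q _ => ?_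
  simp only []; ring

/-- Energy weighted by a nonincreasing function of `t - r` decreases, with an explicit flux. -/
theorem weighted_energy (hm : Adm m) (hreg : z.Reg) {M : ℝ} (hM : z.Bdd M) {ψ : Profile}
    (hψ : ∀ x, ψ.d x ≤ 0) {t₀ t₁ : ℝ} (ht : t₀ ≤ t₁) {K : ℝ}
    (hK : IntLe (fun r => ψ.v (t₀ - r) * z.e r t₀) K) {c d : ℝ} (hc : 0 < c) (hcd : c ≤ d) :
    (∫ r in c..d, ψ.v (t₁ - r) * z.e r t₁)
      + ∫ τ in t₀..t₁, ∫ r in c..d, -ψ.d (τ - r) * (z.e r τ + z.p r τ) ≤ K := by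
  have := master hm hreg hM (ψ := ψ) (f := .zero) (k := .zero) hψ (fun _ => le_rfl)
    (fun _ => le_rfl) (fun _ _ _ => le_rfl) ht (K₀ := K) (K₁ := 0) ?_ ?_ hc hcd
  · simpa [q, good, Profile.zero] using this
  · simpa [q, Profile.zero] using hK
  · intro c d _ _
    simp [bad, Profile.zero]

theorem energy_le (hm : Adm m) (hreg : z.Reg) {M : ℝ} (hM : z.Bdd M) {t₀ t₁ : ℝ} (ht : t₀ ≤ t₁)
    {K : ℝ} (hK : IntLe (fun r => z.e r t₀) K) : IntLe (fun r => z.e r t₁) K := by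
  intro c d hc hcd
  have := weighted_energy hm hreg hM (ψ := .one) (fun _ => le_rfl) ht (K := K) ?_ hc hcd
  · simpa [Profile.one] using this
  · simpa [Profile.one] using hK

theorem morawetz (hm : Adm m) (hreg : z.Reg) {M : ℝ} (hM : z.Bdd M) {t₀ t₁ : ℝ} (ht : t₀ ≤ t₁)
    {c d : ℝ} (hc : 0 < c) (hcd : c ≤ d) :
    ∫ τ in t₀..t₁, ∫ r in c..d, z.w r τ ^ 2 / r ^ 2 ≤ 4 * M := by
  have hm1 := hm.one_le
  have := master hm hreg hM (ψ := .zero) (f := .zero) (k := .one) (fun _ => le_rfl)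
    (fun _ => le_rfl) (fun _ => le_rfl) (fun _ _ _ => zero_le_one) ht (K₀ := 2 * M) (K₁ := 0)
    ?_ ?_ hc hcd
  · simp only [q, good, Profile.zero, Profile.one, zero_mul, one_mul, sub_zero, neg_zero,
      zero_add, add_zero] at this
    have h1 : 0 ≤ ∫ r in c..d, (z.e r t₁ + z.p r t₁) :=
      ContPos.integral_nonneg (F := fun r t => z.e r t + z.p r t) t₁
        (fun r hr => z.e_add_p_nonneg hm1 hr t₁) hc hcd
    have h2 : ∫ τ in t₀..t₁, ∫ r in c..d, (1 / 2) * (z.w r τ ^ 2 / r ^ 2)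
        ≤ ∫ τ in t₀..t₁, ∫ r in c..d, effForce m r * z.w r τ ^ 2 / 2 := by
      refine (z.cont_w_sq.const_mul _).integral₂_mono z.cont_forceTerm ht hc hcd
        fun r τ hr _ _ _ => ?_
      have := mul_le_mul_of_nonneg_right (inv_sq_le_effForce hm1 (hc.trans_le hr))
        (sq_nonneg (z.w r τ))
      have h3 : 1 / r ^ 2 * z.w r τ ^ 2 = z.w r τ ^ 2 / r ^ 2 := by ring
      linarith
    rw [ContPos.integral₂_const_mul] at h2
    linarith
  · simp only [q, Profile.zero, Profile.one, zero_mul, one_mul, zero_add]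
    refine ((hM t₀).const_mul zero_le_two).mono_fun
      ((z.cont_e.add z.cont_p).continuousOn_fst t₀) ((z.cont_e.const_mul 2).continuousOn_fst t₀)
      fun r hr => ?_
    linarith [z.e_sub_p_nonneg hm1 hr t₀]
  · intro c d _ _
    simp [bad, Profile.zero, Profile.one]

theorem morawetz_tail (hm : Adm m) (hreg : z.Reg) {M : ℝ} (hM : z.Bdd M) {ε : ℝ} (hε : 0 < ε) :
    ∃ T₀, 0 ≤ T₀ ∧ ∀ t₀ t₁, T₀ ≤ t₀ → t₀ ≤ t₁ → ∀ c d, 0 < c → c ≤ d →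
      ∫ τ in t₀..t₁, ∫ r in c..d, z.w r τ ^ 2 / r ^ 2 ≤ ε := by
  set S : Set ℝ := {x | ∃ T c d, 0 ≤ T ∧ 0 < c ∧ c ≤ d ∧
    x = ∫ τ in (0 : ℝ)..T, ∫ r in c..d, z.w r τ ^ 2 / r ^ 2}
  have hne : S.Nonempty := ⟨_, 0, 1, 1, le_rfl, one_pos, le_rfl, rfl⟩
  have hbd : BddAbove S :=
    ⟨4 * M, by rintro _ ⟨T, c, d, hT, hc, hcd, rfl⟩; exact morawetz hm hreg hM hT hc hcd⟩
  obtain ⟨_, ⟨T, c₀, d₀, hT, hc₀, hcd₀, rfl⟩, hlt⟩ :=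
    exists_lt_of_lt_csSup hne (sub_lt_self (sSup S) hε)
  refine ⟨T, hT, fun t₀ t₁ h0 h1 c d hc hcd => ?_⟩
  have hpos : ∀ r τ : ℝ, 0 < r → 0 ≤ z.w r τ ^ 2 / r ^ 2 := fun r τ hr => by positivity
  have hc' : 0 < min c c₀ := lt_min hc hc₀
  have hcd' : min c c₀ ≤ max d d₀ := (min_le_left _ _).trans (hcd.trans (le_max_left _ _))
  have hfint := fun s t => z.cont_w_sq.intervalIntegrable_integral hc' hcd' s t
  have i1 : ∫ τ in (0 : ℝ)..t₁, ∫ r in min c c₀..max d d₀, z.w r τ ^ 2 / r ^ 2 ≤ sSup S :=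
    le_csSup hbd ⟨t₁, _, _, hT.trans (h0.trans h1), hc', hcd', rfl⟩
  have i2 := z.cont_w_sq.integral₂_mono_interval hT (fun r τ hr _ _ => hpos r τ hr) hc'
    (min_le_right c c₀) hcd₀ (le_max_right d d₀)
  have i3 := z.cont_w_sq.integral₂_mono_interval h1 (fun r τ hr _ _ => hpos r τ hr) hc'
    (min_le_left c c₀) hcd (le_max_left d d₀)
  have i4 := intervalIntegral.integral_add_adjacent_intervals (hfint 0 T) (hfint T t₀)
  have i5 := intervalIntegral.integral_add_adjacent_intervals (hfint 0 t₀) (hfint t₀ t₁)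
  have i6 := ContPos.integral₂_nonneg h0 hc' hcd' (fun r τ hr _ _ => hpos r τ hr)
  linarith

/-- The incoming part of the energy vanishes as `t → ∞`. -/
theorem inward_decay (hm : Adm m) (hreg : z.Reg) {M : ℝ} (hM : z.Bdd M) {ε : ℝ} (hε : 0 < ε) :
    ∃ T, 0 ≤ T ∧ ∀ t, T ≤ t → IntLe (fun r => z.e r t + z.p r t) ε := by
  have hm1 := hm.one_le
  have hl : 0 ≤ m * (m - 1) := by nlinarith
  set lam := m * (m - 1) with hlam
  set ε' := ε / (2 * lam + 6) with hε'
  have hε'0 : 0 < ε' := by positivity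
  obtain ⟨t₀, ht₀, htail⟩ := morawetz_tail hm hreg hM hε'0
  obtain ⟨-, d₀, -, -, -, hd₀⟩ := (hM t₀).exists_core (z.cont_e_fst t₀)
    (fun r hr => z.e_nonneg hm1 hr t₀) hε'0
  set R := max 1 d₀
  have hR : 1 ≤ R := le_max_left _ _
  set S := t₀ + R with hS
  have hS0 : 0 < S := by linarith
  refine ⟨2 * S, by positivity, fun t ht c d hc hcd => ?_⟩
  have := master hm hreg hM (ψ := .zero) (f := .zero) (k := .up S S) (fun _ => le_rfl)
    (fun _ => le_rfl) (Profile.up_d_nonneg S hS0.le) (fun _ y _ => (Profile.up S S).nonneg y)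
    (show t₀ ≤ t by linarith) (K₀ := 2 * ε') (K₁ := (2 * lam + 4) * ε')
    ?_ ?_ hc hcd
  · have hg : 0 ≤ ∫ τ in t₀..t, ∫ r in c..d, z.good .zero .zero (.up S S) r τ := by
      refine ContPos.integral₂_nonneg (by linarith) hc hcd fun r τ hr _ _ => ?_
      simp only [good, Profile.zero, neg_zero, zero_mul, zero_add, sub_zero]
      have := (Profile.up S S).nonneg (τ + r)
      have := effForce_nonneg hm1 hr
      positivity
    have hq : ∫ r in c..d, z.q .zero .zero (.up S S) r t = ∫ r in c..d, (z.e r t + z.p r t) := by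
      refine intervalIntegral.integral_congr fun r hr => ?_
      rw [uIcc_of_le hcd] at hr
      simp only [q, Profile.zero, zero_mul, zero_add]
      rw [Profile.up_v_of_ge hS0 (by linarith [hr.1]), one_mul]
    have hsum : 2 * ε' + (2 * lam + 4) * ε' = ε := by rw [hε']; field_simp; ring
    linarith
  · refine intLe_of_vanish (F := fun r => 2 * z.e r t₀) (R := R)
      ((z.cont_e.const_mul 2).continuousOn_fst t₀)
      ((z.cont_q _ _ _).continuousOn_fst t₀) (by linarith) (by positivity) ?_ ?_ ?_
    · intro c d hc hcd
      rw [intervalIntegral.integral_const_mul]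
      have := hd₀ c d ((le_max_right _ _).trans hc) hcd
      linarith
    · intro r hr hrR
      simp only [q, Profile.zero, zero_mul, zero_add]
      rw [Profile.up_v_of_le hS0 (by linarith), zero_mul]
    · intro r hr
      have hr0 : 0 < r := by linarith
      simp only [q, Profile.zero, zero_mul, zero_add]
      have h1 := z.e_add_p_nonneg hm1 hr0 t₀
      have h2 := z.e_sub_p_nonneg hm1 hr0 t₀
      have := mul_le_of_le_one_left h1 ((Profile.up S S).le_one (t₀ + r))
      linarith
  · intro c d hc hcd
    have key : ∫ τ in t₀..t, ∫ r in c..d, z.bad .zero (.up S S) r τ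
        ≤ ∫ τ in t₀..t, ∫ r in c..d, (2 * lam + 4) * (z.w r τ ^ 2 / r ^ 2) := by
      refine (z.cont_bad _ _).integral₂_mono (z.cont_w_sq.const_mul _) (by linarith) hc hcd
        fun r τ hr _ hτ _ => ?_
      have hr0 : 0 < r := hc.trans_le hr
      simp only [bad, Profile.zero, zero_add]
      rcases le_total (S + S) (τ + r) with h | h
      · rw [Profile.up_d_of_ge hS0 h, zero_mul]; positivity
      · have h1 := Profile.up_d_le S hS0 (τ + r)
        have hV := effPot_nonneg hm1 hr0
        calc (Profile.up S S).d (τ + r) * (effPot m r * z.w r τ ^ 2)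
            ≤ 2 / S * (effPot m r * z.w r τ ^ 2) := by gcongr
          _ = (2 / S * (lam + r)) * (z.w r τ ^ 2 / r ^ 2) := by
            unfold effPot; field_simp; ring
          _ ≤ (2 * lam + 4) * (z.w r τ ^ 2 / r ^ 2) := by
            gcongr
            have h2 : 2 / S * (lam + r) = (2 * lam + 2 * r) / S := by ring
            rw [h2, div_le_iff₀ hS0]
            nlinarith
    rw [ContPos.integral₂_const_mul] at key
    refine key.trans ?_
    exact mul_le_mul_of_nonneg_left (htail t₀ t le_rfl (by linarith) c d hc hcd) (by positivity)

end RadialWave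

namespace RadialWave

variable {m : ℝ} {z : RadialWave m}

/-- Pointwise control of the source produced by a slowly rising weight. -/
lemma bad_up_le (hm : 1 ≤ m) {t₀ l r τ : ℝ} (h0 : 1 ≤ t₀) (hl : t₀ ≤ l) (hr : 0 < r)
    (hτ : t₀ ≤ τ) :
    z.bad (.up t₀ l) .one r τ ≤ (2 * (m * (m - 1)) + 4) * (z.w r τ ^ 2 / r ^ 2)
      + 4 / l * (1 / max 1 τ * z.w r τ ^ 2) := by
  have hlam : 0 ≤ m * (m - 1) := by nlinarith
  have hl0 : 0 < l := by linarith
  have hτ0 : 0 < τ := by linarith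
  rw [max_eq_right (by linarith : (1 : ℝ) ≤ τ)]
  simp only [bad, Profile.one, add_zero]
  rcases le_total (t₀ + l) (τ - r) with h | h
  · rw [Profile.up_d_of_ge hl0 h, zero_mul]; positivity
  · have h1 := Profile.up_d_le t₀ hl0 (τ - r)
    have hV := effPot_nonneg hm hr
    calc (Profile.up t₀ l).d (τ - r) * (effPot m r * z.w r τ ^ 2)
        ≤ 2 / l * (effPot m r * z.w r τ ^ 2) := by gcongr
      _ = 2 / l * (m * (m - 1)) * (z.w r τ ^ 2 / r ^ 2) + (2 / l * (1 / r)) * z.w r τ ^ 2 := by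
        unfold effPot; ring
      _ ≤ 2 * (m * (m - 1)) * (z.w r τ ^ 2 / r ^ 2) + (4 / r ^ 2 + 4 / l * (1 / τ)) * z.w r τ ^ 2 := by
        gcongr
        · rw [div_le_iff₀ hl0]; linarith
        · rcases le_total (τ / 2) r with h2 | h2
          · have h3 : 1 / r ≤ 1 / (τ / 2) := one_div_le_one_div_of_le (by positivity) h2
            have h4 : 2 / l * (1 / (τ / 2)) = 4 / l * (1 / τ) := by field_simp; norm_num
            have h5 : 2 / l * (1 / r) ≤ 2 / l * (1 / (τ / 2)) := by gcongr
            have : 0 ≤ 4 / r ^ 2 := by positivity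
            linarith
          · have h3 : r ≤ 2 * l := by linarith
            have h4 : 2 / l * (1 / r) ≤ 4 / r ^ 2 := by
              rw [div_mul_div_comm, div_le_div_iff₀ (by positivity) (by positivity)]
              nlinarith
            have : 0 ≤ 4 / l * (1 / τ) := by positivity
            linarith
      _ = _ := by ring

/-- A wave bounded in `L²` leaves the region `r ≤ t - ℓ(t)` as soon as `ℓ(t) ≫ log t`. -/
theorem interior_decay (hm : Adm m) (hreg : z.Reg) {M : ℝ} (hM : z.Bdd M) {L : ℝ}
    (hL : ∀ t, 0 ≤ t → IntLe (fun r => z.w r t ^ 2) L) {ℓ : ℝ → ℝ}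
    (hℓ : Tendsto (fun t => ℓ t / Real.log t) atTop atTop) {ε : ℝ} (hε : 0 < ε) :
    ∀ᶠ t in atTop, ∀ c d, 0 < c → c ≤ d → d ≤ t - ℓ t → ∫ r in c..d, z.e r t ≤ ε := by
  have hm1 := hm.one_le
  have hlam : 0 ≤ m * (m - 1) := by nlinarith
  set B := 2 * (m * (m - 1)) + 4
  set ε' := ε / (B + 1) with hε'
  have hε'0 : 0 < ε' := by positivity
  have hL0 : 0 ≤ L := (hL 0 le_rfl).nonneg
  obtain ⟨T₁, hT₁, htail⟩ := morawetz_tail hm hreg hM hε'0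
  obtain ⟨T₂, hT₂, hin⟩ := inward_decay hm hreg hM hε'0
  set t₀ := max 1 (max T₁ T₂)
  have h1t : 1 ≤ t₀ := le_max_left _ _
  have hlog : Tendsto Real.log atTop atTop := Real.tendsto_log_atTop
  have hK : ∀ᶠ t in atTop, 4 * L / ε + 2 * t₀ + 2 ≤ ℓ t / Real.log t :=
    hℓ.eventually (eventually_ge_atTop _)
  filter_upwards [hK, hlog.eventually (eventually_ge_atTop 1), eventually_ge_atTop t₀]
    with t h1 h2 h3 c d hc hcd hd
  rw [le_div_iff₀ (by linarith)] at h1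
  set l := ℓ t - t₀ with hl
  have hLe : 0 ≤ 4 * L / ε := by positivity
  have h5 : (4 * L / ε) * Real.log t + t₀ ≤ l := by
    have : (2 * t₀ + 2) * 1 ≤ (2 * t₀ + 2) * Real.log t := by gcongr
    linarith
  have hle : t₀ ≤ l := by
    have : 0 ≤ (4 * L / ε) * Real.log t := by positivity
    linarith
  have hl0 : 0 < l := by linarith
  have hfrac : 4 / l * (L * Real.log t) ≤ ε := by
    rw [div_mul_eq_mul_div, div_le_iff₀ hl0]
    have := mul_le_mul_of_nonneg_left h5 hε.le
    have h6 : ε * (4 * L / ε * Real.log t + t₀) = 4 * (L * Real.log t) + ε * t₀ := by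
      field_simp
    have : 0 < ε * t₀ := by positivity
    linarith
  have := master hm hreg hM (ψ := .zero) (f := .up t₀ l) (k := .one) (fun _ => le_rfl)
    (Profile.up_d_nonneg t₀ hl0.le) (fun _ => le_rfl) (fun x _ _ => (Profile.up t₀ l).le_one x)
    h3 (K₀ := ε') (K₁ := B * ε' + 4 / l * (L * Real.log t)) ?_ ?_ hc hcd
  · have hg : 0 ≤ ∫ τ in t₀..t, ∫ r in c..d, z.good .zero (.up t₀ l) .one r τ := by
      refine ContPos.integral₂_nonneg h3 hc hcd fun r τ hr _ _ => ?_
      simp only [good, Profile.zero, Profile.one, neg_zero, zero_mul, zero_add]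
      have := (Profile.up t₀ l).le_one (τ - r)
      have := effForce_nonneg hm1 hr
      exact mul_nonneg (by linarith) (by positivity)
    have hq : ∫ r in c..d, z.q .zero (.up t₀ l) .one r t = ∫ r in c..d, 2 * z.e r t := by
      refine intervalIntegral.integral_congr fun r hr => ?_
      rw [uIcc_of_le hcd] at hr
      simp only [q, Profile.zero, Profile.one, zero_mul, zero_add, one_mul]
      rw [Profile.up_v_of_ge hl0 (by linarith [hr.2])]
      ring
    rw [hq, intervalIntegral.integral_const_mul] at this
    have hsum : ε' + B * ε' = ε := by
      have : ε' * (B + 1) = ε := div_mul_cancel₀ ε (by positivity)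
      linarith
    linarith
  · refine (hin t₀ ((le_max_right _ _).trans (le_max_right _ _))).congr fun r hr => ?_
    simp only [q, Profile.zero, Profile.one, zero_mul, zero_add, one_mul]
    rw [Profile.up_v_of_le hl0 (by linarith)]
    ring
  · intro c d hc hcd
    have c1 : ContPos (fun r τ => B * (z.w r τ ^ 2 / r ^ 2)) := z.cont_w_sq.const_mul _
    have c0 : ContPos (fun (_ : ℝ) τ => 1 / max 1 τ) := by
      refine ContPos.of_continuous ?_
      have : ∀ q : ℝ × ℝ, max 1 q.2 ≠ 0 := fun q => (lt_max_of_lt_left one_pos).ne'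
      fun_prop (disch := exact this _)
    have c2 : ContPos (fun r τ => 1 / max 1 τ * z.w r τ ^ 2) := c0.mul (z.cont_w.pow 2)
    refine ((z.cont_bad _ _).integral₂_mono (c1.add (c2.const_mul (4 / l))) h3 hc hcd
      fun r τ hr _ hτ _ => bad_up_le hm1 h1t hle (hc.trans_le hr) hτ).trans ?_
    rw [c1.integral₂_add (c2.const_mul (4 / l)) _ _ hc hcd, ContPos.integral₂_const_mul,
      ContPos.integral₂_const_mul]
    refine add_le_add ?_ ?_
    · exact mul_le_mul_of_nonneg_left (htail t₀ t
        ((le_max_left _ _).trans (le_max_right _ _)) h3 c d hc hcd) (by positivity)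
    · refine mul_le_mul_of_nonneg_left ?_ (by positivity)
      calc ∫ τ in t₀..t, ∫ r in c..d, 1 / max 1 τ * z.w r τ ^ 2
          ≤ ∫ τ in t₀..t, 1 / τ * L := by
            refine intervalIntegral.integral_mono_on h3
              (c2.intervalIntegrable_integral hc hcd _ _) ?_ fun τ hτ => ?_
            · refine ContinuousOn.intervalIntegrable ?_
              rw [uIcc_of_le h3]
              intro x hx
              have : x ≠ 0 := by linarith [hx.1]
              exact ContinuousAt.continuousWithinAt (by fun_prop (disch := assumption))
            · rw [intervalIntegral.integral_const_mul, max_eq_right (by linarith [hτ.1])]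
              exact mul_le_mul_of_nonneg_left (hL τ (by linarith [hτ.1]) c d hc hcd)
                (one_div_nonneg.2 (by linarith [hτ.1]))
        _ = Real.log (t / t₀) * L := by
            rw [intervalIntegral.integral_mul_const, integral_one_div_of_pos (by linarith)
              (by linarith)]
        _ ≤ L * Real.log t := by
            rw [mul_comm]
            have h0 : 0 < t := by linarith
            refine mul_le_mul_of_nonneg_left (Real.log_le_log (by positivity) ?_) hL0
            exact div_le_self h0.le h1t

end RadialWave

lemma ContPos.param_integral {F : ℝ → ℝ → ℝ} (hF : ContPos F) {φ : ℝ → ℝ → ℝ}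
    (hφ : Continuous (fun q : ℝ × ℝ => φ q.1 q.2)) :
    ContPos (fun r x => ∫ θ in (0 : ℝ)..1, F r (φ x θ)) := by
  refine ContPos.of_comp_max fun c hc => ?_
  refine intervalIntegral.continuous_parametric_intervalIntegral_of_continuous'
    (f := fun (q : ℝ × ℝ) θ => F (max c q.1) (φ q.2 θ)) ?_ 0 1
  have h := hF.comp_max hc
  exact h.comp (f := fun p : (ℝ × ℝ) × ℝ => (p.1.1, φ p.1.2 p.2)) (by fun_prop)

namespace RadialWave

variable {m : ℝ}

/-- Linear combination of waves. -/
def lin (α β : ℝ) (y z : RadialWave m) : RadialWave m where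
  w := fun r t => α * y.w r t + β * z.w r t
  a := fun r t => α * y.a r t + β * z.a r t
  b := fun r t => α * y.b r t + β * z.b r t
  ar := fun r t => α * y.ar r t + β * z.ar r t
  c := fun r t => α * y.c r t + β * z.c r t
  w_r := fun r t hr => ((y.w_r r t hr).const_mul α).add ((z.w_r r t hr).const_mul β)
  w_t := fun r t hr => ((y.w_t r t hr).const_mul α).add ((z.w_t r t hr).const_mul β)
  a_r := fun r t hr => ((y.a_r r t hr).const_mul α).add ((z.a_r r t hr).const_mul β)
  a_t := fun r t hr => ((y.a_t r t hr).const_mul α).add ((z.a_t r t hr).const_mul β)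
  b_r := fun r t hr => ((y.b_r r t hr).const_mul α).add ((z.b_r r t hr).const_mul β)
  b_t := fun r t hr =>
    (((y.b_t r t hr).const_mul α).add ((z.b_t r t hr).const_mul β)).congr_deriv (by ring)
  cont_w := (y.cont_w.const_mul α).add (z.cont_w.const_mul β)
  cont_a := (y.cont_a.const_mul α).add (z.cont_a.const_mul β)
  cont_b := (y.cont_b.const_mul α).add (z.cont_b.const_mul β)
  cont_ar := (y.cont_ar.const_mul α).add (z.cont_ar.const_mul β)
  cont_c := (y.cont_c.const_mul α).add (z.cont_c.const_mul β)
  near := fun T => by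
    obtain ⟨C, hC⟩ := y.near T
    obtain ⟨C', hC'⟩ := z.near T
    refine ⟨|α| * C + |β| * C', fun r t hr hr1 ht => (abs_add_le _ _).trans ?_⟩
    rw [abs_mul, abs_mul]
    have h1 := mul_le_mul_of_nonneg_left (hC r t hr hr1 ht) (abs_nonneg α)
    have h2 := mul_le_mul_of_nonneg_left (hC' r t hr hr1 ht) (abs_nonneg β)
    linarith

/-- Time translate of a wave. -/
def shift (s : ℝ) (z : RadialWave m) : RadialWave m where
  w := fun r t => z.w r (t + s)
  a := fun r t => z.a r (t + s)
  b := fun r t => z.b r (t + s)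
  ar := fun r t => z.ar r (t + s)
  c := fun r t => z.c r (t + s)
  w_r := fun r t hr => z.w_r r (t + s) hr
  w_t := fun r t hr => (z.w_t r (t + s) hr).comp_add_const t s
  a_r := fun r t hr => z.a_r r (t + s) hr
  a_t := fun r t hr => (z.a_t r (t + s) hr).comp_add_const t s
  b_r := fun r t hr => z.b_r r (t + s) hr
  b_t := fun r t hr => (z.b_t r (t + s) hr).comp_add_const t s
  cont_w := z.cont_w.shift s
  cont_a := z.cont_a.shift s
  cont_b := z.cont_b.shift s
  cont_ar := z.cont_ar.shift s
  cont_c := z.cont_c.shift s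
  near := fun T => by
    obtain ⟨C, hC⟩ := z.near (T + |s|)
    exact ⟨C, fun r t hr hr1 ht => hC r _ hr hr1 ((abs_add_le _ _).trans (by linarith))⟩

lemma e_lin_le (hm : 1 ≤ m) (α β : ℝ) (y z : RadialWave m) {r : ℝ} (hr : 0 < r) (t : ℝ) :
    (lin α β y z).e r t ≤ 2 * α ^ 2 * y.e r t + 2 * β ^ 2 * z.e r t := by
  have hV := effPot_nonneg hm hr
  have h : ∀ u v : ℝ, (α * u + β * v) ^ 2 ≤ 2 * α ^ 2 * u ^ 2 + 2 * β ^ 2 * v ^ 2 := fun u v => by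
    nlinarith [sq_nonneg (α * u - β * v)]
  have h1 := h (y.a r t) (z.a r t)
  have h2 := h (y.b r t) (z.b r t)
  have h3 := mul_le_mul_of_nonneg_left (h (y.w r t) (z.w r t)) hV
  simp only [e, lin]
  linarith

lemma intLe_e_lin (hm : 1 ≤ m) (α β : ℝ) {y z : RadialWave m} {t K K' : ℝ}
    (hy : IntLe (fun r => y.e r t) K) (hz : IntLe (fun r => z.e r t) K') :
    IntLe (fun r => (lin α β y z).e r t) (2 * α ^ 2 * K + 2 * β ^ 2 * K') :=
  ((hy.const_mul (by positivity)).add (hz.const_mul (by positivity))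
    ((y.cont_e.const_mul _).continuousOn_fst t) ((z.cont_e.const_mul _).continuousOn_fst t)).mono_fun
    ((lin α β y z).cont_e_fst t)
    (((y.cont_e.const_mul (2 * α ^ 2)).add (z.cont_e.const_mul (2 * β ^ 2))).continuousOn_fst t)
    fun _ hr => e_lin_le hm α β y z hr t

lemma Bdd.lin (hm : 1 ≤ m) (α β : ℝ) {y z : RadialWave m} {K K' : ℝ} (hy : y.Bdd K)
    (hz : z.Bdd K') : (lin α β y z).Bdd (2 * α ^ 2 * K + 2 * β ^ 2 * K') :=
  fun t => intLe_e_lin hm α β (hy t) (hz t)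

lemma Bdd.shift {z : RadialWave m} {K : ℝ} (hz : z.Bdd K) (s : ℝ) : (z.shift s).Bdd K :=
  fun t => hz (t + s)

lemma Reg.lin (α β : ℝ) {y z : RadialWave m} (hy : y.Reg) (hz : z.Reg) :
    (lin α β y z).Reg := fun T => by
  obtain ⟨C, hC⟩ := hy T
  obtain ⟨C', hC'⟩ := hz T
  refine ⟨|α| * C + |β| * C', fun r t hr hr1 ht => (abs_add_le _ _).trans ?_⟩
  rw [abs_mul, abs_mul]
  have h1 := mul_le_mul_of_nonneg_left (hC r t hr hr1 ht) (abs_nonneg α)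
  have h2 := mul_le_mul_of_nonneg_left (hC' r t hr hr1 ht) (abs_nonneg β)
  linarith

lemma Reg.shift {z : RadialWave m} (hz : z.Reg) (s : ℝ) : (z.shift s).Reg := fun T => by
  obtain ⟨C, hC⟩ := hz (T + |s|)
  exact ⟨C, fun r t hr hr1 ht => hC r _ hr hr1 ((abs_add_le _ _).trans (by linarith))⟩

/-- Sliding time average of a wave over `[t, t + h]`. -/
noncomputable def avg (h : ℝ) (z : RadialWave m) : RadialWave m where
  w := fun r t => ∫ θ in (0 : ℝ)..1, z.w r (t + h * θ)
  a := fun r t => ∫ θ in (0 : ℝ)..1, z.a r (t + h * θ)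
  b := fun r t => ∫ θ in (0 : ℝ)..1, z.b r (t + h * θ)
  ar := fun r t => ∫ θ in (0 : ℝ)..1, z.ar r (t + h * θ)
  c := fun r t => ∫ θ in (0 : ℝ)..1, z.c r (t + h * θ)
  w_r := fun r t hr => hasDerivAt_integral_param (Ioi_mem_nhds hr)
    (z.cont_w.comp (f := fun q : ℝ × ℝ => (q.1, t + h * q.2)) (by fun_prop) fun _ hq => ⟨hq.1, trivial⟩)
    (z.cont_a.comp (f := fun q : ℝ × ℝ => (q.1, t + h * q.2)) (by fun_prop) fun _ hq => ⟨hq.1, trivial⟩)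
    fun x hx θ => z.w_r x _ hx
  w_t := fun r t hr => hasDerivAt_integral_param univ_mem
    ((z.cont_w.continuous_snd hr).comp (by fun_prop : Continuous fun q : ℝ × ℝ => q.1 + h * q.2)).continuousOn
    ((z.cont_b.continuous_snd hr).comp (by fun_prop : Continuous fun q : ℝ × ℝ => q.1 + h * q.2)).continuousOn
    fun x _ θ => (z.w_t r _ hr).comp_add_const x _
  a_r := fun r t hr => hasDerivAt_integral_param (Ioi_mem_nhds hr)
    (z.cont_a.comp (f := fun q : ℝ × ℝ => (q.1, t + h * q.2)) (by fun_prop) fun _ hq => ⟨hq.1, trivial⟩)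
    (z.cont_ar.comp (f := fun q : ℝ × ℝ => (q.1, t + h * q.2)) (by fun_prop) fun _ hq => ⟨hq.1, trivial⟩)
    fun x hx θ => z.a_r x _ hx
  a_t := fun r t hr => hasDerivAt_integral_param univ_mem
    ((z.cont_a.continuous_snd hr).comp (by fun_prop : Continuous fun q : ℝ × ℝ => q.1 + h * q.2)).continuousOn
    ((z.cont_c.continuous_snd hr).comp (by fun_prop : Continuous fun q : ℝ × ℝ => q.1 + h * q.2)).continuousOn
    fun x _ θ => (z.a_t r _ hr).comp_add_const x _
  b_r := fun r t hr => hasDerivAt_integral_param (Ioi_mem_nhds hr)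
    (z.cont_b.comp (f := fun q : ℝ × ℝ => (q.1, t + h * q.2)) (by fun_prop) fun _ hq => ⟨hq.1, trivial⟩)
    (z.cont_c.comp (f := fun q : ℝ × ℝ => (q.1, t + h * q.2)) (by fun_prop) fun _ hq => ⟨hq.1, trivial⟩)
    fun x hx θ => z.b_r x _ hx
  b_t := fun r t hr => by
    have cw := z.cont_w.continuous_snd hr
    have car := z.cont_ar.continuous_snd hr
    refine (hasDerivAt_integral_param (F' := fun t θ => z.ar r (t + h * θ)
      - effPot m r * z.w r (t + h * θ)) univ_mem
      ((z.cont_b.continuous_snd hr).comp (by fun_prop : Continuous fun q : ℝ × ℝ => q.1 + h * q.2)).continuousOn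
      (Continuous.continuousOn (by fun_prop))
      fun x _ θ => (z.b_t r _ hr).comp_add_const x _).congr_deriv ?_
    rw [intervalIntegral.integral_sub, intervalIntegral.integral_const_mul]
    · exact Continuous.intervalIntegrable (by fun_prop) _ _
    · exact Continuous.intervalIntegrable (by fun_prop) _ _
  cont_w := z.cont_w.param_integral (by fun_prop)
  cont_a := z.cont_a.param_integral (by fun_prop)
  cont_b := z.cont_b.param_integral (by fun_prop)
  cont_ar := z.cont_ar.param_integral (by fun_prop)
  cont_c := z.cont_c.param_integral (by fun_prop)
  near := fun T => by
    obtain ⟨C, hC⟩ := z.near (T + |h|)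
    refine ⟨C, fun r t hr hr1 ht => ?_⟩
    have := intervalIntegral.norm_integral_le_of_norm_le_const (a := 0) (b := 1) (C := C * r ^ m)
      (f := fun θ => z.w r (t + h * θ)) fun θ hθ => hC r _ hr hr1 ?_
    · simpa using this
    · rw [uIoc_of_le zero_le_one] at hθ
      refine (abs_add_le _ _).trans (add_le_add ht ?_)
      rw [abs_mul, abs_of_pos hθ.1]
      exact mul_le_of_le_one_right (abs_nonneg _) hθ.2

lemma avg_b (z : RadialWave m) {h : ℝ} (hh : h ≠ 0) {r : ℝ} (hr : 0 < r) (t : ℝ) :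
    (z.avg h).b r t = (z.w r (t + h) - z.w r t) / h := by
  have hd : ∀ θ : ℝ, HasDerivAt (fun θ => z.w r (t + h * θ) / h) (z.b r (t + h * θ)) θ := fun θ => by
    have h1 := (z.w_t r (t + h * θ) hr).comp θ (((hasDerivAt_id θ).const_mul h).const_add t)
    refine (h1.div_const h).congr_deriv ?_
    field_simp
  have cb := z.cont_b.continuous_snd hr
  have := intervalIntegral.integral_eq_sub_of_hasDerivAt (a := 0) (b := 1) (fun θ _ => hd θ)
    (Continuous.intervalIntegrable (by fun_prop) _ _)
  show ∫ θ in (0 : ℝ)..1, z.b r (t + h * θ) = _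
  rw [this]
  simp only [mul_one, mul_zero, add_zero]
  ring

lemma reg_avg (z : RadialWave m) {h : ℝ} (hh : h ≠ 0) : (z.avg h).Reg := fun T => by
  obtain ⟨C, hC⟩ := z.near (T + |h|)
  refine ⟨(C + C) / |h|, fun r t hr hr1 ht => ?_⟩
  rw [z.avg_b hh hr, abs_div, div_mul_eq_mul_div, add_mul]
  gcongr
  refine (abs_sub _ _).trans (add_le_add (hC r _ hr hr1 ((abs_add_le _ _).trans (by linarith)))
    (hC r _ hr hr1 (by linarith [abs_nonneg h])))

lemma e_avg_le (hm : 1 ≤ m) (z : RadialWave m) (h : ℝ) {r : ℝ} (hr : 0 < r) (t : ℝ) :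
    (z.avg h).e r t ≤ ∫ θ in (0 : ℝ)..1, z.e r (t + h * θ) := by
  have hV := effPot_nonneg hm hr
  have cw := z.cont_w.continuous_snd hr
  have ca := z.cont_a.continuous_snd hr
  have cb := z.cont_b.continuous_snd hr
  have h1 := sq_integral_le (f := fun θ => z.w r (t + h * θ)) (by fun_prop)
  have h2 := sq_integral_le (f := fun θ => z.a r (t + h * θ)) (by fun_prop)
  have h3 := sq_integral_le (f := fun θ => z.b r (t + h * θ)) (by fun_prop)
  have h4 : ∫ θ in (0 : ℝ)..1, z.e r (t + h * θ) = ((∫ θ in (0 : ℝ)..1, z.a r (t + h * θ) ^ 2)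
      + (∫ θ in (0 : ℝ)..1, z.b r (t + h * θ) ^ 2)
      + effPot m r * ∫ θ in (0 : ℝ)..1, z.w r (t + h * θ) ^ 2) / 2 := by
    simp only [e]
    rw [intervalIntegral.integral_div, intervalIntegral.integral_add,
      intervalIntegral.integral_add, intervalIntegral.integral_const_mul] <;>
    exact Continuous.intervalIntegrable (by fun_prop) _ _
  have h5 := mul_le_mul_of_nonneg_left h1 hV
  rw [h4]
  simp only [e, avg]
  linarith

/-- Jensen for the energy of an average. -/
lemma intLe_e_avg (hm : 1 ≤ m) {z : RadialWave m} {h t K : ℝ}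
    (hK : ∀ θ, 0 ≤ θ → θ ≤ 1 → IntLe (fun r => z.e r (t + h * θ)) K) :
    IntLe (fun r => (z.avg h).e r t) K := by
  intro c d hc hcd
  have hcont : ContPos (fun r θ => z.e r (t + h * θ)) :=
    z.cont_e.comp (f := fun q : ℝ × ℝ => (q.1, t + h * q.2)) (by fun_prop)
      fun _ hq => ⟨hq.1, trivial⟩
  calc ∫ r in c..d, (z.avg h).e r t
      ≤ ∫ r in c..d, ∫ θ in (0 : ℝ)..1, z.e r (t + h * θ) :=
        intervalIntegral.integral_mono_on hcd ((z.avg h).cont_e.intervalIntegrable t hc hcd)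
          (hcont.intervalIntegrable_integral_snd hc hcd 0 1)
          fun r hr => e_avg_le hm z h (hc.trans_le hr.1) t
    _ = ∫ θ in (0 : ℝ)..1, ∫ r in c..d, z.e r (t + h * θ) :=
        hcont.integral_swap hc hcd zero_le_one
    _ ≤ (1 - 0) * K := hcont.integral₂_le zero_le_one hc hcd fun θ h0 h1 => hK θ h0 h1 c d hc hcd
    _ = K := by ring

lemma Bdd.avg (hm : 1 ≤ m) {z : RadialWave m} {M : ℝ} (hz : z.Bdd M) (h : ℝ) :
    (z.avg h).Bdd M := fun _ => intLe_e_avg hm fun _ _ _ => hz _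

lemma tendsto_avg (z : RadialWave m) (t : ℝ) {c d : ℝ} (hc : 0 < c) (hcd : c ≤ d) :
    Tendsto (fun h => ∫ r in c..d, (z.avg h).e r t) (𝓝 0) (𝓝 (∫ r in c..d, z.e r t)) := by
  have hφ : Continuous (fun q : ℝ × ℝ => t + q.1 * q.2) := by fun_prop
  have cw := z.cont_w.param_integral (φ := fun h θ => t + h * θ) hφ
  have ca := z.cont_a.param_integral (φ := fun h θ => t + h * θ) hφ
  have cb := z.cont_b.param_integral (φ := fun h θ => t + h * θ) hφ
  have hcont : ContPos (fun r h => (z.avg h).e r t) := by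
    have := (((ca.pow 2).add (cb.pow 2)).add
      ((contPos_effPot m).mul (cw.pow 2))).mul (ContPos.const (1 / 2))
    refine this.congr fun q _ => ?_
    simp only [e, avg]; ring
  have := (hcont.continuous_integral hc hcd).tendsto 0
  have h0 : ∫ r in c..d, (z.avg 0).e r t = ∫ r in c..d, z.e r t := by
    congr 1; ext r; simp [e, avg]
  rwa [h0] at this

/-- An energy bound on a time interval persists for all later times. -/
theorem energy_le_of_interval (hm : Adm m) {z : RadialWave m} {M : ℝ} (hM : z.Bdd M) {τ K : ℝ}
    (hτ : 0 < τ) (hK : ∀ s, 0 ≤ s → s ≤ τ → IntLe (fun r => z.e r s) K) {t : ℝ} (ht : 0 ≤ t) :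
    IntLe (fun r => z.e r t) K := by
  intro c d hc hcd
  refine le_of_tendsto ((z.tendsto_avg t hc hcd).mono_left (nhdsWithin_le_nhds (s := Ioi 0))) ?_
  filter_upwards [Ioc_mem_nhdsGT hτ] with h hh
  refine energy_le hm (z.reg_avg hh.1.ne') (hM.avg hm.one_le h) ht (K := K)
    (intLe_e_avg hm.one_le fun θ h0 h1 => hK _ ?_ ?_) c d hc hcd
  · have := hh.1; positivity
  · have := mul_le_of_le_one_right hh.1.le h1
    linarith [hh.2]

end RadialWave

lemma contPos_inv : ContPos (fun r _ => 1 / r) := by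
  refine ContPos.of_fst fun r hr => ContinuousAt.continuousWithinAt ?_
  have : r ≠ 0 := ne_of_gt hr
  fun_prop (disch := assumption)

/-- A continuous function takes a value below its mean over a unit interval. -/
lemma exists_le_integral {f : ℝ → ℝ} {d : ℝ} (hf : ContinuousOn f (Icc d (d + 1))) :
    ∃ x ∈ Icc d (d + 1), f x ≤ ∫ y in d..d + 1, f y := by
  obtain ⟨x, hx, hmin⟩ := isCompact_Icc.exists_isMinOn (nonempty_Icc.2 (by linarith)) hf
  refine ⟨x, hx, ?_⟩
  have hfint : IntervalIntegrable f volume d (d + 1) := by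
    apply ContinuousOn.intervalIntegrable
    rwa [uIcc_of_le (by linarith)]
  have := intervalIntegral.integral_mono_on (show d ≤ d + 1 by linarith)
    (intervalIntegrable_const (μ := volume) (c := f x)) hfint fun y hy => hmin hy
  simpa using this

namespace RadialWave

variable {m : ℝ} {z : RadialWave m}

/-- The energy density in the original variables. -/
noncomputable def eu (z : RadialWave m) (r t : ℝ) : ℝ :=
  ((z.a r t - m * z.w r t * (1 / r)) ^ 2 + z.b r t ^ 2 + 1 / r * z.w r t ^ 2) / 2

lemma cont_eu (z : RadialWave m) : ContPos z.eu := by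
  have := ((((z.cont_a.sub ((z.cont_w.const_mul m).mul contPos_inv)).pow 2).add
    (z.cont_b.pow 2)).add (contPos_inv.mul (z.cont_w.pow 2))).mul (ContPos.const (1 / 2))
  refine this.congr fun q _ => ?_
  simp only [eu]; ring

lemma eu_nonneg (z : RadialWave m) {r : ℝ} (hr : 0 < r) (t : ℝ) : 0 ≤ z.eu r t := by
  unfold eu; positivity

lemma hasDerivAt_sq_div (z : RadialWave m) {r : ℝ} (hr : 0 < r) (t : ℝ) :
    HasDerivAt (fun x => z.w x t ^ 2 / x) (2 * z.w r t * z.a r t / r - z.w r t ^ 2 / r ^ 2) r := by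
  refine (((z.w_r r t hr).pow 2).div (hasDerivAt_id r) hr.ne').congr_deriv ?_
  simp only [Pi.pow_apply, id_eq]
  field_simp
  push_cast
  ring

lemma integral_sq_div (z : RadialWave m) (t : ℝ) {c d : ℝ} (hc : 0 < c) (hcd : c ≤ d) :
    ∫ r in c..d, (2 * z.w r t * z.a r t / r - z.w r t ^ 2 / r ^ 2)
      = z.w d t ^ 2 / d - z.w c t ^ 2 / c := by
  refine intervalIntegral.integral_eq_sub_of_hasDerivAt (f := fun x => z.w x t ^ 2 / x)
    (fun r hr => ?_) ?_
  · rw [uIcc_of_le hcd] at hr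
    exact z.hasDerivAt_sq_div (hc.trans_le hr.1) t
  · have h : ContPos (fun r t => 2 * z.w r t * z.a r t * (1 / r) - z.w r t ^ 2 / r ^ 2) :=
      ((((z.cont_w.const_mul 2).mul z.cont_a).mul contPos_inv).sub z.cont_w_sq)
    have := h.intervalIntegrable t hc hcd
    simpa only [mul_one_div] using this

lemma hardy_pointwise {w y r m : ℝ} (hm : 1 ≤ m) (hr : 0 < r) :
    w ^ 2 / r ^ 2 / 2 - 2 * (y - m * w * (1 / r)) ^ 2 ≤ 2 * w * y / r - w ^ 2 / r ^ 2 := by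
  set X := w / r with hX
  have hw : w = X * r := by rw [hX]; field_simp
  set Y := y - m * w * (1 / r) with hY
  have hy : y = Y + m * X := by rw [hY, hX]; ring
  have e1 : 2 * w * y / r = 2 * X * y := by rw [hX]; ring
  have e2 : w ^ 2 / r ^ 2 = X ^ 2 := by rw [hX]; ring
  rw [e1, e2, hy]
  nlinarith [sq_nonneg (X + 2 * Y), mul_nonneg (sub_nonneg.2 hm) (sq_nonneg X)]

/-- Hardy's inequality: the energy is controlled by the energy in the original variables. -/
lemma hardy (hm : 1 ≤ m) {t K : ℝ} (hK : IntLe (fun r => z.eu r t) K) :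
    IntLe (fun r => z.e r t) ((2 + 12 * (m ^ 2 + m * (m - 1))) * K) := by
  have hlam : 0 ≤ m * (m - 1) := by nlinarith
  intro c d hc hcd
  have hd : 0 < d := hc.trans_le hcd
  have hw1 : ContPos (fun r t => z.w r t ^ 2 / r) := by
    simpa only [mul_one_div] using (z.cont_w.pow 2).mul contPos_inv
  obtain ⟨d', ⟨hd1, hd2⟩, hdK⟩ := exists_le_integral (f := fun r => z.w r t ^ 2 / r) (d := d)
    ((hw1.continuousOn_fst t).mono fun x hx => hd.trans_le hx.1)
  have hK1 : ∫ r in d..d + 1, z.w r t ^ 2 / r ≤ 2 * K := by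
    have h1 : ∫ r in d..d + 1, z.w r t ^ 2 / r ≤ ∫ r in d..d + 1, 2 * z.eu r t := by
      refine hw1.integral_mono (z.cont_eu.const_mul 2) t hd (by linarith) fun r hr _ => ?_
      have h2 : z.w r t ^ 2 / r = 1 / r * z.w r t ^ 2 := by ring
      rw [h2]
      unfold eu
      nlinarith [sq_nonneg (z.a r t - m * z.w r t * (1 / r)), sq_nonneg (z.b r t)]
    rw [intervalIntegral.integral_const_mul] at h1
    have := hK d (d + 1) hd (by linarith)
    linarith
  have hcd' : c ≤ d' := hcd.trans hd1
  have h1 : ∫ r in c..d', (z.w r t ^ 2 / r ^ 2 * (1 / 2) - 4 * z.eu r t)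
      ≤ ∫ r in c..d', (2 * z.w r t * z.a r t * (1 / r) - z.w r t ^ 2 / r ^ 2) := by
    refine ContPos.integral_mono
      (F := fun r t => z.w r t ^ 2 / r ^ 2 * (1 / 2) - 4 * z.eu r t)
      (G := fun r t => 2 * z.w r t * z.a r t * (1 / r) - z.w r t ^ 2 / r ^ 2)
      ((z.cont_w_sq.mul (ContPos.const _)).sub (z.cont_eu.const_mul 4))
      ((((z.cont_w.const_mul 2).mul z.cont_a).mul contPos_inv).sub z.cont_w_sq) t hc hcd'
      fun r hr _ => ?_
    have hr0 := hc.trans_le hr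
    have := hardy_pointwise (w := z.w r t) (y := z.a r t) hm hr0
    have h2 : 2 * (z.a r t - m * z.w r t * (1 / r)) ^ 2 ≤ 4 * z.eu r t := by
      have : 0 ≤ 1 / r * z.w r t ^ 2 := by positivity
      unfold eu
      nlinarith [sq_nonneg (z.b r t)]
    have e1 : 2 * z.w r t * z.a r t * (1 / r) = 2 * z.w r t * z.a r t / r := mul_one_div _ _
    rw [e1]
    linarith
  have h2 := z.integral_sq_div t hc hcd'
  simp only [mul_one_div] at h1
  rw [h2, intervalIntegral.integral_sub, intervalIntegral.integral_div,
    intervalIntegral.integral_const_mul] at h1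
  rotate_left
  · simpa only [mul_one_div] using
      (z.cont_w_sq.mul (ContPos.const (1 / 2))).intervalIntegrable t hc hcd'
  · exact (z.cont_eu.const_mul 4).intervalIntegrable t hc hcd'
  have h3 := hK c d' hc hcd'
  have h4 : 0 ≤ z.w c t ^ 2 / c := by positivity
  have h5 : ∫ r in c..d, z.w r t ^ 2 / r ^ 2 ≤ 12 * K := by
    have := z.cont_w_sq.integral_mono_interval t (fun r hr => by positivity) hc le_rfl hcd hd1
    linarith
  have h6 : ∫ r in c..d, z.e r t
      ≤ ∫ r in c..d, (2 * z.eu r t + (m ^ 2 + m * (m - 1)) * (z.w r t ^ 2 / r ^ 2)) := by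
    refine z.cont_e.integral_mono ((z.cont_eu.const_mul 2).add (z.cont_w_sq.const_mul _)) t hc hcd
      fun r hr _ => ?_
    have hr0 := hc.trans_le hr
    have hX : m * z.w r t * (1 / r) = m * (z.w r t / r) := by ring
    have hX2 : z.w r t ^ 2 / r ^ 2 = (z.w r t / r) ^ 2 := by ring
    have hX3 : effPot m r * z.w r t ^ 2 = m * (m - 1) * (z.w r t / r) ^ 2
      + 1 / r * z.w r t ^ 2 := by unfold effPot; ring
    have h1r : 0 ≤ 1 / r * z.w r t ^ 2 := by positivity
    unfold e eu
    rw [hX, hX2, hX3]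
    set X := z.w r t / r
    have h8 : z.a r t ^ 2 ≤ 2 * (z.a r t - m * X) ^ 2 + 2 * m ^ 2 * X ^ 2 := by
      nlinarith [sq_nonneg (z.a r t - 2 * m * X)]
    have h9 : 0 ≤ m * (m - 1) * X ^ 2 := by positivity
    nlinarith [sq_nonneg (z.b r t)]
  rw [ContPos.integral_add' (F := fun r t => 2 * z.eu r t)
    (G := fun r t => (m ^ 2 + m * (m - 1)) * (z.w r t ^ 2 / r ^ 2)) (z.cont_eu.const_mul 2)
    (z.cont_w_sq.const_mul _) t hc hcd, intervalIntegral.integral_const_mul,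
    intervalIntegral.integral_const_mul] at h6
  have h7 := hK c d hc hcd
  have h8 := mul_le_mul_of_nonneg_left h5 (show 0 ≤ m ^ 2 + m * (m - 1) by positivity)
  linarith

lemma eu_le (hm : 1 ≤ m) (z : RadialWave m) {r : ℝ} (hr : 0 < r) (t : ℝ) :
    z.eu r t ≤ 2 * z.e r t + m ^ 2 * (z.w r t ^ 2 / r ^ 2) := by
  have hlam : 0 ≤ m * (m - 1) := by nlinarith
  have hX : m * z.w r t * (1 / r) = m * (z.w r t / r) := by ring
  have hX2 : z.w r t ^ 2 / r ^ 2 = (z.w r t / r) ^ 2 := by ring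
  have hX3 : effPot m r * z.w r t ^ 2 = m * (m - 1) * (z.w r t / r) ^ 2
    + 1 / r * z.w r t ^ 2 := by unfold effPot; ring
  have h1r : 0 ≤ 1 / r * z.w r t ^ 2 := by positivity
  unfold e eu
  rw [hX, hX2, hX3]
  set X := z.w r t / r
  have h9 : 0 ≤ m * (m - 1) * X ^ 2 := by positivity
  nlinarith [sq_nonneg (z.b r t), sq_nonneg (z.a r t + m * X)]

/-- Far from the origin the original energy density is controlled pointwise. -/
lemma eu_le_of_one_le (hm : 1 ≤ m) (z : RadialWave m) {r : ℝ} (hr : 1 ≤ r) (t : ℝ) :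
    z.eu r t ≤ (2 + 2 * m ^ 2) * z.e r t := by
  have hr0 : 0 < r := by linarith
  have h1 := z.eu_le hm hr0 t
  have h2 : z.w r t ^ 2 / r ^ 2 ≤ effPot m r * z.w r t ^ 2 := by
    have h3 : 1 / r ^ 2 ≤ 1 / r := one_div_le_one_div_of_le hr0 (by nlinarith)
    calc z.w r t ^ 2 / r ^ 2 = 1 / r ^ 2 * z.w r t ^ 2 := by ring
      _ ≤ effPot m r * z.w r t ^ 2 := by
        gcongr; exact h3.trans (inv_le_effPot hm hr0)
  have h4 := z.pot_le_e r t
  nlinarith [sq_nonneg m]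

/-- Hardy's inequality near the origin. -/
lemma hardy_inside (hm : 1 ≤ m) (z : RadialWave m) {t R K : ℝ}
    (hK : ∀ c d, 0 < c → c ≤ d → d ≤ R → ∫ r in c..d, z.e r t ≤ K) {c d : ℝ} (hc : 0 < c)
    (hcd : c ≤ d) (hd : d ≤ R) : ∫ r in c..d, z.eu r t ≤ (2 + 8 * m ^ 2) * K := by
  have hlam : 0 ≤ m * (m - 1) := by nlinarith
  have hlow : ∀ c', 0 < c' → c' ≤ c → ∫ r in c..d, z.w r t ^ 2 / r ^ 2
      ≤ 2 * (z.w c' t ^ 2 / c') + 8 * K := by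
    intro c' hc' hcc
    have hcd' := hcc.trans hcd
    have h1 : ∫ r in c'..d, (2 * z.w r t * z.a r t * (1 / r) - z.w r t ^ 2 / r ^ 2)
        ≤ ∫ r in c'..d, (4 * z.e r t - z.w r t ^ 2 / r ^ 2 * (1 / 2)) := by
      refine ContPos.integral_mono
        (F := fun r t => 2 * z.w r t * z.a r t * (1 / r) - z.w r t ^ 2 / r ^ 2)
        (G := fun r t => 4 * z.e r t - z.w r t ^ 2 / r ^ 2 * (1 / 2))
        ((((z.cont_w.const_mul 2).mul z.cont_a).mul contPos_inv).sub z.cont_w_sq)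
        ((z.cont_e.const_mul 4).sub (z.cont_w_sq.mul (ContPos.const _))) t hc' hcd'
        fun r hr _ => ?_
      have hr0 := hc'.trans_le hr
      have hV := mul_nonneg (effPot_nonneg hm hr0) (sq_nonneg (z.w r t))
      have e1 : 2 * z.w r t * z.a r t * (1 / r) = 2 * (z.w r t / r) * z.a r t := by ring
      have e2 : z.w r t ^ 2 / r ^ 2 = (z.w r t / r) ^ 2 := by ring
      rw [e1, e2]
      unfold e
      nlinarith [sq_nonneg (z.w r t / r - 2 * z.a r t), sq_nonneg (z.b r t)]
    have h2 := z.integral_sq_div t hc' hcd'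
    simp only [mul_one_div] at h1
    rw [h2, intervalIntegral.integral_sub, intervalIntegral.integral_div,
      intervalIntegral.integral_const_mul] at h1
    rotate_left
    · exact (z.cont_e.const_mul 4).intervalIntegrable t hc' hcd'
    · simpa only [mul_one_div] using
        (z.cont_w_sq.mul (ContPos.const (1 / 2))).intervalIntegrable t hc' hcd'
    have h3 := hK c' d hc' hcd' hd
    have h4 : 0 ≤ z.w d t ^ 2 / d := by
      have := hc.trans_le hcd; positivity
    have := z.cont_w_sq.integral_mono_interval t (fun r hr => by positivity) hc' hcc hcd le_rfl
    linarith
  have h5 : ∫ r in c..d, z.w r t ^ 2 / r ^ 2 ≤ 8 * K := by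
    obtain ⟨C, hC⟩ := z.near |t|
    have hlim : Tendsto (fun c' : ℝ => 2 * (C ^ 2 * c') + 8 * K) (𝓝[>] 0) (𝓝 (8 * K)) := by
      have : Continuous (fun c' : ℝ => 2 * (C ^ 2 * c') + 8 * K) := by fun_prop
      have h := this.tendsto 0
      simp only [mul_zero, zero_add] at h
      exact h.mono_left nhdsWithin_le_nhds
    refine ge_of_tendsto hlim ?_
    filter_upwards [Ioc_mem_nhdsGT (show (0 : ℝ) < min 1 c by positivity)] with x ⟨hx, hx'⟩
    have hx1 : x ≤ 1 := hx'.trans (min_le_left _ _)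
    refine (hlow x hx (hx'.trans (min_le_right _ _))).trans ?_
    have h6 : |z.w x t| ≤ C * x ^ m := hC x t hx hx1 le_rfl
    have h7 : x ^ m ≤ x := by
      have := Real.rpow_le_rpow_of_exponent_ge hx hx1 hm
      rwa [Real.rpow_one] at this
    have hC0 : 0 ≤ C := near_nonneg (abs_nonneg t) hC
    have h8 : z.w x t ^ 2 / x ≤ C ^ 2 * x := by
      rw [div_le_iff₀ hx, ← sq_abs]
      calc |z.w x t| ^ 2 ≤ (C * x) ^ 2 := by gcongr; exact h6.trans (by gcongr)
        _ = C ^ 2 * x * x := by ring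
    linarith
  have h6 : ∫ r in c..d, z.eu r t ≤ ∫ r in c..d, (2 * z.e r t + m ^ 2 * (z.w r t ^ 2 / r ^ 2)) :=
    z.cont_eu.integral_mono ((z.cont_e.const_mul 2).add (z.cont_w_sq.const_mul _)) t hc hcd
      fun r hr _ => z.eu_le hm (hc.trans_le hr) t
  rw [ContPos.integral_add' (F := fun r t => 2 * z.e r t)
    (G := fun r t => m ^ 2 * (z.w r t ^ 2 / r ^ 2)) (z.cont_e.const_mul 2)
    (z.cont_w_sq.const_mul _) t hc hcd, intervalIntegral.integral_const_mul,
    intervalIntegral.integral_const_mul] at h6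
  have h7 := hK c d hc hcd hd
  have h8 := mul_le_mul_of_nonneg_left h5 (sq_nonneg m)
  linarith

end RadialWave

namespace RadialWave

variable {m : ℝ}

/-- The wave has energy `E'` in the original variables: it is at most `E'` at all times,
and exactly `E'` at time `0`. -/
structure FiniteEnergy (z : RadialWave m) (E' : ℝ) : Prop where
  le : ∀ t, IntLe (fun r => z.eu r t) E'
  core : ∀ ε > 0, ∃ c d, 0 < c ∧ c ≤ d ∧ E' - ε ≤ ∫ r in c..d, z.eu r 0

lemma FiniteEnergy.bdd (hm : 1 ≤ m) {z : RadialWave m} {E' : ℝ} (h : z.FiniteEnergy E') :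
    z.Bdd ((2 + 12 * (m ^ 2 + m * (m - 1))) * E') := fun t => hardy hm (h.le t)

lemma eu_lin_le (α β : ℝ) (y z : RadialWave m) {r : ℝ} (hr : 0 < r) (t : ℝ) :
    (lin α β y z).eu r t ≤ 2 * α ^ 2 * y.eu r t + 2 * β ^ 2 * z.eu r t := by
  have h : ∀ u v : ℝ, (α * u + β * v) ^ 2 ≤ 2 * α ^ 2 * u ^ 2 + 2 * β ^ 2 * v ^ 2 := fun u v => by
    nlinarith [sq_nonneg (α * u - β * v)]
  have h1 := h (y.a r t - m * y.w r t * (1 / r)) (z.a r t - m * z.w r t * (1 / r))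
  have h2 := h (y.b r t) (z.b r t)
  have h3 := mul_le_mul_of_nonneg_left (h (y.w r t) (z.w r t)) (show 0 ≤ 1 / r by positivity)
  have e1 : α * y.a r t + β * z.a r t - m * (α * y.w r t + β * z.w r t) * (1 / r)
      = α * (y.a r t - m * y.w r t * (1 / r)) + β * (z.a r t - m * z.w r t * (1 / r)) := by ring
  simp only [eu, lin]
  rw [e1]
  linarith

/-- The difference between a wave and its time translate. -/
noncomputable def incr (s : ℝ) (z : RadialWave m) : RadialWave m := lin 1 (-1) z (z.shift s)

lemma continuous_integral_incr (z : RadialWave m) {c d : ℝ} (hc : 0 < c) (hcd : c ≤ d) :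
    Continuous (fun q : ℝ × ℝ => ∫ r in c..d, (z.incr q.1).eu r q.2) := by
  have hw := z.cont_w.comp_max hc
  have ha := z.cont_a.comp_max hc
  have hb := z.cont_b.comp_max hc
  have key : Continuous (fun q : (ℝ × ℝ) × ℝ => (z.incr q.1.1).eu (max c q.2) q.1.2) := by
    have h1 : Continuous fun q : (ℝ × ℝ) × ℝ => (q.2, q.1.2) := by fun_prop
    have h2 : Continuous fun q : (ℝ × ℝ) × ℝ => (q.2, q.1.2 + q.1.1) := by fun_prop
    have w1 := hw.comp h1
    have w2 := hw.comp h2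
    have a1 := ha.comp h1
    have a2 := ha.comp h2
    have b1 := hb.comp h1
    have b2 := hb.comp h2
    simp only [Function.comp_def] at w1 w2 a1 a2 b1 b2
    have hne : ∀ q : (ℝ × ℝ) × ℝ, max c q.2 ≠ 0 := fun q => (hc.trans_le (le_max_left _ _)).ne'
    simp only [eu, incr, lin, shift]
    fun_prop (disch := exact hne _)
  refine (intervalIntegral.continuous_parametric_intervalIntegral_of_continuous'
    (f := fun (q : ℝ × ℝ) r => (z.incr q.1).eu (max c r) q.2)
    (μ := volume) key c d).congr fun q => ?_
  refine intervalIntegral.integral_congr fun r hr => ?_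
  rw [uIcc_of_le hcd] at hr
  simp only [max_eq_right hr.1]

/-- Bound on the three pieces of an interval split at `c₀` and `d₀`. -/
lemma intLe_of_pieces {F : ℝ → ℝ} (cF : ContinuousOn F (Ioi 0)) (h0 : ∀ r, 0 < r → 0 ≤ F r)
    {c₀ d₀ A B C : ℝ} (hc₀ : 0 < c₀) (hcd₀ : c₀ ≤ d₀)
    (hA : ∀ c, 0 < c → c ≤ c₀ → ∫ r in c..c₀, F r ≤ A) (hB : ∫ r in c₀..d₀, F r ≤ B)
    (hC : ∀ d, d₀ ≤ d → ∫ r in d₀..d, F r ≤ C) : IntLe F (A + B + C) := by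
  intro c d hc hcd
  have h1 : 0 < min c c₀ := lt_min hc hc₀
  have h2 := integral_le_of_subinterval cF h0 h1 (min_le_left _ _) hcd (le_max_left d d₀)
  have i : ∀ x y, 0 < x → x ≤ y → IntervalIntegrable F volume x y :=
    fun x y hx hxy => intervalIntegrable_of_pos cF hx hxy
  have h3 := intervalIntegral.integral_add_adjacent_intervals (i _ _ h1 (min_le_right c c₀))
    (i _ _ hc₀ hcd₀)
  have h4 := intervalIntegral.integral_add_adjacent_intervals
    ((i _ _ h1 (min_le_right c c₀)).trans (i _ _ hc₀ hcd₀))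
    (i _ _ (hc₀.trans_le hcd₀) (le_max_right d d₀))
  have h5 := hA _ h1 (min_le_right c c₀)
  have h6 := hC _ (le_max_right d d₀)
  linarith

lemma exists_incr_small {z : RadialWave m} {E' : ℝ} (hF : z.FiniteEnergy E') {ε : ℝ}
    (hε : 0 < ε) : ∃ τ > 0, ∀ s a, 0 ≤ s → s ≤ τ → 0 ≤ a → a ≤ τ →
      IntLe (fun r => (z.incr s).eu r a) (17 * ε) := by
  obtain ⟨c₀, d₀, hc₀, hcd₀, hcore⟩ := hF.core ε hε
  have hd₀ := hc₀.trans_le hcd₀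
  have cont0 := (z.cont_eu.continuous_integral hc₀ hcd₀).tendsto 0
  have cont1 := (z.continuous_integral_incr hc₀ hcd₀).tendsto (0, 0)
  have hz : ∫ r in c₀..d₀, (z.incr 0).eu r 0 = 0 := by simp [incr, eu, lin, shift]
  simp only [] at cont1
  rw [hz] at cont1
  have ev0 := cont0.eventually_const_lt (u := E' - 2 * ε) (by linarith)
  have ev1 := cont1.eventually_lt_const hε
  obtain ⟨δ₀, hδ₀, h0⟩ := Metric.eventually_nhds_iff.1 ev0
  obtain ⟨δ₁, hδ₁, h1⟩ := Metric.eventually_nhds_iff.1 ev1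
  refine ⟨min δ₀ δ₁ / 3, by positivity, fun s a hs hs' ha ha' => ?_⟩
  have hmin0 := min_le_left δ₀ δ₁
  have hmin1 := min_le_right δ₀ δ₁
  have hpos : 0 < min δ₀ δ₁ := lt_min hδ₀ hδ₁
  have hin : ∀ t, 0 ≤ t → t < δ₀ → E' - 2 * ε < ∫ r in c₀..d₀, z.eu r t := fun t ht ht' =>
    h0 (by rw [Real.dist_eq, sub_zero, abs_of_nonneg ht]; exact ht')
  have i : ∀ t x y, 0 < x → x ≤ y → IntervalIntegrable (fun r => z.eu r t) volume x y :=
    fun t x y hx hxy => z.cont_eu.intervalIntegrable t hx hxy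
  have hlo : ∀ t c, 0 ≤ t → t < δ₀ → 0 < c → c ≤ c₀ → ∫ r in c..c₀, z.eu r t ≤ 2 * ε := by
    intro t c ht ht' hc hcc
    have e1 := intervalIntegral.integral_add_adjacent_intervals (i t _ _ hc hcc) (i t _ _ hc₀ hcd₀)
    have e2 := hF.le t c d₀ hc (hcc.trans hcd₀)
    have e3 := hin t ht ht'
    linarith
  have hhi : ∀ t d, 0 ≤ t → t < δ₀ → d₀ ≤ d → ∫ r in d₀..d, z.eu r t ≤ 2 * ε := by
    intro t d ht ht' hd
    have e1 := intervalIntegral.integral_add_adjacent_intervals (i t _ _ hc₀ hcd₀) (i t _ _ hd₀ hd)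
    have e2 := hF.le t c₀ d hc₀ (hcd₀.trans hd)
    have e3 := hin t ht ht'
    linarith
  have hsplit : ∀ x y, 0 < x → x ≤ y → ∫ r in x..y, (z.incr s).eu r a
      ≤ 2 * (∫ r in x..y, z.eu r a) + 2 * ∫ r in x..y, z.eu r (a + s) := by
    intro x y hx hxy
    have e1 : ∫ r in x..y, (z.incr s).eu r a
        ≤ ∫ r in x..y, (2 * z.eu r a + 2 * z.eu r (a + s)) := by
      refine (z.incr s).cont_eu.integral_mono
        ((z.cont_eu.const_mul 2).add ((z.cont_eu.shift s).const_mul 2)) a hx hxy fun r hr _ => ?_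
      have := eu_lin_le 1 (-1) z (z.shift s) (hx.trans_le hr) a
      have e : (z.shift s).eu r a = z.eu r (a + s) := rfl
      rw [e] at this
      simp only [incr]
      linarith
    rwa [ContPos.integral_add' (F := fun r a => 2 * z.eu r a)
      (G := fun r a => 2 * z.eu r (a + s)) (z.cont_eu.const_mul 2)
      ((z.cont_eu.shift s).const_mul 2) a hx hxy, intervalIntegral.integral_const_mul,
      intervalIntegral.integral_const_mul] at e1
  have ha0 : a < δ₀ := by linarith
  have has : a + s < δ₀ := by linarith
  have has0 : 0 ≤ a + s := by linarith
  refine (intLe_of_pieces (A := 8 * ε) (B := ε) (C := 8 * ε)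
    ((z.incr s).cont_eu.continuousOn_fst a) (fun r hr => (z.incr s).eu_nonneg hr a)
    hc₀ hcd₀ (fun c hc hcc => ?_) ?_ fun d hd => ?_).mono (by linarith)
  · have := hsplit c c₀ hc hcc
    linarith [hlo a c ha ha0 hc hcc, hlo (a + s) c has0 has hc hcc]
  · have := @h1 (s, a) (by
      rw [Prod.dist_eq, Real.dist_eq, Real.dist_eq, sub_zero, sub_zero, abs_of_nonneg hs,
        abs_of_nonneg ha]
      exact max_lt (by linarith) (by linarith)
      )
    exact this.le
  · have := hsplit d₀ d hd₀ hd
    linarith [hhi a d ha ha0 hd, hhi (a + s) d has0 has hd]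

lemma e_sub_avg_le (hm : 1 ≤ m) (z : RadialWave m) (h : ℝ) {r : ℝ} (hr : 0 < r) (t : ℝ) :
    (lin 1 (-1) z (z.avg h)).e r t ≤ ∫ θ in (0 : ℝ)..1, (z.incr (h * θ)).e r t := by
  have hV := effPot_nonneg hm hr
  have key : ∀ f : ℝ → ℝ, Continuous f → (1 * f t + -1 * ∫ θ in (0 : ℝ)..1, f (t + h * θ)) ^ 2
      ≤ ∫ θ in (0 : ℝ)..1, (1 * f t + -1 * f (t + h * θ)) ^ 2 := by
    intro f hf
    have h1 := sq_integral_le (f := fun θ => 1 * f t + -1 * f (t + h * θ)) (by fun_prop)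
    rw [intervalIntegral.integral_add (by simp)
      (Continuous.intervalIntegrable (by fun_prop) _ _), intervalIntegral.integral_const_mul (-1)]
      at h1
    simpa using h1
  have cw := z.cont_w.continuous_snd hr
  have ca := z.cont_a.continuous_snd hr
  have cb := z.cont_b.continuous_snd hr
  have h1 := mul_le_mul_of_nonneg_left (key _ cw) hV
  have h2 := key _ ca
  have h3 := key _ cb
  have h4 : ∫ θ in (0 : ℝ)..1, (z.incr (h * θ)).e r t
      = ((∫ θ in (0 : ℝ)..1, (1 * z.a r t + -1 * z.a r (t + h * θ)) ^ 2)
      + (∫ θ in (0 : ℝ)..1, (1 * z.b r t + -1 * z.b r (t + h * θ)) ^ 2)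
      + effPot m r * ∫ θ in (0 : ℝ)..1, (1 * z.w r t + -1 * z.w r (t + h * θ)) ^ 2) / 2 := by
    simp only [e, incr, lin, shift]
    rw [intervalIntegral.integral_div, intervalIntegral.integral_add,
      intervalIntegral.integral_add, intervalIntegral.integral_const_mul] <;>
    exact Continuous.intervalIntegrable (by fun_prop) _ _
  rw [h4]
  simp only [e, lin, avg]
  linarith

/-- Time averages over short intervals approximate a finite energy wave uniformly in time. -/
theorem FiniteEnergy.sub_avg (hm : Adm m) {z : RadialWave m} {E' : ℝ} (hF : z.FiniteEnergy E')
    {ε : ℝ} (hε : 0 < ε) : ∃ h₀ > 0, ∀ h, 0 < h → h ≤ h₀ → ∀ t, 0 ≤ t →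
      IntLe (fun r => (lin 1 (-1) z (z.avg h)).e r t) ε := by
  have hm1 := hm.one_le
  have hlam : 0 ≤ m * (m - 1) := by nlinarith
  set Ch := 2 + 12 * (m ^ 2 + m * (m - 1)) with hCh
  have hCh0 : 0 < Ch := by positivity
  obtain ⟨τ, hτ, hsmall⟩ := exists_incr_small hF (ε := ε / (17 * Ch)) (by positivity)
  have hB := hF.bdd hm1
  refine ⟨τ, hτ, fun h hh hhτ t ht => ?_⟩
  have hD : ∀ s, 0 ≤ s → s ≤ τ → IntLe (fun r => (z.incr s).e r t) ε := by
    intro s hs hs'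
    refine energy_le_of_interval hm (z := z.incr s) (Bdd.lin hm1 1 (-1) hB (hB.shift s)) hτ
      (fun a ha ha' => ?_) ht
    refine (hardy hm1 (hsmall s a hs hs' ha ha')).mono (le_of_eq ?_)
    rw [← hCh]
    field_simp
  intro c d hc hcd
  have hcont : ContPos (fun r θ => (z.incr (h * θ)).e r t) := by
    have diff : ∀ F : ℝ → ℝ → ℝ, ContPos F →
        ContPos fun r θ => 1 * F r t + -1 * F r (t + h * θ) := fun F hF =>
      ((ContinuousOn.comp (f := fun q : ℝ × ℝ => (q.1, t)) hF (by fun_prop)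
        fun _ hq => ⟨hq.1, trivial⟩ : ContPos fun r _ => F r t).const_mul 1).add
      ((ContinuousOn.comp (f := fun q : ℝ × ℝ => (q.1, t + h * q.2)) hF (by fun_prop)
        fun _ hq => ⟨hq.1, trivial⟩ : ContPos fun r θ => F r (t + h * θ)).const_mul (-1))
    have cw := diff _ z.cont_w
    have ca := diff _ z.cont_a
    have cb := diff _ z.cont_b
    have := (((ca.pow 2).add (cb.pow 2)).add
      ((contPos_effPot m).mul (cw.pow 2))).mul (ContPos.const (1 / 2))
    refine this.congr fun q _ => ?_
    simp only [e, incr, lin, shift]; ring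
  calc ∫ r in c..d, (lin 1 (-1) z (z.avg h)).e r t
      ≤ ∫ r in c..d, ∫ θ in (0 : ℝ)..1, (z.incr (h * θ)).e r t :=
        intervalIntegral.integral_mono_on hcd
          ((lin 1 (-1) z (z.avg h)).cont_e.intervalIntegrable t hc hcd)
          (hcont.intervalIntegrable_integral_snd hc hcd 0 1)
          fun r hr => e_sub_avg_le hm1 z h (hc.trans_le hr.1) t
    _ = ∫ θ in (0 : ℝ)..1, ∫ r in c..d, (z.incr (h * θ)).e r t :=
        hcont.integral_swap hc hcd zero_le_one
    _ ≤ (1 - 0) * ε := hcont.integral₂_le zero_le_one hc hcd fun θ h0 h1 =>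
        hD _ (by positivity) ((mul_le_of_le_one_right hh.le h1).trans hhτ) c d hc hcd
    _ = ε := by ring

end RadialWave

lemma Profile.down_v_of_le {s l x : ℝ} (hl : 0 < l) (hx : x ≤ s) : (Profile.down s l).v x = 1 := by
  show 1 - ramp _ = 1
  rw [ramp_of_nonpos (div_nonpos_of_nonpos_of_nonneg (by linarith) hl.le), sub_zero]

lemma Profile.down_v_of_ge {s l x : ℝ} (hl : 0 < l) (hx : s + l ≤ x) :
    (Profile.down s l).v x = 0 := by
  show 1 - ramp _ = 0
  rw [ramp_of_one_le ((one_le_div hl).2 (by linarith)), sub_self]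

namespace RadialWave

variable {m : ℝ} {z : RadialWave m}

lemma flux_le (hm : Adm m) (hreg : z.Reg) {M : ℝ} (hM : z.Bdd M) {ψ : Profile}
    (hψ : ∀ x, ψ.d x ≤ 0) {t₀ t₁ : ℝ} (ht : t₀ ≤ t₁) {c d : ℝ} (hc : 0 < c) (hcd : c ≤ d) :
    ∫ τ in t₀..t₁, ∫ r in c..d, -ψ.d (τ - r) * (z.e r τ + z.p r τ) ≤ M := by
  have hm1 := hm.one_le
  have h := weighted_energy hm hreg hM hψ ht (K := M) ?_ hc hcd
  · have h0 : 0 ≤ ∫ r in c..d, ψ.v (t₁ - r) * z.e r t₁ :=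
      ContPos.integral_nonneg (F := fun r t => ψ.v (t - r) * z.e r t) t₁
        (fun r hr => mul_nonneg (ψ.nonneg _) (z.e_nonneg hm1 hr _)) hc hcd
    linarith
  · refine (hM t₀).mono_fun
      (((Profile.contPos_sub ψ.continuous).mul z.cont_e).continuousOn_fst t₀) (z.cont_e_fst t₀)
      fun r hr => mul_le_of_le_one_left (z.e_nonneg hm1 hr _) (ψ.le_one _)

lemma weighted_energy_le (hm : Adm m) (hreg : z.Reg) {M : ℝ} (hM : z.Bdd M) {ψ : Profile}
    (hψ : ∀ x, ψ.d x ≤ 0) {t₀ t₁ : ℝ} (ht : t₀ ≤ t₁) {K : ℝ}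
    (hK : IntLe (fun r => ψ.v (t₀ - r) * z.e r t₀) K) :
    IntLe (fun r => ψ.v (t₁ - r) * z.e r t₁) K := by
  intro c d hc hcd
  have h := weighted_energy hm hreg hM hψ ht hK hc hcd
  have h0 : 0 ≤ ∫ τ in t₀..t₁, ∫ r in c..d, -ψ.d (τ - r) * (z.e r τ + z.p r τ) :=
    ContPos.integral₂_nonneg (F := fun r τ => -ψ.d (τ - r) * (z.e r τ + z.p r τ)) ht hc hcd
      fun r τ hr _ _ => mul_nonneg (neg_nonneg.2 (hψ _)) (z.e_add_p_nonneg hm.one_le hr τ)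
  linarith

/-- Little energy far outside a light cone. -/
lemma exists_exterior_tail (hm : Adm m) (hreg : z.Reg) {M : ℝ} (hM : z.Bdd M) {ε : ℝ}
    (hε : 0 < ε) : ∃ s, ∀ t, 0 ≤ t → IntLe (fun r => (Profile.down s 1).v (t - r) * z.e r t) ε := by
  have hm1 := hm.one_le
  obtain ⟨c₀, d₀, hc₀, hcd₀, -, hd₀⟩ := (hM 0).exists_core (z.cont_e_fst 0)
    (fun r hr => z.e_nonneg hm1 hr 0) hε
  refine ⟨-d₀ - 1, fun t ht => weighted_energy_le hm hreg hM
    (Profile.down_d_nonpos _ zero_le_one) ht ?_⟩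
  refine intLe_of_vanish (z.cont_e_fst 0)
    (((Profile.contPos_sub (Profile.continuous _)).mul z.cont_e).continuousOn_fst 0)
    (hc₀.trans_le hcd₀) hε.le hd₀ (fun r _ hr' => ?_) fun r hr => ?_
  · rw [Profile.down_v_of_ge one_pos (by linarith), zero_mul]
  · exact mul_le_of_le_one_left (z.e_nonneg hm1 ((hc₀.trans_le hcd₀).trans_le hr) _)
      (Profile.le_one _ _)

lemma e_avg_le_flux (hm : 1 ≤ m) (y : RadialWave m) {h : ℝ} (hh : 0 < h) {r t A : ℝ} (hr : 0 < r)
    (hA : 1 ≤ A) (hrA : r ≤ A) :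
    (y.avg h).e r t ≤ (2 + 6 / h ^ 2) * A * (((y.avg h).e r t + (y.avg h).p r t)
      + ((y.e r t + y.p r t) + ((y.shift h).e r t + (y.shift h).p r t))) := by
  have hV := effPot_nonneg hm hr
  have hw : ∀ x : RadialWave m, x.w r t ^ 2 ≤ 2 * A * (x.e r t + x.p r t) := by
    intro x
    have h1 := x.pot_le_e_add_p r t
    have h2 : 1 / r * x.w r t ^ 2 ≤ effPot m r * x.w r t ^ 2 := by
      gcongr; exact inv_le_effPot hm hr
    have h3 : x.w r t ^ 2 ≤ r * (2 * (x.e r t + x.p r t)) := by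
      have := mul_le_mul_of_nonneg_left (h2.trans h1) hr.le
      have e1 : r * (1 / r * x.w r t ^ 2) = x.w r t ^ 2 := by field_simp
      linarith
    have := mul_le_mul_of_nonneg_right hrA
      (show 0 ≤ 2 * (x.e r t + x.p r t) by linarith [x.e_add_p_nonneg hm hr t])
    linarith
  have hY := hw y
  have hS := hw (y.shift h)
  have e0 : (y.shift h).w r t = y.w r (t + h) := rfl
  rw [e0] at hS
  have hb : (y.avg h).b r t ^ 2 ≤ 2 / h ^ 2 * (y.w r (t + h) ^ 2 + y.w r t ^ 2) := by
    rw [y.avg_b hh.ne' hr, div_pow, div_mul_eq_mul_div]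
    gcongr
    nlinarith [sq_nonneg (y.w r (t + h) + y.w r t)]
  have hb2 : 2 / h ^ 2 * (y.w r (t + h) ^ 2 + y.w r t ^ 2) ≤ 2 / h ^ 2 * (2 * A *
      ((y.e r t + y.p r t) + ((y.shift h).e r t + (y.shift h).p r t))) := by
    gcongr; linarith
  have he : (y.avg h).e r t ≤ 2 * ((y.avg h).e r t + (y.avg h).p r t)
      + 3 / 2 * (y.avg h).b r t ^ 2 := by
    have := mul_nonneg hV (sq_nonneg ((y.avg h).w r t))
    rw [e_add_p]
    unfold e
    nlinarith [sq_nonneg ((y.avg h).a r t + 2 * (y.avg h).b r t)]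
  have p1 := (y.avg h).e_add_p_nonneg hm hr t
  have p2 := y.e_add_p_nonneg hm hr t
  have p3 := (y.shift h).e_add_p_nonneg hm hr t
  set P := (y.avg h).e r t + (y.avg h).p r t
  set Q := (y.e r t + y.p r t) + ((y.shift h).e r t + (y.shift h).p r t)
  have hQ : 0 ≤ Q := by positivity
  have h6 : 0 ≤ 6 / h ^ 2 := by positivity
  have e2 : 3 / 2 * (2 / h ^ 2 * (2 * A * Q)) = 6 / h ^ 2 * A * Q := by ring
  have h7 : 2 * P ≤ 2 * A * P := by nlinarith
  have h8 : 0 ≤ 6 / h ^ 2 * A * P := by positivity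
  have h9 : 0 ≤ 2 * A * Q := by positivity
  nlinarith

/-- The energy in a strip along a light cone becomes small at some late time. -/
lemma exists_strip_small (hm : Adm m) {y : RadialWave m} (hreg : y.Reg) {M : ℝ} (hM : y.Bdd M)
    {h : ℝ} (hh : 0 < h) (s : ℝ) {l : ℝ} (hl : 0 < l) {ε : ℝ} (hε : 0 < ε) (T : ℝ) :
    ∃ t ≥ T, IntLe (fun r => -(Profile.down s l).d (t - r) * (y.avg h).e r t) ε := by
  have hm1 := hm.one_le
  by_contra! hcon
  set B := 2 + 6 / h ^ 2 with hB
  have hB0 : 0 < B := by positivity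
  set T₀ := max T (1 + |s| + l) with hT₀
  have hT : T ≤ T₀ := le_max_left _ _
  have hTl : 1 + |s| + l ≤ T₀ := le_max_right _ _
  have hs1 := neg_abs_le s
  have hs2 := le_abs_self s
  have hs3 := abs_nonneg s
  set T₁ := T₀ + (T₀ + |s|) * (Real.exp (3 * M * B / ε)) with hT₁
  have hE := Real.exp_pos (3 * M * B / ε)
  have hT01 : T₀ ≤ T₁ := by
    have : 0 ≤ (T₀ + |s|) * (Real.exp (3 * M * B / ε)) := by
      apply mul_nonneg _ hE.le; linarith
    linarith
  set g : ℝ → ℝ := fun x => -(Profile.down s l).d x with hg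
  have hgc : Continuous g := (Profile.cont _).neg
  have hg0 : ∀ x, 0 ≤ g x := fun x => neg_nonneg.2 (Profile.down_d_nonpos s hl.le x)
  set d := T₁ + |s| + 1 with hd
  have h1d : (1 : ℝ) ≤ d := by linarith
  have hgv : ∀ τ r, T₀ ≤ τ → τ ≤ T₁ → r ≤ 1 ∨ d ≤ r → g (τ - r) = 0 := by
    intro τ r h1 h2 h3
    have e : ∀ x, g x = (Profile.up s l).d x := fun x => neg_neg _
    rw [e]
    rcases h3 with h3 | h3
    · exact Profile.up_d_of_ge hl (by linarith)
    · exact Profile.up_d_of_le hl (by linarith)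
  set Q : ℝ → ℝ → ℝ := fun r t => ((y.avg h).e r t + (y.avg h).p r t)
      + ((y.e r t + y.p r t) + ((y.shift h).e r t + (y.shift h).p r t)) with hQ
  have cg : ContPos (fun r t => g (t - r)) := Profile.contPos_sub hgc
  have c1 : ContPos (fun r t => g (t - r) * ((y.avg h).e r t + (y.avg h).p r t)) :=
    cg.mul ((y.avg h).cont_e.add (y.avg h).cont_p)
  have c2 : ContPos (fun r t => g (t - r) * (y.e r t + y.p r t)) :=
    cg.mul (y.cont_e.add y.cont_p)
  have c3 : ContPos (fun r t => g (t - r) * ((y.shift h).e r t + (y.shift h).p r t)) :=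
    cg.mul ((y.shift h).cont_e.add (y.shift h).cont_p)
  have hflux : ∫ τ in T₀..T₁, ∫ r in (1 : ℝ)..d, g (τ - r) * Q r τ ≤ 3 * M := by
    have f1 := flux_le hm (y.reg_avg hh.ne') (hM.avg hm1 h) (ψ := .down s l)
      (Profile.down_d_nonpos s hl.le) hT01 one_pos h1d
    have f2 := flux_le hm hreg hM (ψ := .down s l)
      (Profile.down_d_nonpos s hl.le) hT01 one_pos h1d
    have f3 := flux_le hm (hreg.shift h) (hM.shift h) (ψ := .down s l)
      (Profile.down_d_nonpos s hl.le) hT01 one_pos h1d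
    have e1 := ContPos.integral₂_add c1 (c2.add c3) T₀ T₁ one_pos h1d
    have e2 := ContPos.integral₂_add c2 c3 T₀ T₁ one_pos h1d
    rw [e2] at e1
    have e3 : ∫ τ in T₀..T₁, ∫ r in (1 : ℝ)..d, g (τ - r) * Q r τ
        = ∫ τ in T₀..T₁, ∫ r in (1 : ℝ)..d, (g (τ - r) * ((y.avg h).e r τ + (y.avg h).p r τ)
          + (g (τ - r) * (y.e r τ + y.p r τ)
            + g (τ - r) * ((y.shift h).e r τ + (y.shift h).p r τ))) := by
      congr 1; ext τ; congr 1; ext r; simp only [hQ]; ring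
    rw [e3, e1]
    simp only [hg]
    linarith
  have cQ : ContPos (fun r t => g (t - r) * Q r t) :=
    cg.mul (((y.avg h).cont_e.add (y.avg h).cont_p).add
      ((y.cont_e.add y.cont_p).add ((y.shift h).cont_e.add (y.shift h).cont_p)))
  have hlow : ∀ τ ∈ Icc T₀ T₁, ε / B * (1 / (τ + |s|)) ≤ ∫ r in (1 : ℝ)..d, g (τ - r) * Q r τ := by
    rintro τ ⟨hτ0, hτ1⟩
    have cge : ContPos (fun r t => g (t - r) * (y.avg h).e r t) := cg.mul (y.avg h).cont_e
    have hbig : ε < ∫ r in (1 : ℝ)..d, g (τ - r) * (y.avg h).e r τ := by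
      by_contra! hle
      refine hcon τ (hT.trans hτ0) ?_
      have := intLe_of_pieces (cge.continuousOn_fst τ) (A := 0) (C := 0)
        (fun r hr => mul_nonneg (hg0 _) ((y.avg h).e_nonneg hm1 hr τ)) one_pos h1d
        (fun c hc hc1 => ?_) hle fun x hx => ?_
      · rw [zero_add, add_zero] at this; exact this
      · refine le_of_eq (intervalIntegral.integral_zero_ae (ae_of_all _ fun r hr => ?_))
        rw [uIoc_of_le hc1] at hr
        rw [hgv τ r hτ0 hτ1 (.inl hr.2), zero_mul]
      · refine le_of_eq (intervalIntegral.integral_zero_ae (ae_of_all _ fun r hr => ?_))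
        rw [uIoc_of_le hx] at hr
        rw [hgv τ r hτ0 hτ1 (.inr hr.1.le), zero_mul]
    have hle : ∫ r in (1 : ℝ)..d, g (τ - r) * (y.avg h).e r τ
        ≤ ∫ r in (1 : ℝ)..d, B * (τ + |s|) * (g (τ - r) * Q r τ) := by
      refine cge.integral_mono (cQ.const_mul (B * (τ + |s|))) τ one_pos h1d fun r hr _ => ?_
      have hr0 : 0 < r := by linarith
      rcases le_or_gt r (τ + |s|) with h1 | h1
      · have := mul_le_mul_of_nonneg_left
          (e_avg_le_flux (t := τ) hm1 y hh (A := τ + |s|) hr0 (by linarith) h1) (hg0 (τ - r))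
        simp only [hQ, hB]
        linarith
      · have e : g (τ - r) = (Profile.up s l).d (τ - r) := neg_neg _
        rw [e, Profile.up_d_of_le hl (by linarith)]
        simp
    rw [intervalIntegral.integral_const_mul] at hle
    have hpos : 0 < B * (τ + |s|) := mul_pos hB0 (by linarith)
    have : ε / B * (1 / (τ + |s|)) = ε / (B * (τ + |s|)) := by field_simp
    rw [this, div_le_iff₀ hpos]
    linarith
  have hlog : ∫ τ in T₀..T₁, ε / B * (1 / (τ + |s|))
      = ε / B * (Real.log (T₁ + |s|) - Real.log (T₀ + |s|)) := by
    rw [intervalIntegral.integral_const_mul]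
    congr 1
    refine intervalIntegral.integral_eq_sub_of_hasDerivAt
      (f := fun τ => Real.log (τ + |s|)) (fun τ hτ => ?_) ?_
    · rw [uIcc_of_le hT01] at hτ
      have h1 : τ + |s| ≠ 0 := by linarith [hτ.1]
      exact ((hasDerivAt_id τ).add_const _).log h1
    · apply ContinuousOn.intervalIntegrable
      rw [uIcc_of_le hT01]
      refine continuousOn_const.div (by fun_prop) fun τ hτ => ?_
      linarith [hτ.1]
  have hfint : ∫ τ in T₀..T₁, ε / B * (1 / (τ + |s|))
      ≤ ∫ τ in T₀..T₁, ∫ r in (1 : ℝ)..d, g (τ - r) * Q r τ := by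
    refine intervalIntegral.integral_mono_on hT01 ?_
      (cQ.intervalIntegrable_integral one_pos h1d _ _) hlow
    apply ContinuousOn.intervalIntegrable
    rw [uIcc_of_le hT01]
    refine continuousOn_const.mul (continuousOn_const.div (by fun_prop) fun τ hτ => ?_)
    linarith [hτ.1]
  have hTs : 0 < T₀ + |s| := by linarith
  have hgt : 3 * M * B / ε < Real.log (T₁ + |s|) - Real.log (T₀ + |s|) := by
    rw [← Real.log_div (by linarith) hTs.ne', Real.lt_log_iff_exp_lt (by positivity),
      lt_div_iff₀ hTs, hT₁]
    nlinarith
  have h2 := hlog ▸ hfint.trans hflux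
  have h3 : ε / B * (3 * M * B / ε) = 3 * M := by field_simp
  have h4 := mul_lt_mul_of_pos_left hgt (show 0 < ε / B by positivity)
  linarith

/-- For an averaged wave, the energy in `r ≥ t - η` tends to zero. -/
theorem exterior_avg (hm : Adm m) {y : RadialWave m} (hreg : y.Reg) {M : ℝ} (hM : y.Bdd M)
    {h : ℝ} (hh : 0 < h) (η : ℝ) {ε : ℝ} (hε : 0 < ε) :
    ∃ T, ∀ t, T ≤ t → ∀ c d, 0 < c → t - η ≤ c → c ≤ d → ∫ r in c..d, (y.avg h).e r t ≤ ε := by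
  have hm1 := hm.one_le
  have hregz := y.reg_avg hh.ne'
  have hMz := hM.avg hm1 h
  obtain ⟨s', hs'⟩ := exists_exterior_tail hm hregz hMz (half_pos hε)
  set l := |η + 1 - s'| + 1 with hl
  have hlη : η + 1 - s' ≤ l - 1 := by linarith [le_abs_self (η + 1 - s')]
  have hl0 : 0 < l := by positivity
  obtain ⟨t₀, ht₀, hstrip⟩ := exists_strip_small hm hreg hM hh (s' - l) (l := 3 * l)
    (by positivity) (ε := ε / 2 / (3 * l)) (by positivity) 0
  set z := y.avg h
  have hcomp : ∀ x, (Profile.down η 1).v x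
      ≤ (Profile.down s' 1).v x + 3 * l * -(Profile.down (s' - l) (3 * l)).d x := by
    intro x
    have e : -(Profile.down (s' - l) (3 * l)).d x = (Profile.up (s' - l) (3 * l)).d x := neg_neg _
    have h0 := Profile.up_d_nonneg (s' - l) (show 0 ≤ 3 * l by positivity) x
    have h1 := (Profile.down s' 1).nonneg x
    have h2 := (Profile.down η 1).le_one x
    rw [e]
    have h3 : 0 ≤ 3 * l * (Profile.up (s' - l) (3 * l)).d x := by positivity
    rcases le_total x s' with hx | hx
    · rw [Profile.down_v_of_le one_pos hx]; linarith
    rcases le_total x (η + 1) with hx' | hx'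
    · have h4 : 1 ≤ 3 * l * (Profile.up (s' - l) (3 * l)).d x := by
        show 1 ≤ 3 * l * (bump ((x - (s' - l)) / (3 * l)) / (3 * l))
        rw [mul_div_cancel₀ _ (by positivity)]
        refine le_bump ?_ ?_
        · rw [div_le_div_iff₀ (by norm_num) (by positivity)]; linarith
        · rw [div_le_div_iff₀ (by positivity) (by norm_num)]; linarith
      linarith
    · rw [Profile.down_v_of_ge one_pos hx']; linarith
  have hstart : IntLe (fun r => (Profile.down η 1).v (t₀ - r) * z.e r t₀) ε := by
    have cA : ContPos (fun r t => (Profile.down s' 1).v (t - r) * z.e r t) :=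
      (Profile.contPos_sub (Profile.continuous _)).mul z.cont_e
    have cB : ContPos (fun r t => 3 * l * (-(Profile.down (s' - l) (3 * l)).d (t - r) * z.e r t)) :=
      ((Profile.contPos_sub (Profile.cont _).neg).mul z.cont_e).const_mul _
    have := ((hs' t₀ ht₀).add (hstrip.const_mul (show 0 ≤ 3 * l by positivity))
      (cA.continuousOn_fst t₀) (cB.continuousOn_fst t₀)).mono_fun
      (((Profile.contPos_sub (Profile.down η 1).continuous).mul z.cont_e).continuousOn_fst t₀)
      ((cA.add cB).continuousOn_fst t₀) fun r hr => ?_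
    · refine this.mono (le_of_eq ?_)
      field_simp
      ring
    · have := mul_le_mul_of_nonneg_right (hcomp (t₀ - r)) (z.e_nonneg hm1 hr t₀)
      linarith
  refine ⟨t₀, fun t ht c d hc hηc hcd => ?_⟩
  have h1 := weighted_energy_le hm hregz hMz (Profile.down_d_nonpos η zero_le_one) ht hstart
    c d hc hcd
  refine le_trans (le_of_eq ?_) h1
  refine intervalIntegral.integral_congr fun r hr => ?_
  rw [uIcc_of_le hcd] at hr
  show z.e r t = (Profile.down η 1).v (t - r) * z.e r t
  rw [Profile.down_v_of_le one_pos (by linarith [hr.1]), one_mul]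

lemma e_avg_sub_avg (z : RadialWave m) (h k : ℝ) {r : ℝ} (hr : 0 < r) (t : ℝ) :
    (lin 1 (-1) (z.avg h) ((z.avg h).avg k)).e r t
      = ((lin 1 (-1) z (z.avg k)).avg h).e r t := by
  have key : ∀ f : ℝ → ℝ, Continuous f →
      1 * (∫ θ in (0 : ℝ)..1, f (t + h * θ))
        + -1 * (∫ θ' in (0 : ℝ)..1, ∫ θ in (0 : ℝ)..1, f (t + k * θ' + h * θ))
      = ∫ θ in (0 : ℝ)..1, (1 * f (t + h * θ) + -1 * ∫ θ' in (0 : ℝ)..1, f (t + h * θ + k * θ')) := by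
    intro f hf
    have hc : Continuous fun θ => ∫ θ' in (0 : ℝ)..1, f (t + h * θ + k * θ') :=
      intervalIntegral.continuous_parametric_intervalIntegral_of_continuous' (by fun_prop) 0 1
    rw [intervalIntegral.integral_add (Continuous.intervalIntegrable (by fun_prop) _ _)
      (Continuous.intervalIntegrable (by fun_prop) _ _), intervalIntegral.integral_const_mul,
      intervalIntegral.integral_const_mul, MeasureTheory.intervalIntegral_intervalIntegral_swap]
    · simp only [add_right_comm]
    · have : Continuous (Function.uncurry fun x y : ℝ => f (t + k * x + h * y)) := by fun_prop
      exact (this.continuousOn.integrableOn_compact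
        (isCompact_uIcc.prod isCompact_uIcc)).mono_set
        (prod_mono uIoc_subset_uIcc uIoc_subset_uIcc)
  have h1 := key _ (z.cont_w.continuous_snd hr)
  have h2 := key _ (z.cont_a.continuous_snd hr)
  have h3 := key _ (z.cont_b.continuous_snd hr)
  simp only [e, lin, avg]
  rw [h1, h2, h3]

end RadialWave

/-- A continuous function takes a value below its mean. -/
lemma exists_mul_le_integral {f : ℝ → ℝ} {p q : ℝ} (hpq : p ≤ q) (hf : ContinuousOn f (Icc p q)) :
    ∃ x ∈ Icc p q, (q - p) * f x ≤ ∫ y in p..q, f y := by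
  obtain ⟨x, hx, hmin⟩ := isCompact_Icc.exists_isMinOn (nonempty_Icc.2 hpq) hf
  refine ⟨x, hx, ?_⟩
  have hfint : IntervalIntegrable f volume p q := by
    apply ContinuousOn.intervalIntegrable
    rwa [uIcc_of_le hpq]
  have := intervalIntegral.integral_mono_on hpq
    (intervalIntegrable_const (μ := volume) (c := f x)) hfint fun y hy => hmin hy
  simpa using this

lemma ContPos.exists_bound {F : ℝ → ℝ → ℝ} (hF : ContPos F) (t : ℝ) {p q : ℝ} (hp : 0 < p) :
    ∃ G, ∀ r, p ≤ r → r ≤ q → |F r t| ≤ G := by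
  obtain ⟨G, hG⟩ := (isCompact_Icc (a := p) (b := q)).exists_bound_of_continuousOn
    ((hF.continuousOn_fst t).mono fun x hx => hp.trans_le hx.1)
  exact ⟨G, fun r h1 h2 => hG r ⟨h1, h2⟩⟩

lemma mul_le_add_sq_div {k x G κ : ℝ} (hκ : 0 < κ) (hk : |k| ≤ G) :
    k * x ≤ κ + G ^ 2 / (4 * κ) * x ^ 2 := by
  have hG : k ^ 2 ≤ G ^ 2 := by
    rw [← sq_abs k]; gcongr
  have h1 : k ^ 2 / (4 * κ) * x ^ 2 ≤ G ^ 2 / (4 * κ) * x ^ 2 := by gcongr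
  have h2 : k * x ≤ κ + k ^ 2 / (4 * κ) * x ^ 2 := by
    have : κ + k ^ 2 / (4 * κ) * x ^ 2 - k * x = (2 * κ - k * x) ^ 2 / (4 * κ) := by
      field_simp; ring
    have h3 : 0 ≤ (2 * κ - k * x) ^ 2 / (4 * κ) := by positivity
    linarith
  linarith

namespace RadialWave

variable {m : ℝ} {z : RadialWave m}

/-- The energy pairing of a wave at times `0` and `n`. -/
noncomputable def pair (z : RadialWave m) (n r : ℝ) : ℝ :=
  z.a r 0 * z.a r n + z.b r 0 * z.b r n + effPot m r * z.w r 0 * z.w r n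

lemma contPos_pair (z : RadialWave m) (n : ℝ) : ContPos (fun r _ => z.pair n r) := by
  refine ContPos.of_fst ?_
  have w0 := z.cont_w.continuousOn_fst 0
  have a0 := z.cont_a.continuousOn_fst 0
  have b0 := z.cont_b.continuousOn_fst 0
  have w1 := z.cont_w.continuousOn_fst n
  have a1 := z.cont_a.continuousOn_fst n
  have b1 := z.cont_b.continuousOn_fst n
  have V := (contPos_effPot m).continuousOn_fst 0
  exact ((a0.mul a1).add (b0.mul b1)).add ((V.mul w0).mul w1)

lemma pair_le (hm : 1 ≤ m) (z : RadialWave m) (n : ℝ) {r : ℝ} (hr : 0 < r) :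
    z.pair n r ≤ 8 * z.e r 0 + 1 / 8 * z.e r n := by
  have hV := effPot_nonneg hm hr
  have h1 := mul_nonneg hV (sq_nonneg (8 * z.w r 0 - z.w r n))
  unfold pair e
  nlinarith [sq_nonneg (8 * z.a r 0 - z.a r n), sq_nonneg (8 * z.b r 0 - z.b r n)]

lemma e_half_shift (z : RadialWave m) (n r : ℝ) :
    (lin (1 / 2) (1 / 2) z (z.shift n)).e r 0
      = 1 / 4 * z.e r 0 + 1 / 4 * z.e r n + 1 / 4 * z.pair n r := by
  simp only [e, lin, shift, pair, zero_add]
  ring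

/-- Weak convergence to zero: the pairing over a fixed compact interval becomes small, after
a suitable choice of end points. -/
lemma exists_pair_small (hm : Adm m) (hreg : z.Reg) {M : ℝ} (hM : z.Bdd M) {c₀ d₀ : ℝ}
    (hc₀ : 0 < c₀) (hcd₀ : c₀ ≤ d₀) {ε : ℝ} (hε : 0 < ε) :
    ∃ n > 0, ∃ c d, 0 < c ∧ c ≤ c₀ ∧ d₀ ≤ d ∧ ∫ r in c..d, z.pair n r ≤ ε := by
  have hm1 := hm.one_le
  set p := c₀ / 2 with hp
  set q := d₀ + 1 with hq
  have hp0 : 0 < p := by positivity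
  have hpq : p ≤ q := by linarith
  have hq0 : 0 < q := hp0.trans_le hpq
  obtain ⟨G₁, hG₁⟩ := (z.cont_a.sub z.cont_b).exists_bound 0 (q := q) hp0
  obtain ⟨G₂, hG₂⟩ := (((contPos_effPot m).mul z.cont_w).sub (z.cont_ar.sub z.cont_c)).exists_bound 0
    (q := q) hp0
  obtain ⟨G₃, hG₃⟩ := z.cont_b.exists_bound 0 (q := q) hp0
  set G := max G₁ (max G₂ G₃)
  have hG1 : G₁ ≤ G := le_max_left _ _
  have hG2 : G₂ ≤ G := (le_max_left _ _).trans (le_max_right _ _)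
  have hG3 : G₃ ≤ G := (le_max_right _ _).trans (le_max_right _ _)
  set κ := ε / (2 * (2 + 2 * (q - p))) with hκ
  have hqp : 0 ≤ q - p := by linarith
  have hκ0 : 0 < κ := by positivity
  set H := G ^ 2 / (4 * κ) with hH
  have hH0 : 0 ≤ H := by positivity
  set D := H * (2 * q * (1 + 1 / p) + 2 * q + 2) with hD
  have hD0 : 0 ≤ D := by positivity
  set ν := ε / (2 * (D + 1)) with hν
  have hν0 : 0 < ν := by positivity
  obtain ⟨T, hT, hin⟩ := inward_decay hm hreg hM hν0
  set n := T + 1 with hn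
  have hin := hin n (by linarith)
  have hw2 : ∀ x y, p ≤ x → x ≤ y → y ≤ q → ∫ r in x..y, z.w r n ^ 2 ≤ 2 * q * ν := by
    intro x y hx hxy hy
    have hx0 := hp0.trans_le hx
    have h1 := hin x y hx0 hxy
    have h2 : ∫ r in x..y, z.w r n ^ 2 ≤ ∫ r in x..y, 2 * q * (z.e r n + z.p r n) := by
      refine (z.cont_w.pow 2).integral_mono ((z.cont_e.add z.cont_p).const_mul (2 * q)) n hx0 hxy
        fun r h3 h4 => ?_
      have hr0 := hx0.trans_le h3
      have h5 := z.pot_le_e_add_p r n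
      have h6 : 1 / r * z.w r n ^ 2 ≤ effPot m r * z.w r n ^ 2 := by
        gcongr; exact inv_le_effPot hm1 hr0
      have h7 := mul_le_mul_of_nonneg_left (h6.trans h5) hr0.le
      have e1 : r * (1 / r * z.w r n ^ 2) = z.w r n ^ 2 := by field_simp
      have h8 := mul_le_mul_of_nonneg_right (h4.trans hy)
        (show 0 ≤ 2 * (z.e r n + z.p r n) by linarith [z.e_add_p_nonneg hm1 hr0 n])
      linarith
    rw [intervalIntegral.integral_const_mul] at h2
    have := mul_le_mul_of_nonneg_left h1 (show 0 ≤ 2 * q by positivity)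
    linarith
  have hcw := (z.cont_w.pow 2).continuousOn_fst n
  obtain ⟨c, ⟨hc1, hc2⟩, hcm⟩ := exists_mul_le_integral (f := fun r => z.w r n ^ 2) (p := p)
    (q := c₀) (by linarith) (hcw.mono fun x hx => hp0.trans_le hx.1)
  obtain ⟨d, ⟨hd1, hd2⟩, hdm⟩ := exists_mul_le_integral (f := fun r => z.w r n ^ 2) (p := d₀)
    (q := q) (by linarith) (hcw.mono fun x hx => (hc₀.trans_le hcd₀).trans_le hx.1)
  have hwc : z.w c n ^ 2 ≤ 1 / p * (2 * q * ν) := by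
    have h1 := hcm.trans (hw2 p c₀ le_rfl (by linarith) (by linarith))
    have e1 : c₀ - p = p := by rw [hp]; ring
    rw [e1] at h1
    rw [one_div_mul_eq_div, le_div_iff₀ hp0]
    linarith
  have hwd : z.w d n ^ 2 ≤ 2 * q * ν := by
    have h1 := hdm.trans (hw2 d₀ q (by linarith) (by linarith) le_rfl)
    have e1 : q - d₀ = 1 := by rw [hq]; ring
    rwa [e1, one_mul] at h1
  have hc0 : 0 < c := hp0.trans_le hc1
  have hcd : c ≤ d := hc2.trans (hcd₀.trans hd1)
  refine ⟨n, by positivity, c, d, hc0, hc2, hd1, ?_⟩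
  have hbp : ∫ r in c..d, ((z.ar r 0 - z.c r 0) * z.w r n + (z.a r 0 - z.b r 0) * z.a r n)
      = (z.a d 0 - z.b d 0) * z.w d n - (z.a c 0 - z.b c 0) * z.w c n := by
    refine intervalIntegral.integral_eq_sub_of_hasDerivAt
      (f := fun r => (z.a r 0 - z.b r 0) * z.w r n) (fun r hr => ?_) ?_
    · rw [uIcc_of_le hcd] at hr
      have hr0 := hc0.trans_le hr.1
      exact ((z.a_r r 0 hr0).sub (z.b_r r 0 hr0)).mul (z.w_r r n hr0)
    · refine intervalIntegrable_of_pos ?_ hc0 hcd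
      exact (((z.cont_ar.sub z.cont_c).continuousOn_fst 0).mul (z.cont_w.continuousOn_fst n)).add
        (((z.cont_a.sub z.cont_b).continuousOn_fst 0).mul (z.cont_a.continuousOn_fst n))
  have cst : ContPos fun r (_ : ℝ) =>
      (z.ar r 0 - z.c r 0) * z.w r n + (z.a r 0 - z.b r 0) * z.a r n := ContPos.of_fst <|
    (((z.cont_ar.sub z.cont_c).continuousOn_fst 0).mul (z.cont_w.continuousOn_fst n)).add
        (((z.cont_a.sub z.cont_b).continuousOn_fst 0).mul (z.cont_a.continuousOn_fst n))
  have c1 : ContPos fun r (_ : ℝ) => H * z.w r n ^ 2 :=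
    ContPos.of_fst (((z.cont_w.pow 2).const_mul H).continuousOn_fst n)
  have c2 : ContPos fun r (_ : ℝ) => 2 * H * (z.e r n + z.p r n) :=
    ContPos.of_fst (((z.cont_e.add z.cont_p).const_mul (2 * H)).continuousOn_fst n)
  have hpair : ∫ r in c..d, z.pair n r ≤ ∫ r in c..d, (((z.ar r 0 - z.c r 0) * z.w r n
      + (z.a r 0 - z.b r 0) * z.a r n) + (2 * κ + (H * z.w r n ^ 2
      + 2 * H * (z.e r n + z.p r n)))) := by
    refine (z.contPos_pair n).integral_mono (cst.add ((ContPos.const (2 * κ)).add (c1.add c2))) 0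
      hc0 hcd fun r h1 h2 => ?_
    have hr0 := hc0.trans_le h1
    have k1 := mul_le_add_sq_div (x := z.w r n) hκ0
      ((hG₂ r (hc1.trans h1) (h2.trans hd2)).trans hG2)
    have k2 := mul_le_add_sq_div (x := z.a r n + z.b r n) hκ0
      ((hG₃ r (hc1.trans h1) (h2.trans hd2)).trans hG3)
    have k3 : (z.a r n + z.b r n) ^ 2 ≤ 2 * (z.e r n + z.p r n) := by
      have := mul_nonneg (effPot_nonneg hm1 hr0) (sq_nonneg (z.w r n))
      rw [e_add_p]; linarith
    have k4 := mul_le_mul_of_nonneg_left k3 hH0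
    rw [← hH] at k1 k2
    unfold pair
    linarith
  rw [ContPos.integral_add' cst ((ContPos.const (2 * κ)).add (c1.add c2)) 0 hc0 hcd,
    ContPos.integral_add' (ContPos.const (2 * κ)) (c1.add c2) 0 hc0 hcd,
    ContPos.integral_add' c1 c2 0 hc0 hcd, hbp] at hpair
  simp only [intervalIntegral.integral_const_mul, intervalIntegral.integral_const,
    smul_eq_mul] at hpair
  have b1 := mul_le_add_sq_div (x := z.w d n) hκ0 ((hG₁ d (hc1.trans hcd) hd2).trans hG1)
  have b2 := mul_le_add_sq_div (x := -z.w c n) hκ0 ((hG₁ c hc1 (hcd.trans hd2)).trans hG1)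
  rw [← hH] at b1 b2
  rw [neg_sq] at b2
  have b3 := mul_le_mul_of_nonneg_left hwd hH0
  have b4 := mul_le_mul_of_nonneg_left hwc hH0
  have b5 := mul_le_mul_of_nonneg_left (hw2 c d hc1 hcd hd2) hH0
  have b6 := mul_le_mul_of_nonneg_left (hin c d hc0 hcd) (show 0 ≤ 2 * H by positivity)
  beta_reduce at b6
  have b7 : (d - c) * (2 * κ) ≤ (q - p) * (2 * κ) := by gcongr
  have e1 : (2 + 2 * (q - p)) * κ = ε / 2 := by rw [hκ]; field_simp
  have e2 : D * ν ≤ ε / 2 := by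
    have : (D + 1) * ν = ε / 2 := by rw [hν]; field_simp
    linarith
  have e3 : D * ν = H * (2 * q * ν) + H * (1 / p * (2 * q * ν)) + H * (2 * q * ν) + 2 * H * ν := by
    rw [hD]; ring
  linarith

/-- Averaging a wave with a late translate reduces the energy. -/
lemma exists_half_shift (hm : Adm m) (hreg : z.Reg) {M : ℝ} (hM : z.Bdd M) {θ : ℝ} (hθ : 0 < θ)
    (hz : ∀ t, 0 ≤ t → IntLe (fun r => z.e r t) θ) : ∃ n > 0, ∀ t, 0 ≤ t →
      IntLe (fun r => (lin (1 / 2) (1 / 2) z (z.shift n)).e r t) (3 / 4 * θ) := by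
  have hm1 := hm.one_le
  obtain ⟨c₀, d₀, hc₀, hcd₀, hlo, hhi⟩ := (hM 0).exists_core (z.cont_e_fst 0)
    (fun r hr => z.e_nonneg hm1 hr 0) (ε := θ / 64) (by positivity)
  obtain ⟨n, hn, c₁, d₁, hc₁, hcc₁, hdd₁, hpair⟩ := exists_pair_small hm hreg hM hc₀ hcd₀
    (half_pos hθ)
  refine ⟨n, hn, fun t ht => ?_⟩
  set z' := lin (1 / 2) (1 / 2) z (z.shift n)
  refine energy_le hm (hreg.lin _ _ (hreg.shift n)) (Bdd.lin hm1 _ _ hM (hM.shift n)) ht ?_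
  intro c d hc hcd
  have hcm : 0 < min c c₁ := lt_min hc hc₁
  have hd₁ : 0 < d₁ := hc₀.trans_le (hcd₀.trans hdd₁)
  have hcd₁ : c₁ ≤ d₁ := hcc₁.trans (hcd₀.trans hdd₁)
  have h1 := integral_le_of_subinterval (z'.cont_e_fst 0) (fun r hr => z'.e_nonneg hm1 hr 0)
    hcm (min_le_left c c₁) hcd (le_max_left d d₁)
  set x := min c c₁
  set y := max d d₁
  have hx : x ≤ c₁ := min_le_right _ _
  have hy : d₁ ≤ y := le_max_right _ _
  have hxy : x ≤ y := hx.trans (hcd₁.trans hy)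
  have cp := z.contPos_pair n
  have cn : ContPos fun r (_ : ℝ) => z.e r n := ContPos.of_fst (z.cont_e_fst n)
  have e1 : ∫ r in x..y, z'.e r 0 = 1 / 4 * (∫ r in x..y, z.e r 0) + 1 / 4 * (∫ r in x..y, z.e r n)
      + 1 / 4 * ∫ r in x..y, z.pair n r := by
    simp only [z', e_half_shift]
    rw [ContPos.integral_add' (F := fun r t => 1 / 4 * z.e r t + 1 / 4 * z.e r n)
      (G := fun r _ => 1 / 4 * z.pair n r) ((z.cont_e.const_mul _).add (cn.const_mul _))
      (cp.const_mul _) 0 hcm hxy, ContPos.integral_add' (F := fun r t => 1 / 4 * z.e r t)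
      (G := fun r _ => 1 / 4 * z.e r n) (z.cont_e.const_mul _) (cn.const_mul _) 0 hcm hxy]
    simp only [intervalIntegral.integral_const_mul]
  have htail : ∀ u v, 0 < u → u ≤ v → (∫ r in u..v, z.e r 0) ≤ θ / 64 →
      ∫ r in u..v, z.pair n r ≤ θ / 4 := by
    intro u v hu huv h
    have h2 : ∫ r in u..v, z.pair n r ≤ ∫ r in u..v, (8 * z.e r 0 + 1 / 8 * z.e r n) :=
      cp.integral_mono (G := fun r t => 8 * z.e r t + 1 / 8 * z.e r n)
        ((z.cont_e.const_mul _).add (cn.const_mul _)) 0 hu huv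
        fun r hr _ => z.pair_le hm1 n (hu.trans_le hr)
    rw [ContPos.integral_add' (F := fun r t => 8 * z.e r t)
      (G := fun r _ => 1 / 8 * z.e r n) (z.cont_e.const_mul _) (cn.const_mul _) 0 hu huv,
      intervalIntegral.integral_const_mul, intervalIntegral.integral_const_mul] at h2
    have := hz n hn.le u v hu huv
    linarith
  have i : ∀ u v, 0 < u → u ≤ v → IntervalIntegrable (z.pair n) volume u v :=
    fun u v hu huv => cp.intervalIntegrable 0 hu huv
  have s1 := intervalIntegral.integral_add_adjacent_intervals (i x c₁ hcm hx) (i c₁ d₁ hc₁ hcd₁)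
  have s2 := intervalIntegral.integral_add_adjacent_intervals
    ((i x c₁ hcm hx).trans (i c₁ d₁ hc₁ hcd₁)) (i d₁ y hd₁ hy)
  have t1 := htail x c₁ hcm hx (hlo x c₁ hcm hx hcc₁)
  have t2 := htail d₁ y hd₁ hy (hhi d₁ y hdd₁ hy)
  have t3 := hz 0 le_rfl x y hcm hxy
  have t4 := hz n hn.le x y hcm hxy
  have h2 : ∫ r in c..d, z'.e r 0 ≤ ∫ r in x..y, z'.e r 0 := h1
  linarith

lemma intLe_sub_shift_sq (hm : 1 ≤ m) {M : ℝ} (hM : z.Bdd M) {n : ℝ} (hn : 0 < n) (t : ℝ) :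
    IntLe (fun r => (z.w r (t + n) - z.w r t) ^ 2) (2 * n ^ 2 * M) := by
  have h1 : IntLe (fun r => 2 * n ^ 2 * (z.avg n).e r t) (2 * n ^ 2 * M) :=
    (hM.avg hm n t).const_mul (by positivity)
  refine h1.mono_fun ?_ (((z.avg n).cont_e.const_mul _).continuousOn_fst t) fun r hr => ?_
  · exact ((z.cont_w.continuousOn_fst (t + n)).sub (z.cont_w.continuousOn_fst t)).pow 2
  · have hb := z.avg_b hn.ne' hr t
    have h2 : z.w r (t + n) - z.w r t = n * (z.avg n).b r t := by
      rw [hb]; field_simp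
    rw [h2]
    have h3 : (z.avg n).b r t ^ 2 ≤ 2 * (z.avg n).e r t := by
      have := mul_nonneg (effPot_nonneg hm hr) (sq_nonneg ((z.avg n).w r t))
      unfold e
      nlinarith [sq_nonneg ((z.avg n).a r t)]
    have := mul_le_mul_of_nonneg_left h3 (sq_nonneg n)
    linarith

/-- Every regular wave is, up to small energy, a wave with bounded `L²` norm. -/
lemma exists_small_modification (hm : Adm m) {y : RadialWave m} (hreg : y.Reg) {M : ℝ}
    (hM : y.Bdd M) (k : ℕ) : ∃ z : RadialWave m, z.Reg ∧ (∃ M', z.Bdd M') ∧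
      (∀ t, 0 ≤ t → IntLe (fun r => z.e r t) ((3 / 4) ^ k * (M + 1))) ∧
      ∃ L, ∀ t, 0 ≤ t → IntLe (fun r => (lin 1 (-1) y z).w r t ^ 2) L := by
  have hm1 := hm.one_le
  have hM0 : 0 ≤ M := (hM 0).nonneg
  induction k with
  | zero =>
    refine ⟨y, hreg, ⟨M, hM⟩, fun t _ => (hM t).mono (by simp), 0, fun t _ c d hc hcd => ?_⟩
    simp [lin]
  | succ k ih =>
    obtain ⟨z, hz, ⟨M', hM'⟩, hsmall, L, hL⟩ := ih
    obtain ⟨n, hn, hn'⟩ := exists_half_shift hm hz hM' (by positivity) hsmall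
    refine ⟨lin (1 / 2) (1 / 2) z (z.shift n), hz.lin _ _ (hz.shift n),
      ⟨_, Bdd.lin hm1 _ _ hM' (hM'.shift n)⟩, fun t ht => (hn' t ht).mono (by rw [pow_succ]; linarith),
      2 * L + 1 / 2 * (2 * n ^ 2 * M'), fun t ht => ?_⟩
    have c1 : ContinuousOn (fun r => 2 * (lin 1 (-1) y z).w r t ^ 2) (Ioi 0) :=
      (((lin 1 (-1) y z).cont_w.pow 2).const_mul 2).continuousOn_fst t
    have c2 : ContinuousOn (fun r => 1 / 2 * (z.w r (t + n) - z.w r t) ^ 2) (Ioi 0) :=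
      continuousOn_const.mul
        (((z.cont_w.continuousOn_fst (t + n)).sub (z.cont_w.continuousOn_fst t)).pow 2)
    refine (((hL t ht).const_mul zero_le_two).add ((intLe_sub_shift_sq hm1 hM' hn t).const_mul
      (by norm_num)) c1 c2).mono_fun
      (((lin 1 (-1) y _).cont_w.pow 2).continuousOn_fst t) (c1.add c2) fun r hr => ?_
    simp only [lin, shift]
    nlinarith [sq_nonneg ((y.w r t - z.w r t) + 1 / 2 * (z.w r (t + n) - z.w r t))]

/-- The energy of a wave is controlled by the energies of an approximation and of the error. -/
lemma integral_e_le (hm : 1 ≤ m) (y z : RadialWave m) (t : ℝ) {c d : ℝ} (hc : 0 < c)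
    (hcd : c ≤ d) : ∫ r in c..d, y.e r t
      ≤ 2 * (∫ r in c..d, (lin 1 (-1) y z).e r t) + 2 * ∫ r in c..d, z.e r t := by
  have h4 : ∫ r in c..d, y.e r t
      ≤ ∫ r in c..d, (2 * (lin 1 (-1) y z).e r t + 2 * z.e r t) := by
    refine y.cont_e.integral_mono (((lin 1 (-1) y z).cont_e.const_mul 2).add
      (z.cont_e.const_mul 2)) t hc hcd fun r hr _ => ?_
    have := e_lin_le hm 1 1 (lin 1 (-1) y z) z (hc.trans_le hr) t
    have e1 : (lin 1 1 (lin 1 (-1) y z) z).e r t = y.e r t := by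
      simp only [e, lin]; ring
    rw [e1] at this
    linarith
  rwa [ContPos.integral_add' (F := fun r t => 2 * (lin 1 (-1) y z).e r t)
    (G := fun r t => 2 * z.e r t) ((lin 1 (-1) y z).cont_e.const_mul 2) (z.cont_e.const_mul 2) t
    hc hcd, intervalIntegral.integral_const_mul, intervalIntegral.integral_const_mul] at h4

/-- The energy in the interior of the light cone decays for every regular wave. -/
theorem interior_decay_reg (hm : Adm m) {y : RadialWave m} (hreg : y.Reg) {M : ℝ} (hM : y.Bdd M)
    {ℓ : ℝ → ℝ} (hℓ : Tendsto (fun t => ℓ t / Real.log t) atTop atTop) {ε : ℝ} (hε : 0 < ε) :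
    ∀ᶠ t in atTop, ∀ c d, 0 < c → c ≤ d → d ≤ t - ℓ t → ∫ r in c..d, y.e r t ≤ ε := by
  have hm1 := hm.one_le
  have hM0 : 0 ≤ M := (hM 0).nonneg
  obtain ⟨k, hk⟩ := exists_pow_lt_of_lt_one (show 0 < ε / 4 / (M + 1) by positivity)
    (show (3 / 4 : ℝ) < 1 by norm_num)
  rw [lt_div_iff₀ (by positivity)] at hk
  obtain ⟨z, hz, ⟨M', hM'⟩, hsmall, L, hL⟩ := exists_small_modification hm hreg hM k
  have h1 := interior_decay hm (hreg.lin 1 (-1) hz) (Bdd.lin hm1 1 (-1) hM hM') hL hℓ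
    (show 0 < ε / 4 by positivity)
  filter_upwards [h1, eventually_ge_atTop 0] with t ht ht0 c d hc hcd hd
  have h2 := ht c d hc hcd hd
  have h3 := hsmall t ht0 c d hc hcd
  have h4 := integral_e_le hm1 y z t hc hcd
  linarith

end RadialWave

namespace RadialWave
variable {m : ℝ}

/-- Finite-energy waves lose their energy in the interior of the light cone. -/
theorem FiniteEnergy.interior (hm : Adm m) {z : RadialWave m} {E' : ℝ} (hF : z.FiniteEnergy E')
    {ℓ : ℝ → ℝ} (hℓ : Tendsto (fun t => ℓ t / Real.log t) atTop atTop) {ε : ℝ} (hε : 0 < ε) :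
    ∀ᶠ t in atTop, ∀ c d, 0 < c → c ≤ d → d ≤ t - ℓ t → ∫ r in c..d, z.eu r t ≤ ε := by
  have hm1 := hm.one_le
  set κ := ε / (2 + 8 * m ^ 2) / 4 with hκ
  have hκ0 : 0 < κ := by positivity
  obtain ⟨h, hh, hsub⟩ := hF.sub_avg hm hκ0
  have hM := hF.bdd hm1
  filter_upwards [interior_decay_reg hm (z.reg_avg hh.ne') (hM.avg hm1 h) hℓ hκ0,
    eventually_ge_atTop 0] with t ht ht0 c d hc hcd hd
  have key := hardy_inside hm1 z (t := t) (R := t - ℓ t) (K := 4 * κ) (fun c d hc hcd hd => by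
    have h1 := integral_e_le hm1 z (z.avg h) t hc hcd
    have h2 := hsub h hh le_rfl t ht0 c d hc hcd
    have h3 := ht c d hc hcd hd
    linarith) hc hcd hd
  have e1 : (2 + 8 * m ^ 2) * (4 * κ) = ε := by rw [hκ]; field_simp
  rwa [e1] at key

/-- Finite-energy waves lose their energy in the exterior of the light cone. -/
theorem FiniteEnergy.exterior (hm : Adm m) {z : RadialWave m} {E' : ℝ} (hF : z.FiniteEnergy E')
    (η : ℝ) {ε : ℝ} (hε : 0 < ε) :
    ∀ᶠ t in atTop, ∀ c d, 0 < c → t - η ≤ c → c ≤ d → ∫ r in c..d, z.eu r t ≤ ε := by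
  have hm1 := hm.one_le
  set κ := ε / (2 + 2 * m ^ 2) / 10 with hκ
  have hκ0 : 0 < κ := by positivity
  obtain ⟨h, hh, hsub⟩ := hF.sub_avg hm hκ0
  have hM := hF.bdd hm1
  obtain ⟨T, hT⟩ := exterior_avg hm (z.reg_avg hh.ne') (hM.avg hm1 h) hh η hκ0
  filter_upwards [eventually_ge_atTop 0, eventually_ge_atTop T, eventually_ge_atTop (1 + η)]
    with t ht0 htT htη c d hc htc hcd
  have h1 := integral_e_le hm1 z (z.avg h) t hc hcd
  have h2 := hsub h hh le_rfl t ht0 c d hc hcd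
  have h3 := integral_e_le hm1 (z.avg h) ((z.avg h).avg h) t hc hcd
  have h4 : ∫ r in c..d, (lin 1 (-1) (z.avg h) ((z.avg h).avg h)).e r t ≤ κ := by
    have h6 : IntLe (fun r => ((lin 1 (-1) z (z.avg h)).avg h).e r t) κ :=
      intLe_e_avg hm1 fun θ hθ _ => hsub h hh le_rfl _ (by positivity)
    refine le_trans (le_of_eq (intervalIntegral.integral_congr fun r hr => ?_)) (h6 c d hc hcd)
    rw [uIcc_of_le hcd] at hr
    exact e_avg_sub_avg z h h (hc.trans_le hr.1) t
  have h5 := hT t htT c d hc htc hcd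
  have h6 : ∫ r in c..d, z.eu r t ≤ ∫ r in c..d, (2 + 2 * m ^ 2) * z.e r t :=
    z.cont_eu.integral_mono (z.cont_e.const_mul _) t hc hcd fun r hr _ =>
      eu_le_of_one_le hm1 z (by linarith) t
  rw [intervalIntegral.integral_const_mul] at h6
  have h7 : (2 + 2 * m ^ 2) * (∫ r in c..d, z.e r t) ≤ (2 + 2 * m ^ 2) * (10 * κ) := by
    gcongr
    beta_reduce at h2
    linarith
  have e1 : (2 + 2 * m ^ 2) * (10 * κ) = ε := by rw [hκ]; field_simp
  linarith

end RadialWave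

lemma HasFDerivAt.hasDerivAt_fst {F : ℝ × ℝ → ℝ} {F' : ℝ × ℝ →L[ℝ] ℝ} {r t : ℝ}
    (h : HasFDerivAt F F' (r, t)) : HasDerivAt (fun x => F (x, t)) (F' (1, 0)) r := by
  exact h.comp_hasDerivAt (f := fun x => (x, t)) r
    ((hasDerivAt_id r).prodMk (hasDerivAt_const r t))

lemma HasFDerivAt.hasDerivAt_snd {F : ℝ × ℝ → ℝ} {F' : ℝ × ℝ →L[ℝ] ℝ} {r t : ℝ}
    (h : HasFDerivAt F F' (r, t)) : HasDerivAt (fun x => F (r, x)) (F' (0, 1)) t := by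
  exact h.comp_hasDerivAt (f := fun x => (r, x)) t
    ((hasDerivAt_const t r).prodMk (hasDerivAt_id t))

/-- A function of class `C²` on a half-plane together with its partial derivatives. -/
structure HalfPlaneC2 (G : ℝ → ℝ → ℝ) where
  Gr : ℝ → ℝ → ℝ
  Gt : ℝ → ℝ → ℝ
  Grr : ℝ → ℝ → ℝ
  Grt : ℝ → ℝ → ℝ
  Gtt : ℝ → ℝ → ℝ
  G_r : ∀ r t, 0 < r → HasDerivAt (fun x => G x t) (Gr r t) r
  G_t : ∀ r t, 0 < r → HasDerivAt (G r) (Gt r t) t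
  Gr_r : ∀ r t, 0 < r → HasDerivAt (fun x => Gr x t) (Grr r t) r
  Gr_t : ∀ r t, 0 < r → HasDerivAt (Gr r) (Grt r t) t
  Gt_r : ∀ r t, 0 < r → HasDerivAt (fun x => Gt x t) (Grt r t) r
  Gt_t : ∀ r t, 0 < r → HasDerivAt (Gt r) (Gtt r t) t
  cont : ContPos G
  cont_r : ContPos Gr
  cont_t : ContPos Gt
  cont_rr : ContPos Grr
  cont_rt : ContPos Grt

lemma HalfPlaneC2.exists_of_contDiffOn {G : ℝ → ℝ → ℝ}
    (hG : ContDiffOn ℝ 2 (fun q : ℝ × ℝ => G q.1 q.2) (Ioi 0 ×ˢ univ)) :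
    Nonempty (HalfPlaneC2 G) := by
  set S : Set (ℝ × ℝ) := Ioi 0 ×ˢ univ with hS
  have hSo : IsOpen S := isOpen_Ioi.prod isOpen_univ
  set F : ℝ × ℝ → ℝ := fun q => G q.1 q.2 with hF
  have hD : ContDiffOn ℝ 1 (fderiv ℝ F) S := hG.fderiv_of_isOpen hSo (by norm_num)
  have hD2 : ContDiffOn ℝ 0 (fderiv ℝ (fderiv ℝ F)) S := hD.fderiv_of_isOpen hSo (by norm_num)
  have mem : ∀ r t, 0 < r → S ∈ 𝓝 (r, t) := fun r t hr => hSo.mem_nhds ⟨hr, trivial⟩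
  have d1 : ∀ r t, 0 < r → HasFDerivAt F (fderiv ℝ F (r, t)) (r, t) := fun r t hr =>
    ((hG.contDiffAt (mem r t hr)).differentiableAt (by norm_num)).hasFDerivAt
  have d2 : ∀ (v : ℝ × ℝ) r t, 0 < r → HasFDerivAt (fun q => fderiv ℝ F q v)
      ((fderiv ℝ (fderiv ℝ F) (r, t)).flip v) (r, t) := fun v r t hr =>
    (((hD.contDiffAt (mem r t hr)).differentiableAt (by norm_num)).hasFDerivAt.clm_apply
      (hasFDerivAt_const v _)).congr_fderiv (by simp)
  have symm : ∀ r t, 0 < r → ∀ v w, fderiv ℝ (fderiv ℝ F) (r, t) v w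
      = fderiv ℝ (fderiv ℝ F) (r, t) w v := fun r t hr v w =>
    ((hG.contDiffAt (mem r t hr)).isSymmSndFDerivAt (by simp)).eq v w
  have c1 : ∀ v : ℝ × ℝ, ContPos fun r t => fderiv ℝ F (r, t) v := fun v =>
    hD.continuousOn.clm_apply continuousOn_const
  have c2 : ∀ v w : ℝ × ℝ, ContPos fun r t => fderiv ℝ (fderiv ℝ F) (r, t) v w := fun v w =>
    (hD2.continuousOn.clm_apply continuousOn_const).clm_apply continuousOn_const
  exact ⟨{
    Gr := fun r t => fderiv ℝ F (r, t) (1, 0)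
    Gt := fun r t => fderiv ℝ F (r, t) (0, 1)
    Grr := fun r t => fderiv ℝ (fderiv ℝ F) (r, t) (1, 0) (1, 0)
    Grt := fun r t => fderiv ℝ (fderiv ℝ F) (r, t) (1, 0) (0, 1)
    Gtt := fun r t => fderiv ℝ (fderiv ℝ F) (r, t) (0, 1) (0, 1)
    G_r := fun r t hr => (d1 r t hr).hasDerivAt_fst
    G_t := fun r t hr => (d1 r t hr).hasDerivAt_snd
    Gr_r := fun r t hr => (d2 (1, 0) r t hr).hasDerivAt_fst
    Gr_t := fun r t hr => by
      rw [symm r t hr]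
      exact (d2 (1, 0) r t hr).hasDerivAt_snd
    Gt_r := fun r t hr => (d2 (0, 1) r t hr).hasDerivAt_fst
    Gt_t := fun r t hr => (d2 (0, 1) r t hr).hasDerivAt_snd
    cont := hG.continuousOn
    cont_r := c1 _
    cont_t := c1 _
    cont_rr := c2 _ _
    cont_rt := c2 _ _ }⟩

lemma hasFDerivAt_norm {V : Type*} [NormedAddCommGroup V] [InnerProductSpace ℝ V] {x : V}
    (hx : x ≠ 0) : HasFDerivAt (fun y : V => ‖y‖) ((1 / ‖x‖) • innerSL ℝ x) x := by
  have hn : ‖x‖ ^ 2 ≠ 0 := by positivity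
  have h := (Real.hasDerivAt_sqrt hn).comp_hasFDerivAt x (hasStrictFDerivAt_norm_sq x).hasFDerivAt
  have e1 : (Real.sqrt ∘ fun y : V => ‖y‖ ^ 2) = fun y => ‖y‖ := by
    funext y; simp
  rw [e1, Real.sqrt_sq (norm_nonneg x)] at h
  refine h.congr_fderiv ?_
  rw [two_smul, ← two_smul ℝ, smul_smul]
  congr 1
  field_simp

/-- The first derivative of a radial function. -/
lemma hasFDerivAt_radial {V : Type*} [NormedAddCommGroup V] [InnerProductSpace ℝ V] {g : ℝ → ℝ}
    {g' : ℝ} {x : V} (hx : x ≠ 0) (hg : HasDerivAt g g' ‖x‖) :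
    HasFDerivAt (fun y => g ‖y‖) ((g' / ‖x‖) • innerSL ℝ x) x := by
  refine (hg.comp_hasFDerivAt x (hasFDerivAt_norm hx)).congr_fderiv ?_
  rw [smul_smul]
  congr 1
  ring

lemma norm_gradient_radial {V : Type*} [NormedAddCommGroup V] [InnerProductSpace ℝ V]
    [CompleteSpace V] {g : ℝ → ℝ} {g' : ℝ} {x : V} (hx : x ≠ 0) (hg : HasDerivAt g g' ‖x‖) :
    ‖gradient (fun y => g ‖y‖) x‖ ^ 2 = g' ^ 2 := by
  rw [gradient, LinearIsometryEquiv.norm_map, (hasFDerivAt_radial hx hg).fderiv, norm_smul,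
    innerSL_apply_norm, norm_div, norm_norm, div_mul_cancel₀ _ (norm_ne_zero_iff.2 hx),
    Real.norm_eq_abs, sq_abs]

/-- The Laplacian of a radial function. -/
lemma lap_radial {d : ℕ} {g g₁ : ℝ → ℝ} {g₂ : ℝ} {x : EuclideanSpace ℝ (Fin d)} (hx : x ≠ 0)
    (hg : ∀ r, 0 < r → HasDerivAt g (g₁ r) r) (hg₁ : HasDerivAt g₁ g₂ ‖x‖) :
    lap (fun y => g ‖y‖) x = g₂ + (d - 1) / ‖x‖ * g₁ ‖x‖ := by
  have hr : 0 < ‖x‖ := norm_pos_iff.2 hx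
  have hfd : fderiv ℝ (fun y : EuclideanSpace ℝ (Fin d) => g ‖y‖)
      =ᶠ[𝓝 x] fun y => (g₁ ‖y‖ / ‖y‖) • innerSL ℝ y := by
    filter_upwards [isOpen_compl_singleton.mem_nhds hx] with y hy
    exact (hasFDerivAt_radial hy (hg _ (norm_pos_iff.2 hy))).fderiv
  have h1 := hasFDerivAt_radial hx (hg₁.div (hasDerivAt_id ‖x‖) hr.ne')
  have h2 := h1.fun_smul (innerSL ℝ (E := EuclideanSpace ℝ (Fin d))).hasFDerivAt
  have h3 := (h2.congr_of_eventuallyEq hfd).fderiv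
  have hs : ‖x‖ ^ 2 = ∑ i, x i ^ 2 := EuclideanSpace.real_norm_sq_eq x
  unfold lap
  have h4 : ∀ i : Fin d, iteratedFDeriv ℝ 2 (fun y : EuclideanSpace ℝ (Fin d) => g ‖y‖) x
      ![EuclideanSpace.single i 1, EuclideanSpace.single i 1]
      = g₁ ‖x‖ / ‖x‖ + (g₂ / ‖x‖ ^ 2 - g₁ ‖x‖ / ‖x‖ ^ 3) * x i ^ 2 := fun i => by
    rw [iteratedFDeriv_two_apply, h3]
    change g₁ ‖x‖ / ‖x‖ * inner ℝ (EuclideanSpace.single i (1 : ℝ)) (EuclideanSpace.single i 1)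
      + (g₂ * ‖x‖ - g₁ ‖x‖ * 1) / ‖x‖ ^ 2 / ‖x‖ * inner ℝ x (EuclideanSpace.single i 1)
        * inner ℝ x (EuclideanSpace.single i 1) = _
    simp only [EuclideanSpace.inner_single_right, PiLp.single_apply, if_true, map_one, one_mul,
      mul_one, conj_trivial]
    field_simp
  rw [Finset.sum_congr rfl fun i _ => h4 i, Finset.sum_add_distrib, ← Finset.mul_sum, ← hs]
  simp
  field_simp
  ring

lemma contPos_rpow (m : ℝ) : ContPos fun r _ => r ^ m :=
  ContPos.of_fst (continuousOn_id.rpow_const fun _ hx => Or.inl (ne_of_gt hx))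

lemma hasDerivAt_rpow_mul (m : ℝ) {f : ℝ → ℝ} {f' r : ℝ} (hr : 0 < r) (hf : HasDerivAt f f' r) :
    HasDerivAt (fun x => x ^ m * f x) (r ^ m * (m * (1 / r) * f r + f')) r := by
  refine ((Real.hasDerivAt_rpow_const (p := m) (Or.inl hr.ne')).fun_mul hf).congr_deriv ?_
  rw [Real.rpow_sub_one hr.ne']
  ring

/-- A radial solution `G` of the Coulomb wave equation yields the wave `r^m G` on the half line. -/
lemma HalfPlaneC2.exists_radialWave {G : ℝ → ℝ → ℝ} (D : HalfPlaneC2 G) (m : ℝ)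
    (heq : ∀ r t, 0 < r → D.Gtt r t - (D.Grr r t + 2 * m / r * D.Gr r t) + G r t / r = 0)
    (hnear : ∀ T : ℝ, ∃ C, ∀ r t, 0 < r → r ≤ 1 → |t| ≤ T → |G r t| ≤ C) :
    ∃ z : RadialWave m, ∀ r t, 0 < r → z.eu r t
      = r ^ (2 * m) * ((D.Gr r t ^ 2 + D.Gt r t ^ 2 + 1 / r * G r t ^ 2) / 2) := by
  have cm := contPos_rpow m
  refine ⟨{
    w := fun r t => r ^ m * G r t
    a := fun r t => r ^ m * (m * (1 / r) * G r t + D.Gr r t)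
    b := fun r t => r ^ m * D.Gt r t
    ar := fun r t => r ^ m * (m * (m - 1) * (1 / r) ^ 2 * G r t + 2 * m * (1 / r) * D.Gr r t
      + D.Grr r t)
    c := fun r t => r ^ m * (m * (1 / r) * D.Gt r t + D.Grt r t)
    w_r := fun r t hr => hasDerivAt_rpow_mul m hr (D.G_r r t hr)
    w_t := fun r t hr => (D.G_t r t hr).const_mul _
    a_r := fun r t hr => ?_
    a_t := fun r t hr => (((D.G_t r t hr).const_mul _).add (D.Gr_t r t hr)).const_mul _
    b_r := fun r t hr => hasDerivAt_rpow_mul m hr (D.Gt_r r t hr)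
    b_t := fun r t hr => ?_
    cont_w := cm.mul D.cont
    cont_a := cm.mul (((contPos_inv.const_mul m).mul D.cont).add D.cont_r)
    cont_b := cm.mul D.cont_t
    cont_ar := cm.mul (((((contPos_inv.pow 2).const_mul (m * (m - 1))).mul D.cont).add
      ((contPos_inv.const_mul (2 * m)).mul D.cont_r)).add D.cont_rr)
    cont_c := cm.mul (((contPos_inv.const_mul m).mul D.cont_t).add D.cont_rt)
    near := fun T => ?_ }, fun r t hr => ?_⟩
  · have h1 : HasDerivAt (fun x : ℝ => m * (1 / x)) (m * (-1 / r ^ 2)) r := by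
      simpa [neg_div] using ((hasDerivAt_id r).fun_inv hr.ne').const_mul m
    refine (hasDerivAt_rpow_mul m hr ((h1.fun_mul (D.G_r r t hr)).fun_add (D.Gr_r r t hr))).congr_deriv ?_
    ring
  · refine ((D.Gt_t r t hr).const_mul (r ^ m)).congr_deriv ?_
    have h := heq r t hr
    have h2 : D.Gtt r t = D.Grr r t + 2 * m / r * D.Gr r t - G r t / r := by linarith
    rw [h2, effPot]
    ring
  · obtain ⟨C, hC⟩ := hnear T
    refine ⟨C, fun r t hr hr1 ht => ?_⟩
    rw [abs_mul, abs_of_pos (Real.rpow_pos_of_pos hr m), mul_comm]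
    gcongr
    exact hC r t hr hr1 ht
  · have h2 : r ^ (2 * m) = (r ^ m) ^ 2 := by
      rw [mul_comm, Real.rpow_mul hr.le, Real.rpow_two]
    rw [h2, RadialWave.eu]
    ring

/-- Integrals over a subset of the half line are limits of integrals over compact parts. -/
lemma tendsto_setIntegral_inter_Ioc {f : ℝ → ℝ} (hf : IntegrableOn f (Ioi 0)) {s : Set ℝ}
    (hs : MeasurableSet s) (hs0 : s ⊆ Ioi 0) :
    Tendsto (fun n : ℕ => ∫ r in s ∩ Ioc (1 / (n + 1 : ℝ)) (n + 1), f r) atTop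
      (𝓝 (∫ r in s, f r)) := by
  have hU : ⋃ n : ℕ, s ∩ Ioc (1 / (n + 1 : ℝ)) (n + 1) = s := by
    refine subset_antisymm (iUnion_subset fun n => inter_subset_left) fun x hx => ?_
    have hx0 : 0 < x := hs0 hx
    obtain ⟨n₁, h₁⟩ := exists_nat_one_div_lt hx0
    obtain ⟨n₂, h₂⟩ := exists_nat_ge x
    refine mem_iUnion.2 ⟨max n₁ n₂, hx, lt_of_le_of_lt ?_ h₁, ?_⟩
    · exact Nat.one_div_le_one_div (le_max_left _ _)
    · have : (n₂ : ℝ) ≤ (max n₁ n₂ : ℕ) := by exact_mod_cast le_max_right _ _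
      linarith
  have h := tendsto_setIntegral_of_monotone (μ := volume) (f := f)
    (s := fun n : ℕ => s ∩ Ioc (1 / (n + 1 : ℝ)) (n + 1))
    (fun n => hs.inter measurableSet_Ioc) (fun i j hij => by
      refine inter_subset_inter_right _ (Ioc_subset_Ioc (Nat.one_div_le_one_div hij) ?_)
      gcongr) (by rw [hU]; exact hf.mono_set hs0)
  rwa [hU] at h

namespace RadialWave
variable {m : ℝ}

lemma setIntegral_le_of_intervals (z : RadialWave m) {t K : ℝ}
    (hf : IntegrableOn (fun r => z.eu r t) (Ioi 0)) (hK0 : 0 ≤ K) {p q : ℝ} (hp : 0 ≤ p)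
    (hK : ∀ c d, 0 < c → p ≤ c → c ≤ d → d ≤ q → ∫ r in c..d, z.eu r t ≤ K) :
    ∫ r in Ioc p q, z.eu r t ≤ K := by
  refine le_of_tendsto' (tendsto_setIntegral_inter_Ioc hf measurableSet_Ioc fun r hr =>
    hp.trans_lt hr.1) fun n => ?_
  rw [Ioc_inter_Ioc]
  rcases le_total (max p (1 / (n + 1 : ℝ))) (min q (n + 1)) with h | h
  · rw [← intervalIntegral.integral_of_le h]
    exact hK _ _ (lt_max_of_lt_right (by positivity)) (le_max_left _ _) h (min_le_left _ _)
  · rw [Ioc_eq_empty h.not_gt]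
    simpa using hK0

lemma setIntegral_Ioi_le_of_intervals (z : RadialWave m) {t K : ℝ}
    (hf : IntegrableOn (fun r => z.eu r t) (Ioi 0)) (hK0 : 0 ≤ K) {p : ℝ} (hp : 0 ≤ p)
    (hK : ∀ c d, 0 < c → p ≤ c → c ≤ d → ∫ r in c..d, z.eu r t ≤ K) :
    ∫ r in Ioi p, z.eu r t ≤ K := by
  refine le_of_tendsto' (tendsto_setIntegral_inter_Ioc hf measurableSet_Ioi fun r hr =>
    hp.trans_lt hr) fun n => ?_
  rw [inter_comm, Ioc_inter_Ioi]
  rcases le_total (max (1 / (n + 1 : ℝ)) p) (n + 1) with h | h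
  · rw [← intervalIntegral.integral_of_le h]
    exact hK _ _ (lt_max_of_lt_left (by positivity)) (le_max_right _ _) h
  · rw [Ioc_eq_empty h.not_gt]
    simpa using hK0

lemma finiteEnergy_of_integral (z : RadialWave m) {E' : ℝ}
    (hi : ∀ t, IntegrableOn (fun r => z.eu r t) (Ioi 0))
    (hE : ∀ t, ∫ r in Ioi 0, z.eu r t = E') : z.FiniteEnergy E' where
  le t c d hc hcd := by
    rw [intervalIntegral.integral_of_le hcd, ← hE t]
    refine setIntegral_mono_set (hi t) ?_ (Eventually.of_forall fun r hr => hc.trans hr.1)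
    exact (ae_restrict_mem measurableSet_Ioi).mono fun r hr => z.eu_nonneg hr t
  core ε hε := by
    have h := tendsto_setIntegral_inter_Ioc (hi 0) measurableSet_Ioi subset_rfl
    rw [hE 0] at h
    obtain ⟨n, hn⟩ := (h.eventually_const_le (sub_lt_self E' hε)).exists
    have h1 : (1 / (n + 1 : ℝ)) ≤ n + 1 := by
      have : (0 : ℝ) ≤ n := n.cast_nonneg
      rw [div_le_iff₀ (by positivity)]
      nlinarith
    have h0 : 0 < 1 / (n + 1 : ℝ) := by positivity
    refine ⟨1 / (n + 1), n + 1, h0, h1, ?_⟩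
    rwa [intervalIntegral.integral_of_le h1, ← inter_eq_self_of_subset_right
      (Ioc_subset_Ioi_self.trans (Ioi_subset_Ioi h0.le))]

/-- The energy of a finite-energy wave concentrates along the light cone. -/
theorem FiniteEnergy.tendsto_annulus (hm : Adm m) {z : RadialWave m} {E' : ℝ}
    (hi : ∀ t, IntegrableOn (fun r => z.eu r t) (Ioi 0))
    (hE : ∀ t, ∫ r in Ioi 0, z.eu r t = E') {ℓ : ℝ → ℝ}
    (hℓ : Tendsto (fun t => ℓ t / Real.log t) atTop atTop) (η : ℝ) :
    Tendsto (fun t => ∫ r in Ioi 0 ∩ Ioo (t - ℓ t) (t - η), z.eu r t) atTop (𝓝 E') := by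
  have hF := z.finiteEnergy_of_integral hi hE
  rw [Metric.tendsto_nhds]
  intro ε hε
  filter_upwards [hF.interior hm hℓ (show 0 < ε / 3 by positivity),
    hF.exterior hm η (show 0 < ε / 3 by positivity), eventually_gt_atTop η] with t h1 h2 h3
  have i1 := z.setIntegral_le_of_intervals (hi t) (by positivity) le_rfl (q := t - ℓ t)
    fun c d hc _ hcd hd => h1 c d hc hcd hd
  have i2 := z.setIntegral_Ioi_le_of_intervals (hi t) (by positivity) (sub_nonneg.2 h3.le)
    fun c d hc hpc hcd => h2 c d hc hpc hcd
  have hsub3 : Ioi 0 ∩ Ioo (t - ℓ t) (t - η) ⊆ Ioi (0 : ℝ) := inter_subset_left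
  have lower : E' ≤ (∫ r in Ioi 0 ∩ Ioo (t - ℓ t) (t - η), z.eu r t) + ε / 3 + ε / 3 := by
    have hIci : Ici (t - η) ⊆ Ioi 0 := fun r hr => (sub_pos.2 h3).trans_le hr
    have d1 := integral_inter_add_sdiff (measurableSet_Iic (a := t - ℓ t)) (hi t)
    have d2 := integral_inter_add_sdiff (measurableSet_Ici (a := t - η))
      ((hi t).mono_set (sdiff_subset (s := Ioi 0) (t := Iic (t - ℓ t))))
    have e1 : (Ioi 0 \ Iic (t - ℓ t)) \ Ici (t - η) = Ioi 0 ∩ Ioo (t - ℓ t) (t - η) := by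
      ext r
      simp only [Set.mem_sdiff, mem_inter_iff, mem_Ioi, mem_Iic, mem_Ici, mem_Ioo, not_le, and_assoc]
    have d3 : ∫ r in (Ioi 0 \ Iic (t - ℓ t)) ∩ Ici (t - η), z.eu r t
        ≤ ∫ r in Ici (t - η), z.eu r t := by
      refine setIntegral_mono_set ((hi t).mono_set hIci) ?_
        (Eventually.of_forall fun r hr => hr.2)
      exact (ae_restrict_mem measurableSet_Ici).mono fun r hr => z.eu_nonneg (hIci hr) t
    rw [Ioi_inter_Iic, hE t] at d1
    rw [e1] at d2
    rw [integral_Ici_eq_integral_Ioi] at d3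
    linarith
  have upper : ∫ r in Ioi 0 ∩ Ioo (t - ℓ t) (t - η), z.eu r t ≤ E' := by
    rw [← hE t]
    refine setIntegral_mono_set (hi t) ?_ (Eventually.of_forall hsub3)
    exact (ae_restrict_mem measurableSet_Ioi).mono fun r hr => z.eu_nonneg hr t
  rw [Real.dist_eq, abs_lt]
  constructor <;> linarith

end RadialWave

/-- Integrals of radial functions over spherical shells, in polar coordinates. -/
lemma setIntegral_radial {d : ℕ} (hd : 0 < d) {f : EuclideanSpace ℝ (Fin d) → ℝ} {φ : ℝ → ℝ}
    (hf : ∀ x, x ≠ 0 → f x = φ ‖x‖) {A : Set ℝ} (hA : MeasurableSet A) :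
    ∫ x in {x | ‖x‖ ∈ A}, f x = (d * volume.real (Metric.ball (0 : EuclideanSpace ℝ (Fin d)) 1))
      * ∫ r in Ioi 0 ∩ A, r ^ (d - 1) * φ r := by
  have : Nonempty (Fin d) := ⟨⟨0, hd⟩⟩
  have hne : ∀ᵐ x : EuclideanSpace ℝ (Fin d), x ≠ 0 := by
    simp [ae_iff]
  have hmeas : MeasurableSet {x : EuclideanSpace ℝ (Fin d) | ‖x‖ ∈ A} := measurable_norm hA
  have h1 : ∫ x in {x | ‖x‖ ∈ A}, f x
      = ∫ x : EuclideanSpace ℝ (Fin d), A.indicator φ ‖x‖ := by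
    rw [← integral_indicator hmeas]
    refine integral_congr_ae (hne.mono fun x hx => ?_)
    by_cases h : ‖x‖ ∈ A
    · simp [indicator, h, hf x hx]
    · simp [indicator, h]
  rw [h1, integral_fun_norm_addHaar, ← setIntegral_indicator hA]
  simp only [finrank_euclideanSpace, Fintype.card_fin, nsmul_eq_mul, smul_eq_mul, mul_assoc]
  congr 2
  refine setIntegral_congr_fun measurableSet_Ioi fun r _ => ?_
  by_cases h : r ∈ A <;> simp [indicator, h]

lemma integrableOn_radial {d : ℕ} (hd : 0 < d) {f : EuclideanSpace ℝ (Fin d) → ℝ} {φ : ℝ → ℝ}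
    (hf : ∀ x, x ≠ 0 → f x = φ ‖x‖) (hi : Integrable f) :
    IntegrableOn (fun r => r ^ (d - 1) * φ r) (Ioi 0) := by
  have : Nonempty (Fin d) := ⟨⟨0, hd⟩⟩
  have hne : ∀ᵐ x : EuclideanSpace ℝ (Fin d), x ≠ 0 := by
    simp [ae_iff]
  have h := (integrable_fun_norm_addHaar volume (f := φ)).1 (hi.congr (hne.mono hf))
  simpa using h

variable {d : ℕ} {u : EuclideanSpace ℝ (Fin d) → ℝ → ℝ}

/-- The radial profile of a radial function. -/
noncomputable def radialPart (i : Fin d) (u : EuclideanSpace ℝ (Fin d) → ℝ → ℝ) (r t : ℝ) : ℝ :=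
  u (r • EuclideanSpace.single i 1) t

lemma norm_smul_single (i : Fin d) {r : ℝ} (hr : 0 ≤ r) :
    ‖r • EuclideanSpace.single i (1 : ℝ)‖ = r := by
  simp [norm_smul, abs_of_nonneg hr]

lemma radialPart_norm (i : Fin d)
    (hrad : ∀ (t : ℝ) (x y : EuclideanSpace ℝ (Fin d)), ‖x‖ = ‖y‖ → u x t = u y t)
    (x : EuclideanSpace ℝ (Fin d)) : u x = radialPart i u ‖x‖ := by
  funext t
  exact hrad t _ _ (norm_smul_single i (norm_nonneg x)).symm

lemma IsFreeCoulombWave.halfPlaneC2 {E : ℝ} (hu : IsFreeCoulombWave u E) (i : Fin d) :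
    Nonempty (HalfPlaneC2 (radialPart i u)) := by
  refine HalfPlaneC2.exists_of_contDiffOn
    (hu.2.1.comp (f := fun q : ℝ × ℝ => (q.1 • EuclideanSpace.single i (1 : ℝ), q.2))
      (ContDiff.contDiffOn (by fun_prop)) fun q hq => ⟨?_, trivial⟩)
  have : q.1 ≠ 0 := ne_of_gt hq.1
  simpa using this

/-- A radial Coulomb wave is governed by a wave on the half line. -/
lemma IsFreeCoulombWave.exists_radialWave {E : ℝ} (hu : IsFreeCoulombWave u E) (hd : 0 < d)
    (hrad : ∀ (t : ℝ) (x y : EuclideanSpace ℝ (Fin d)), ‖x‖ = ‖y‖ → u x t = u y t) :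
    ∃ (z : RadialWave ((d - 1 : ℝ) / 2)) (φ : ℝ → ℝ → ℝ),
      (∀ x t, x ≠ 0 → eDenFree u x t = φ ‖x‖ t) ∧
      ∀ r t, 0 < r → z.eu r t = r ^ (d - 1) * φ r t := by
  set i : Fin d := ⟨0, hd⟩
  obtain ⟨D⟩ := hu.halfPlaneC2 i
  have hG := radialPart_norm i hrad
  have hgrad : ∀ t, (fun y => u y t) = fun y => radialPart i u ‖y‖ t := fun t => by
    funext y; rw [hG y]
  have heq : ∀ r t, 0 < r → D.Gtt r t - (D.Grr r t + 2 * ((d - 1 : ℝ) / 2) / r * D.Gr r t)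
      + radialPart i u r t / r = 0 := fun r t hr => by
    set x : EuclideanSpace ℝ (Fin d) := r • EuclideanSpace.single i (1 : ℝ) with hx
    have hxr : ‖x‖ = r := norm_smul_single i hr.le
    have hx0 : x ≠ 0 := norm_pos_iff.1 (by rwa [hxr])
    have h := hu.2.2.1 x hx0 t
    have h1 : deriv (radialPart i u r) = D.Gt r := funext fun s => (D.G_t r s hr).deriv
    rw [hgrad, hG x, hxr, h1, (D.Gt_t r t hr).deriv, lap_radial hx0 (fun s hs => D.G_r s t hs)
      (by rw [hxr]; exact D.Gr_r r t hr), hxr] at h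
    rw [mul_div_cancel₀ _ (two_ne_zero' ℝ)]
    exact h
  have hnear : ∀ T : ℝ, ∃ C, ∀ r t, 0 < r → r ≤ 1 → |t| ≤ T → |radialPart i u r t| ≤ C :=
      fun T => by
    have hc : ContinuousOn (fun q : ℝ × ℝ => radialPart i u q.1 q.2) (Icc 0 1 ×ˢ Icc (-T) T) :=
      (hu.1.comp (f := fun q : ℝ × ℝ => (q.1 • EuclideanSpace.single i (1 : ℝ), q.2))
        (by fun_prop)).continuousOn
    obtain ⟨C, hC⟩ := (isCompact_Icc.prod isCompact_Icc).exists_bound_of_continuousOn hc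
    exact ⟨C, fun r t hr hr1 ht => hC (r, t) ⟨⟨hr.le, hr1⟩, abs_le.1 ht⟩⟩
  obtain ⟨z, hz⟩ := D.exists_radialWave ((d - 1 : ℝ) / 2) heq hnear
  refine ⟨z, fun r t => (D.Gr r t ^ 2 + D.Gt r t ^ 2 + 1 / r * radialPart i u r t ^ 2) / 2,
    fun x t hx => ?_, fun r t hr => ?_⟩
  · have hr : 0 < ‖x‖ := norm_pos_iff.2 hx
    rw [eDenFree, hgrad, norm_gradient_radial hx (D.G_r _ t hr), hG x, (D.G_t _ t hr).deriv]
    field_simp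
  · rw [hz r t hr]
    congr 1
    rw [← Real.rpow_natCast, Nat.cast_sub hd]
    congr 1
    push_cast
    ring

end

/-- For a radial finite-energy free Coulomb wave with energy
`E` and any `ℓ` with `ℓ(t)/ln t → ∞`, the energy in the annulus
`t - ℓ(t) < |x| < t - η` tends to `E` as `t → +∞`. -/
theorem stmt10 (d : ℕ) (hd : 3 ≤ d)
    (u : EuclideanSpace ℝ (Fin d) → ℝ → ℝ) (E : ℝ)
    (hu : IsFreeCoulombWave u E)
    (hrad : ∀ (t : ℝ) (x y : EuclideanSpace ℝ (Fin d)), ‖x‖ = ‖y‖ → u x t = u y t)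
    (ℓ : ℝ → ℝ) (hℓpos : ∀ t : ℝ, 0 < t → 0 < ℓ t)
    (hℓ : Tendsto (fun t => ℓ t / Real.log t) atTop atTop)
    (η : ℝ) :
    Tendsto (fun t : ℝ =>
        ∫ x in {x : EuclideanSpace ℝ (Fin d) | t - ℓ t < ‖x‖ ∧ ‖x‖ < t - η},
          eDenFree u x t)
      atTop (nhds E) := by
  have hd0 : 0 < d := by omega
  obtain ⟨z, φ, hφ, hz⟩ := hu.exists_radialWave hd0 hrad
  have hm : Adm ((d - 1 : ℝ) / 2) := by
    rcases hd.eq_or_lt with rfl | h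
    · left; norm_num
    · right
      have : (4 : ℝ) ≤ d := by exact_mod_cast h
      linarith
  set κ := d * volume.real (Metric.ball (0 : EuclideanSpace ℝ (Fin d)) 1) with hκ
  have hκ0 : 0 < κ := by
    have := Metric.isOpen_ball.measure_pos (volume : Measure (EuclideanSpace ℝ (Fin d)))
      ⟨0, Metric.mem_ball_self zero_lt_one⟩
    have h2 : 0 < volume.real (Metric.ball (0 : EuclideanSpace ℝ (Fin d)) 1) :=
      ENNReal.toReal_pos this.ne' measure_ball_lt_top.ne
    positivity
  have shell : ∀ t (A : Set ℝ), MeasurableSet A →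
      ∫ x in {x : EuclideanSpace ℝ (Fin d) | ‖x‖ ∈ A}, eDenFree u x t
        = κ * ∫ r in Set.Ioi 0 ∩ A, z.eu r t := fun t A hA => by
    rw [setIntegral_radial hd0 (φ := fun r => φ r t) (fun x hx => hφ x t hx) hA, ← hκ]
    congr 1
    exact setIntegral_congr_fun (measurableSet_Ioi.inter hA) fun r hr => (hz r t hr.1).symm
  have hi : ∀ t, IntegrableOn (fun r => z.eu r t) (Set.Ioi 0) := fun t =>
    (integrableOn_radial hd0 (φ := fun r => φ r t) (fun x hx => hφ x t hx) (hu.2.2.2.1 t)).congr_fun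
      (fun r hr => (hz r t hr).symm) measurableSet_Ioi
  have hE : ∀ t, ∫ r in Set.Ioi 0, z.eu r t = E / κ := fun t => by
    have h := shell t Set.univ MeasurableSet.univ
    simp only [Set.mem_univ, Set.ofPred_true, setIntegral_univ, Set.inter_univ, hu.2.2.2.2 t] at h
    rw [h, mul_div_cancel_left₀ _ hκ0.ne']
  have key := (RadialWave.FiniteEnergy.tendsto_annulus hm hi hE hℓ η).const_mul κ
  rw [mul_div_cancel₀ _ hκ0.ne'] at key
  exact key.congr fun t => (shell t (Set.Ioo (t - ℓ t) (t - η)) measurableSet_Ioo).symm
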